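/- arXiv:2202.08323 — 2 statements merged into one kernel-verified Lean document; each statement's English description precedes it below -/
import Mathlib

section
/- Let n ≥ 2 and let T be a symmetric positive semidefinite n×n real matrix with eigenvalues μ_1 ≥ μ_2 ≥ ⋯ ≥ μ_n ≥ 0 counted with multiplicity, with μ_1 > 0, and let e₁ be a unit eigenvector of T for the eigenvalue μ_1. Let ε ∈ (0,1] satisfy μ_2 < ε²·μ_1. Then for every nonzero v ∈ ℝⁿ with |⟨v,e₁⟩| ≥ ε·‖v‖, the vector T·v is nonzero and ‖T·v − ⟨T·v,e₁⟩·e₁‖ < ε·‖T·v‖ (i.e. the sine of the angle between T·v and the line ℝe₁ is less than ε). -/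
open Matrix

/-- The Euclidean norm of a vector in `ℝ^n`. -/
noncomputable def euclNorm {n : ℕ} (v : Fin n → ℝ) : ℝ :=
  Real.sqrt (∑ i, v i ^ 2)

/-- The standard inner product on `ℝ^n`. -/
def dotp {n : ℕ} (v w : Fin n → ℝ) : ℝ := ∑ i, v i * w i

theorem dotp_eq_dotProduct {n : ℕ} (v w : Fin n → ℝ) : dotp v w = v ⬝ᵥ w := rfl

theorem euclNorm_nonneg {n : ℕ} (v : Fin n → ℝ) : 0 ≤ euclNorm v :=
  Real.sqrt_nonneg _

theorem euclNorm_sq {n : ℕ} (v : Fin n → ℝ) : euclNorm v ^ 2 = dotp v v := by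
  rw [euclNorm, Real.sq_sqrt (Finset.sum_nonneg fun i _ => sq_nonneg (v i)), dotp]
  exact Finset.sum_congr rfl fun i _ => sq (v i)

theorem euclNorm_pos {n : ℕ} {v : Fin n → ℝ} (hv : v ≠ 0) : 0 < euclNorm v := by
  refine (euclNorm_nonneg v).lt_of_ne fun h => hv ?_
  rw [← dotProduct_self_eq_zero, ← dotp_eq_dotProduct, ← euclNorm_sq, ← h]
  norm_num

/-- Parseval's identity for an orthonormal family of `n` vectors in `ℝ^n`. -/
theorem dotp_eq_sum_of_orthonormal {n : ℕ} {e : Fin n → Fin n → ℝ}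
    (he : ∀ i j, dotp (e i) (e j) = if i = j then 1 else 0) (x y : Fin n → ℝ) :
    dotp x y = ∑ i, dotp (e i) x * dotp (e i) y := by
  have hE : Matrix.of e * (Matrix.of e)ᵀ = 1 := by
    ext i j
    rw [Matrix.one_apply, ← he i j]
    rfl
  have h : (Matrix.of e *ᵥ x) ⬝ᵥ (Matrix.of e *ᵥ y) = x ⬝ᵥ y := by
    rw [Matrix.dotProduct_mulVec, Matrix.vecMul_mulVec, ← Matrix.dotProduct_mulVec,
      ← Matrix.mulVec_mulVec, Matrix.mulVec_mulVec, mul_eq_one_comm.mp hE, Matrix.one_mulVec]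
  exact h.symm

theorem dotp_mulVec_of_eigenvector {n : ℕ} {T : Matrix (Fin n) (Fin n) ℝ} (hT : T.IsSymm)
    {u : Fin n → ℝ} {c : ℝ} (hu : T.mulVec u = c • u) (x : Fin n → ℝ) :
    dotp u (T.mulVec x) = c * dotp u x := by
  rw [dotp_eq_dotProduct, Matrix.dotProduct_mulVec, ← Matrix.mulVec_transpose, hT.eq, hu,
    smul_dotProduct, smul_eq_mul, dotp_eq_dotProduct]

theorem stmt10 (n : ℕ) (hn : 2 ≤ n)
    (T : Matrix (Fin n) (Fin n) ℝ) (hsymm : T.IsSymm) (hpsd : T.PosSemidef)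
    (μ : Fin n → ℝ) (hμanti : Antitone μ)
    (hμlast : 0 ≤ μ ⟨n - 1, by omega⟩)
    (e : Fin n → (Fin n → ℝ))
    (he_orth : ∀ i j, dotp (e i) (e j) = if i = j then 1 else 0)
    (he_eig : ∀ i, T.mulVec (e i) = μ i • e i)
    (hμ1pos : 0 < μ ⟨0, by omega⟩)
    (e₁ : Fin n → ℝ) (he₁unit : euclNorm e₁ = 1)
    (he₁eig : T.mulVec e₁ = μ ⟨0, by omega⟩ • e₁)
    (ε : ℝ) (hε0 : 0 < ε) (hε1 : ε ≤ 1)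
    (hgap : μ ⟨1, by omega⟩ < ε ^ 2 * μ ⟨0, by omega⟩) :
    ∀ v : Fin n → ℝ, v ≠ 0 → ε * euclNorm v ≤ |dotp v e₁| →
      T.mulVec v ≠ 0 ∧
      euclNorm (T.mulVec v - dotp (T.mulVec v) e₁ • e₁) < ε * euclNorm (T.mulVec v) := by
  intro v hv hve
  have hμnonneg (i : Fin n) : 0 ≤ μ i :=
    hμlast.trans (hμanti (Fin.le_def.2 (by have := i.2; simp only; omega)))
  set o : Fin n := ⟨0, by omega⟩
  set p : Fin n := ⟨1, by omega⟩
  have hle (i : Fin n) (hi : i ≠ o) : μ i ≤ μ p :=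
    hμanti (Fin.le_def.2 (Nat.one_le_iff_ne_zero.2 fun h => hi (Fin.ext h)))
  have hT (i : Fin n) (x : Fin n → ℝ) : dotp (e i) (T.mulVec x) = μ i * dotp (e i) x :=
    dotp_mulVec_of_eigenvector hsymm (he_eig i) x
  have hperp (i : Fin n) (hi : i ≠ o) : dotp (e i) e₁ = 0 := by
    have h := hT i e₁
    rw [he₁eig, dotp_eq_dotProduct, dotProduct_smul, smul_eq_mul, ← dotp_eq_dotProduct] at h
    have hlt : μ i < μ o := (hle i hi).trans_lt <| hgap.trans_le <|
      mul_le_of_le_one_left hμ1pos.le (pow_le_one₀ hε0.le hε1)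
    exact (mul_eq_mul_right_iff.1 h).resolve_left hlt.ne'
  have hdot (x : Fin n → ℝ) : dotp x e₁ = dotp (e o) x * dotp (e o) e₁ := by
    rw [dotp_eq_sum_of_orthonormal he_orth]
    exact Finset.sum_eq_single o (fun i _ hi => by rw [hperp i hi, mul_zero]) (by simp)
  have hs : dotp (e o) e₁ * dotp (e o) e₁ = 1 := by
    rw [← hdot, ← euclNorm_sq, he₁unit, one_pow]
  have hnorm (x : Fin n → ℝ) : euclNorm x ^ 2 = ∑ i, dotp (e i) x ^ 2 := by
    rw [euclNorm_sq, dotp_eq_sum_of_orthonormal he_orth]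
    exact Finset.sum_congr rfl fun i _ => (sq _).symm
  have habs : |dotp v e₁| = |dotp (e o) v| := by
    rw [← sq_eq_sq₀ (abs_nonneg _) (abs_nonneg _), sq_abs, sq_abs, hdot]
    linear_combination dotp (e o) v ^ 2 * hs
  have hvpos := euclNorm_pos hv
  have hTv : μ o * |dotp (e o) v| ≤ euclNorm (T.mulVec v) := by
    refine le_of_sq_le_sq ?_ (euclNorm_nonneg _)
    rw [hnorm, mul_pow, sq_abs, ← mul_pow, ← hT]
    exact Finset.single_le_sum (f := fun i => dotp (e i) (T.mulVec v) ^ 2)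
      (fun i _ => sq_nonneg _) (Finset.mem_univ o)
  have hrest : euclNorm (T.mulVec v - dotp (T.mulVec v) e₁ • e₁) ≤ μ p * euclNorm v := by
    refine le_of_sq_le_sq ?_ (mul_nonneg (hμnonneg p) (euclNorm_nonneg v))
    rw [mul_pow, hnorm, hnorm, Finset.mul_sum]
    refine Finset.sum_le_sum fun i _ => ?_
    have hi : dotp (e i) (T.mulVec v - dotp (T.mulVec v) e₁ • e₁) =
        μ i * dotp (e i) v - μ o * dotp (e o) v * dotp (e o) e₁ * dotp (e i) e₁ := by
      rw [dotp_eq_dotProduct, dotProduct_sub, dotProduct_smul, smul_eq_mul,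
        ← dotp_eq_dotProduct, ← dotp_eq_dotProduct, hT, hdot, hT]
    rw [hi]
    by_cases h : i = o
    · have h0 : μ o * dotp (e o) v - μ o * dotp (e o) v * dotp (e o) e₁ * dotp (e o) e₁ = 0 := by
        linear_combination -(μ o * dotp (e o) v) * hs
      rw [h, h0, zero_pow two_ne_zero]
      positivity
    · rw [hperp i h, mul_zero, sub_zero, mul_pow]
      have := hμnonneg i
      gcongr
      exact hle i h
  rw [habs] at hve
  have hTpos : 0 < euclNorm (T.mulVec v) :=
    (mul_pos hμ1pos ((mul_pos hε0 hvpos).trans_le hve)).trans_le hTv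
  refine ⟨fun h => ?_, ?_⟩
  · rw [h] at hTpos
    simp [euclNorm] at hTpos
  · calc
      _ ≤ μ p * euclNorm v := hrest
      _ < ε ^ 2 * μ o * euclNorm v := by gcongr
      _ = ε * (μ o * (ε * euclNorm v)) := by ring
      _ ≤ ε * (μ o * |dotp (e o) v|) := by gcongr
      _ ≤ ε * euclNorm (T.mulVec v) := by gcongr
end

section
/- Let d ≥ 2, let μ be a Haar measure on the locally compact group SL(d,ℝ), and for t > 0 let D_t := {g ∈ SL(d,ℝ) : ∑_{i=1}^d (log σ_i(g))² ≤ t²}, where σ_1(g),…,σ_d(g) are the singular values of g, i.e. the square roots of the eigenvalues of gᵀ·g. Let h be a polynomial with integer coefficients in the d² matrix entries which does not vanish identically on SL(d,ℝ). Then there exist κ_h > 0 and C > 0 such that for all t > 1: #{γ ∈ SL(d,ℤ) : γ ∈ D_t and h(γ) = 0} ≤ C·μ(D_t)^{1−κ_h}. -/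
open Matrix Polynomial MeasureTheory

/-- `SL(d,ℝ)` carries the topology induced from the space of matrices. -/
noncomputable instance SLRtop (d : ℕ) :
    TopologicalSpace (Matrix.SpecialLinearGroup (Fin d) ℝ) :=
  TopologicalSpace.induced (fun g => (g : Matrix (Fin d) (Fin d) ℝ)) inferInstance

noncomputable instance SLRmeas (d : ℕ) :
    MeasurableSpace (Matrix.SpecialLinearGroup (Fin d) ℝ) :=
  borel _

instance SLRborel (d : ℕ) :
    BorelSpace (Matrix.SpecialLinearGroup (Fin d) ℝ) := ⟨rfl⟩

/-- The canonical morphism `SL(d,ℤ) →* SL(d,ℝ)`. -/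
noncomputable def toSLR {d : ℕ} :
    Matrix.SpecialLinearGroup (Fin d) ℤ →* Matrix.SpecialLinearGroup (Fin d) ℝ :=
  Matrix.SpecialLinearGroup.map (Int.castRingHom ℝ)

/-- `Dt d t` is the set of `g ∈ SL(d,ℝ)` whose vector of logarithms of singular values
(the square roots of the eigenvalues of `gᵀ·g`) has Euclidean norm at most `t`. -/
def Dt (d : ℕ) (t : ℝ) : Set (Matrix.SpecialLinearGroup (Fin d) ℝ) :=
  {g | ∃ μ : Fin d → ℝ,
    ((g : Matrix (Fin d) (Fin d) ℝ)ᵀ * (g : Matrix (Fin d) (Fin d) ℝ)).charpoly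
      = ∏ i, (X - C (μ i)) ∧
    ∑ i, Real.log (Real.sqrt (μ i)) ^ 2 ≤ t ^ 2}

namespace SLCount

section

/-- The group `SL(d, ℝ)`. -/
abbrev SLR (d : ℕ) := Matrix.SpecialLinearGroup (Fin d) ℝ

variable {d : ℕ}

lemma isClosedEmbedding_coe :
    Topology.IsClosedEmbedding (fun g : SLR d => (g : Matrix (Fin d) (Fin d) ℝ)) :=
  Matrix.SpecialLinearGroup.isClosedEmbedding_val (R := ℝ) (n := Fin d)

instance : IsTopologicalGroup (SLR d) :=
  Matrix.SpecialLinearGroup.topologicalGroup (R := ℝ) (n := Fin d)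

instance : T2Space (SLR d) := isClosedEmbedding_coe.isEmbedding.t2Space

instance : SecondCountableTopology (SLR d) := by
  have : SecondCountableTopology (Matrix (Fin d) (Fin d) ℝ) :=
    inferInstanceAs (SecondCountableTopology (Fin d → Fin d → ℝ))
  exact isClosedEmbedding_coe.isEmbedding.secondCountableTopology

instance : LocallyCompactSpace (SLR d) := by
  have : LocallyCompactSpace (Matrix (Fin d) (Fin d) ℝ) :=
    inferInstanceAs (LocallyCompactSpace (Fin d → Fin d → ℝ))
  exact isClosedEmbedding_coe.locallyCompactSpace

lemma continuous_coe : Continuous (fun g : SLR d => (g : Matrix (Fin d) (Fin d) ℝ)) :=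
  isClosedEmbedding_coe.continuous

lemma continuous_entry (i j : Fin d) : Continuous (fun g : SLR d => g i j) :=
  (continuous_apply_apply i j).comp continuous_coe

lemma isCompact_entries_le (r : ℝ) : IsCompact {g : SLR d | ∀ i j, |g i j| ≤ r} := by
  have h : IsCompact {m : Fin d → Fin d → ℝ | ∀ i j, m i j ∈ Set.Icc (-r) r} := by
    have := isCompact_univ_pi (fun _ : Fin d => isCompact_univ_pi
      (fun _ : Fin d => isCompact_Icc (a := -r) (b := r)))
    convert this using 1
    ext m; simp only [Set.mem_ofPred_eq, Set.mem_univ_pi]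
  have := isClosedEmbedding_coe.isCompact_preimage (K := {m | ∀ i j, m i j ∈ Set.Icc (-r) r}) h
  convert this using 1
  ext g
  simp [abs_le]

lemma toSLR_apply (γ : SpecialLinearGroup (Fin d) ℤ) (i j : Fin d) :
    toSLR γ i j = (γ i j : ℝ) := rfl

lemma one_entry (i j : Fin d) : (1 : SLR d) i j = if i = j then 1 else 0 := Matrix.one_apply

lemma exists_separating_nhd (d : ℕ) : ∃ B : Set (SLR d), IsOpen B ∧ (1 : SLR d) ∈ B ∧
    (∀ b ∈ B, b⁻¹ ∈ B) ∧ (∀ b ∈ B, ∀ i j, |b i j| ≤ 2) ∧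
    (∀ b ∈ B, ∀ b' ∈ B, ∀ γ : SpecialLinearGroup (Fin d) ℤ, b * b' = toSLR γ → γ = 1) := by
  let W : Set (SLR d) := ⋂ i, ⋂ j, {g : SLR d | |g i j - (1 : SLR d) i j| < 1}
  have hW : IsOpen W := isOpen_iInter_of_finite fun i => isOpen_iInter_of_finite fun j =>
    isOpen_lt ((continuous_entry i j).sub continuous_const).abs continuous_const
  have hW1 : (1 : SLR d) ∈ W := by simp [W]
  obtain ⟨V, hVo, hV1, hV⟩ := exists_open_nhds_one_mul_subset (hW.mem_nhds hW1)
  have hVW : V ⊆ W := fun v hv => by simpa using hV (Set.mul_mem_mul hv hV1)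
  refine ⟨V ∩ V⁻¹, hVo.inter hVo.inv, ⟨hV1, by simpa using hV1⟩, fun b hb => ⟨hb.2, by simpa using hb.1⟩,
    fun b hb i j => ?_, fun b hb b' hb' γ h => ?_⟩
  · have h1 : |b i j - (1 : SLR d) i j| < 1 := by
      have := hVW hb.1
      simp only [W, Set.mem_iInter] at this
      exact this i j
    have h2 : |(1 : SLR d) i j| ≤ 1 := by
      rw [one_entry]
      split_ifs <;> simp
    calc |b i j| = |(b i j - (1 : SLR d) i j) + (1 : SLR d) i j| := by ring_nf
      _ ≤ _ := abs_add_le _ _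
      _ ≤ 2 := by linarith
  · have := hV (Set.mul_mem_mul hb.1 hb'.1)
    rw [h] at this
    simp only [W, Set.mem_iInter] at this
    ext i j
    have := this i j
    simp only [Set.mem_ofPred_eq, toSLR_apply, one_entry] at this
    have h3 : |((γ i j - if i = j then 1 else 0 : ℤ) : ℝ)| < 1 := by
      push_cast
      exact this
    rw [← Int.cast_abs] at h3
    have h4 : |(γ i j - if i = j then 1 else 0 : ℤ)| < 1 := by exact_mod_cast h3
    have := Int.abs_lt_one_iff.1 h4
    change γ i j = (1 : Matrix (Fin d) (Fin d) ℤ) i j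
    rw [Matrix.one_apply]
    linarith

/-- The diagonal matrix with entries `exp (a i)`. -/
noncomputable def expDiag (a : Fin d → ℝ) : Matrix (Fin d) (Fin d) ℝ :=
  diagonal fun i => Real.exp (a i)

lemma expDiag_transpose (a : Fin d → ℝ) : (expDiag a)ᵀ = expDiag a := by simp [expDiag]

lemma expDiag_add (a b : Fin d → ℝ) : expDiag (a + b) = expDiag a * expDiag b := by
  simp [expDiag, Real.exp_add]

lemma expDiag_zero : expDiag (0 : Fin d → ℝ) = 1 := by simp [expDiag]

lemma det_expDiag (a : Fin d → ℝ) : (expDiag a).det = Real.exp (∑ i, a i) := by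
  simp [expDiag, Real.exp_sum]

lemma roots_prod_X_sub_C_map (f : Fin d → ℝ) :
    (∏ i, (X - C (f i))).roots = Finset.univ.val.map f := by
  rw [← Polynomial.roots_multiset_prod_X_sub_C (Finset.univ.val.map f), Multiset.map_map]
  rfl

lemma mem_Dt_iff {g : SLR d} {t : ℝ} {k₁ k₂ : Matrix (Fin d) (Fin d) ℝ} {a : Fin d → ℝ}
    (h₁ : k₁ᵀ * k₁ = 1) (h₂ : k₂ᵀ * k₂ = 1) (hg : (g : Matrix (Fin d) (Fin d) ℝ) = k₁ * expDiag a * k₂) :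
    g ∈ Dt d t ↔ ∑ i, a i ^ 2 ≤ t ^ 2 := by
  have h₂' : k₂ * k₂ᵀ = 1 := mul_eq_one_comm.1 h₂
  have hchar : ((g : Matrix (Fin d) (Fin d) ℝ)ᵀ * (g : Matrix (Fin d) (Fin d) ℝ)).charpoly
      = ∏ i, (X - C (Real.exp (2 * a i))) := by
    have : (g : Matrix (Fin d) (Fin d) ℝ)ᵀ * (g : Matrix (Fin d) (Fin d) ℝ) =
        k₂ᵀ * (expDiag (a + a) * k₂) := by
      rw [hg, expDiag_add]
      simp only [transpose_mul, expDiag_transpose]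
      calc k₂ᵀ * (expDiag a * k₁ᵀ) * (k₁ * expDiag a * k₂)
          = k₂ᵀ * (expDiag a * (k₁ᵀ * k₁) * expDiag a * k₂) := by simp only [Matrix.mul_assoc]
        _ = _ := by rw [h₁, Matrix.mul_one]
    rw [this, Matrix.charpoly_mul_comm, Matrix.mul_assoc, h₂', Matrix.mul_one, expDiag,
      Matrix.charpoly_diagonal]
    simp [two_mul]
  have hlog : ∀ x : ℝ, Real.log (Real.sqrt (Real.exp (2 * x))) = x := by
    intro x
    rw [Real.log_sqrt (Real.exp_pos _).le, Real.log_exp]; ring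
  constructor
  · rintro ⟨μ, hμ, hle⟩
    have hroots : Finset.univ.val.map μ = Finset.univ.val.map (fun i => Real.exp (2 * a i)) := by
      have := congrArg Polynomial.roots (hμ.symm.trans hchar)
      rwa [roots_prod_X_sub_C_map, roots_prod_X_sub_C_map] at this
    have := congrArg (fun m => (m.map (fun x => Real.log (Real.sqrt x) ^ 2)).sum) hroots
    simp only [Multiset.map_map, Function.comp_def, hlog] at this
    change (∑ i, _) = (∑ i, _) at this
    rwa [← this]
  · intro h
    exact ⟨_, hchar, by simpa [hlog] using h⟩

end

section

variable {d : ℕ}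

lemma det_sq_of_orthogonal {k : Matrix (Fin d) (Fin d) ℝ} (h : kᵀ * k = 1) :
    k.det = 1 ∨ k.det = -1 := by
  have := congrArg Matrix.det h
  rw [det_mul, det_transpose, det_one] at this
  exact mul_self_eq_one_iff.1 this

lemma exists_orthogonal_diagonalization (g : SLR d) :
    ∃ (U : Matrix (Fin d) (Fin d) ℝ) (a : Fin d → ℝ), Uᵀ * U = 1 ∧ Antitone a ∧
      Uᵀ * ((g : Matrix (Fin d) (Fin d) ℝ)ᵀ * g) * U = expDiag (a + a) := by
  set G : Matrix (Fin d) (Fin d) ℝ := g.1 with hG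
  have hpos : (Gᵀ * G).PosDef := by
    have hinj : Function.Injective G.mulVec := by
      apply Matrix.mulVec_injective_of_isUnit
      rw [Matrix.isUnit_iff_isUnit_det]
      have : G.det = 1 := g.2
      simp [this]
    have := Matrix.PosDef.conjTranspose_mul_self G hinj
    simpa using this
  have hA := hpos.isHermitian
  set V : Matrix (Fin d) (Fin d) ℝ := hA.eigenvectorUnitary.1 with hV
  have hVV : Vᵀ * V = 1 := by
    have := (Matrix.mem_unitaryGroup_iff' (A := V)).1 hA.eigenvectorUnitary.2
    simpa [star_eq_conjTranspose] using this
  have hdiag : Vᵀ * (Gᵀ * G) * V = diagonal hA.eigenvalues := by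
    have := hA.conjStarAlgAut_star_eigenvectorUnitary
    rw [Unitary.conjStarAlgAut_star_apply] at this
    simpa [star_eq_conjTranspose, Function.comp_def] using this
  set σ : Equiv.Perm (Fin d) := Tuple.sort (fun i => - hA.eigenvalues i) with hσ
  have hmono : Monotone ((fun i => - hA.eigenvalues i) ∘ σ) := Tuple.monotone_sort _
  have hsub : ∀ B : Matrix (Fin d) (Fin d) ℝ, (V.submatrix id σ)ᵀ * B * V.submatrix id σ =
      (Vᵀ * B * V).submatrix σ σ := by
    intro B
    rw [Matrix.submatrix_mul _ _ σ id σ Function.bijective_id,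
      Matrix.submatrix_mul _ _ σ id id Function.bijective_id]
    rfl
  refine ⟨V.submatrix id σ, fun i => Real.log (hA.eigenvalues (σ i)) / 2, ?_, ?_, ?_⟩
  · have := hsub 1
    simpa [hVV] using this
  · intro i j hij
    have := hmono hij
    simp only [Function.comp_apply, neg_le_neg_iff] at this
    have := Real.log_le_log (hpos.eigenvalues_pos _) this
    change _ / 2 ≤ _ / 2
    linarith
  · rw [hsub, hdiag, Matrix.submatrix_diagonal_equiv]
    unfold expDiag
    congr 1
    ext i
    simp only [Function.comp_apply, Pi.add_apply]
    rw [show Real.log (hA.eigenvalues (σ i)) / 2 + Real.log (hA.eigenvalues (σ i)) / 2 =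
      Real.log (hA.eigenvalues (σ i)) by ring, Real.exp_log (hpos.eigenvalues_pos _)]

lemma expDiag_neg_mul (a : Fin d → ℝ) : expDiag (-a) * expDiag a = 1 := by
  rw [← expDiag_add, neg_add_cancel, expDiag_zero]

lemma expDiag_mul_neg (a : Fin d → ℝ) : expDiag a * expDiag (-a) = 1 := by
  rw [← expDiag_add, add_neg_cancel, expDiag_zero]

lemma exists_svd (g : SLR d) : ∃ (k₁ k₂ : SLR d) (a : Fin d → ℝ),
    (k₁ : Matrix (Fin d) (Fin d) ℝ)ᵀ * k₁ = 1 ∧ (k₂ : Matrix (Fin d) (Fin d) ℝ)ᵀ * k₂ = 1 ∧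
    Antitone a ∧ ∑ i, a i = 0 ∧ (g : Matrix (Fin d) (Fin d) ℝ) = k₁ * expDiag a * k₂ := by
  obtain ⟨U, a, hU, ha, hUa⟩ := exists_orthogonal_diagonalization g
  have hU' : U * Uᵀ = 1 := mul_eq_one_comm.1 hU
  set G : Matrix (Fin d) (Fin d) ℝ := g.1 with hG
  set W : Matrix (Fin d) (Fin d) ℝ := G * U * expDiag (-a) with hW
  have hWW : Wᵀ * W = 1 := by
    calc Wᵀ * W = expDiag (-a) * (Uᵀ * (Gᵀ * G) * U) * expDiag (-a) := by
          simp only [hW, transpose_mul, expDiag_transpose, Matrix.mul_assoc]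
      _ = (expDiag (-a) * expDiag a) * (expDiag a * expDiag (-a)) := by
          rw [hUa, expDiag_add]; simp only [Matrix.mul_assoc]
      _ = 1 := by rw [expDiag_neg_mul, expDiag_mul_neg, Matrix.mul_one]
  have hG' : G = W * expDiag a * Uᵀ := by
    rw [hW, Matrix.mul_assoc (G * U), expDiag_neg_mul, Matrix.mul_one, Matrix.mul_assoc, hU',
      Matrix.mul_one]
  have hdet : W.det * Real.exp (∑ i, a i) * U.det = 1 := by
    have h1 : G.det = 1 := g.2
    rw [hG', det_mul, det_mul, det_transpose, det_expDiag] at h1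
    exact h1
  have hpos := Real.exp_pos (∑ i, a i)
  have hUt : (Uᵀ)ᵀ * Uᵀ = 1 := by rw [transpose_transpose, hU']
  have key : Real.exp (∑ i, a i) = 1 ∧ W.det = U.det := by
    rcases det_sq_of_orthogonal hWW with h | h <;> rcases det_sq_of_orthogonal hU with h' | h' <;>
      rw [h, h'] at hdet ⊢ <;> constructor <;> linarith
  have hsum : ∑ i, a i = 0 := by
    have := congrArg Real.log key.1
    simpa using this
  rcases det_sq_of_orthogonal hU with h | h
  · exact ⟨⟨W, by rw [key.2, h]⟩, ⟨Uᵀ, by rw [det_transpose, h]⟩, a, hWW, hUt, ha, hsum, hG'⟩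
  · have hne : Nonempty (Fin d) := by
      by_contra hcon
      rw [not_nonempty_iff] at hcon
      rw [Matrix.det_isEmpty] at h
      norm_num at h
    obtain ⟨i₀⟩ := hne
    set ε : Matrix (Fin d) (Fin d) ℝ := diagonal (Function.update (fun _ => (1 : ℝ)) i₀ (-1)) with hε
    have hεε : ε * ε = 1 := by
      rw [hε, diagonal_mul_diagonal, ← diagonal_one]
      congr 1
      ext i
      by_cases hi : i = i₀
      · subst hi; simp
      · simp [hi]
    have hεt : εᵀ = ε := by simp [hε]
    have hεdet : ε.det = -1 := by
      rw [hε, det_diagonal, Finset.prod_update_of_mem (Finset.mem_univ _)]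
      simp
    have hεa : ε * expDiag a = expDiag a * ε := by
      simp [hε, expDiag, mul_comm]
    refine ⟨⟨W * ε, by rw [det_mul, key.2, h, hεdet]; norm_num⟩,
      ⟨ε * Uᵀ, by rw [det_mul, det_transpose, h, hεdet]; norm_num⟩, a, ?_, ?_, ha, hsum, ?_⟩
    · change (W * ε)ᵀ * (W * ε) = 1
      rw [transpose_mul, hεt, Matrix.mul_assoc, ← Matrix.mul_assoc Wᵀ, hWW, Matrix.one_mul, hεε]
    · change (ε * Uᵀ)ᵀ * (ε * Uᵀ) = 1
      rw [transpose_mul, hεt, Matrix.mul_assoc, ← Matrix.mul_assoc ε, hεε, Matrix.one_mul, hUt]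
    · change G = (W * ε) * expDiag a * (ε * Uᵀ)
      rw [Matrix.mul_assoc W, hεa, ← Matrix.mul_assoc W, Matrix.mul_assoc (W * expDiag a),
        ← Matrix.mul_assoc ε, hεε, Matrix.one_mul, hG']

lemma orthogonal_transpose {k : Matrix (Fin d) (Fin d) ℝ} (h : kᵀ * k = 1) : kᵀᵀ * kᵀ = 1 := by
  rw [transpose_transpose, mul_eq_one_comm.1 h]

lemma mem_Dt_inv {g : SLR d} {t : ℝ} (hg : g ∈ Dt d t) : g⁻¹ ∈ Dt d t := by
  obtain ⟨k₁, k₂, a, h₁, h₂, -, -, h⟩ := exists_svd g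
  rw [mem_Dt_iff h₁ h₂ h] at hg
  have hinv : ((g⁻¹ : SLR d) : Matrix (Fin d) (Fin d) ℝ) =
      (k₂ : Matrix (Fin d) (Fin d) ℝ)ᵀ * expDiag (-a) * (k₁ : Matrix (Fin d) (Fin d) ℝ)ᵀ := by
    have hgg : (g : Matrix (Fin d) (Fin d) ℝ) * ((g⁻¹ : SLR d) : Matrix (Fin d) (Fin d) ℝ) = 1 :=
      congrArg Subtype.val (mul_inv_cancel g)
    refine (left_inv_eq_right_inv ?_ hgg).symm
    rw [h]
    calc _ = (k₂ : Matrix (Fin d) (Fin d) ℝ)ᵀ * (expDiag (-a) * (((k₁ : Matrix (Fin d) (Fin d) ℝ)ᵀ * k₁) *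
          (expDiag a * k₂))) := by simp only [Matrix.mul_assoc]
      _ = 1 := by
        rw [h₁, Matrix.one_mul, ← Matrix.mul_assoc (expDiag (-a)), expDiag_neg_mul, Matrix.one_mul, h₂]
  rw [mem_Dt_iff (orthogonal_transpose h₂) (orthogonal_transpose h₁) hinv]
  simpa using hg

lemma mem_Dt_inv_iff {g : SLR d} {t : ℝ} : g⁻¹ ∈ Dt d t ↔ g ∈ Dt d t :=
  ⟨fun h => by simpa using mem_Dt_inv h, mem_Dt_inv⟩

lemma Dt_mono {s t : ℝ} (hs : 0 ≤ s) (h : s ≤ t) : Dt d s ⊆ Dt d t := by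
  rintro g ⟨μ, hμ, hle⟩
  exact ⟨μ, hμ, hle.trans (by gcongr)⟩

lemma orthogonal_entry_le {k : Matrix (Fin d) (Fin d) ℝ} (h : kᵀ * k = 1) (i j : Fin d) :
    |k i j| ≤ 1 := by
  have h1 : ∑ l, k l j * k l j = 1 := by
    have := congrFun (congrFun h j) j
    simpa [Matrix.mul_apply] using this
  have h2 : k i j * k i j ≤ ∑ l, k l j * k l j :=
    Finset.single_le_sum (f := fun l => k l j * k l j) (fun l _ => mul_self_nonneg _)
      (Finset.mem_univ i)
  rw [abs_le_one_iff_mul_self_le_one]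
  linarith

end

section

variable {d : ℕ}

lemma expDiag_mul_apply (a : Fin d → ℝ) (N : Matrix (Fin d) (Fin d) ℝ) (i j : Fin d) :
    (expDiag a * N) i j = Real.exp (a i) * N i j := by simp [expDiag]

lemma mul_expDiag_apply (a : Fin d → ℝ) (N : Matrix (Fin d) (Fin d) ℝ) (i j : Fin d) :
    (N * expDiag a) i j = N i j * Real.exp (a j) := by simp [expDiag]

lemma abs_mul_apply_le {M N : Matrix (Fin d) (Fin d) ℝ} {r s : ℝ} (hr : 0 ≤ r)
    (hM : ∀ i j, |M i j| ≤ r) (hN : ∀ i j, |N i j| ≤ s) (i j : Fin d) :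
    |(M * N) i j| ≤ d * (r * s) := by
  rw [Matrix.mul_apply]
  calc |∑ l, M i l * N l j| ≤ ∑ l, |M i l * N l j| := Finset.abs_sum_le_sum_abs _ _
    _ ≤ ∑ _l : Fin d, r * s := Finset.sum_le_sum fun l _ => by
        rw [abs_mul]
        exact mul_le_mul (hM _ _) (hN _ _) (abs_nonneg _) hr
    _ = d * (r * s) := by simp

lemma abs_le_of_mem_Dt {t : ℝ} (ht : 0 ≤ t) {a : Fin d → ℝ} (h : ∑ i, a i ^ 2 ≤ t ^ 2)
    (i : Fin d) : |a i| ≤ t := by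
  apply abs_le_of_sq_le_sq _ ht
  exact (Finset.single_le_sum (f := fun i => a i ^ 2) (fun l _ => sq_nonneg _)
      (Finset.mem_univ i)).trans h

lemma exists_perm_abs_ge {M : Matrix (Fin d) (Fin d) ℝ} (hM : Mᵀ * M = 1) :
    ∃ σ : Equiv.Perm (Fin d), ∀ i, ((d.factorial : ℕ) : ℝ)⁻¹ ≤ |M (σ i) i| := by
  have hdet : |M.det| = 1 := by rcases det_sq_of_orthogonal hM with h | h <;> simp [h]
  have hfac : (0 : ℝ) < d.factorial := by exact_mod_cast d.factorial_pos
  have : ∃ σ : Equiv.Perm (Fin d), ((d.factorial : ℕ) : ℝ)⁻¹ ≤ ∏ i, |M (σ i) i| := by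
    by_contra! hcon
    have h1 : |M.det| ≤ ∑ σ : Equiv.Perm (Fin d), ∏ i, |M (σ i) i| := by
      rw [Matrix.det_apply']
      refine (Finset.abs_sum_le_sum_abs _ _).trans (Finset.sum_le_sum fun σ _ => ?_)
      rw [abs_mul, Finset.abs_prod]
      have : |((Equiv.Perm.sign σ : ℤ) : ℝ)| = 1 := by
        rcases Int.units_eq_one_or (Equiv.Perm.sign σ) with h | h <;> simp [h]
      rw [this, one_mul]
    have h2 : ∑ σ : Equiv.Perm (Fin d), ∏ i, |M (σ i) i| <
        ∑ _σ : Equiv.Perm (Fin d), ((d.factorial : ℕ) : ℝ)⁻¹ :=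
      Finset.sum_lt_sum_of_nonempty Finset.univ_nonempty fun σ _ => hcon σ
    simp only [Finset.sum_const, Finset.card_univ, Fintype.card_perm, Fintype.card_fin,
      nsmul_eq_mul, mul_inv_cancel₀ hfac.ne'] at h2
    linarith
  obtain ⟨σ, hσ⟩ := this
  refine ⟨σ, fun i => hσ.trans ?_⟩
  rw [← Finset.mul_prod_erase _ _ (Finset.mem_univ i)]
  exact mul_le_of_le_one_right (abs_nonneg _)
    (Finset.prod_le_one (fun _ _ => abs_nonneg _) fun j _ => orthogonal_entry_le hM _ _)

lemma abs_le_of_sum_eq_zero {x : Fin d → ℝ} {c : ℝ} (hc : 0 ≤ c) (hx : ∑ i, x i = 0)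
    (h : ∀ i, x i ≤ c) (i : Fin d) : |x i| ≤ d * c := by
  have hd : (1 : ℝ) ≤ d := by
    have : 0 < d := i.pos
    exact_mod_cast this
  rw [abs_le]
  constructor
  · have h1 : ∑ j ∈ Finset.univ.erase i, x j ≤ ∑ j ∈ Finset.univ.erase i, c :=
      Finset.sum_le_sum fun j _ => h j
    rw [← Finset.add_sum_erase _ _ (Finset.mem_univ i)] at hx
    have h2 : ∑ j ∈ Finset.univ.erase i, c ≤ ∑ j : Fin d, c :=
      Finset.sum_le_sum_of_subset_of_nonneg (Finset.erase_subset _ _) fun _ _ _ => hc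
    simp only [Finset.sum_const, Finset.card_univ, Fintype.card_fin, nsmul_eq_mul] at h1 h2
    linarith
  · nlinarith [h i]

lemma exists_Dt_mul_right (d : ℕ) (r : ℝ) : ∃ c : ℝ, 0 ≤ c ∧ ∀ s : ℝ, 0 ≤ s → ∀ g ∈ Dt d s,
    ∀ b : SLR d, (∀ i j, |b i j| ≤ r) → g * b ∈ Dt d (s + c) := by
  set L : ℝ := d * (d * (1 * r) * 1) with hL
  set c₁ : ℝ := max 0 (Real.log (L * d.factorial)) with hc₁
  have hc₁0 : 0 ≤ c₁ := le_max_left _ _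
  refine ⟨d * (d * c₁), by positivity, fun s hs g hg b hb => ?_⟩
  obtain ⟨k₁, k₂, a, h₁, h₂, -, ha, h⟩ := exists_svd g
  obtain ⟨l₁, l₂, a', h₁', h₂', -, ha', h'⟩ := exists_svd (g * b)
  rw [mem_Dt_iff h₁ h₂ h] at hg
  rw [mem_Dt_iff h₁' h₂' h']
  have hfac : (0 : ℝ) < d.factorial := by exact_mod_cast d.factorial_pos
  set M := (k₁ : Matrix (Fin d) (Fin d) ℝ)ᵀ * l₁ with hM
  set N := (k₂ : Matrix (Fin d) (Fin d) ℝ) * b * (l₂ : Matrix (Fin d) (Fin d) ℝ)ᵀ with hN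
  have hMM : Mᵀ * M = 1 := by
    rw [hM, transpose_mul, transpose_transpose, Matrix.mul_assoc,
      ← Matrix.mul_assoc (k₁ : Matrix (Fin d) (Fin d) ℝ), mul_eq_one_comm.1 h₁, Matrix.one_mul, h₁']
  have hMN : M * expDiag a' = expDiag a * N := by
    have h3 : (l₁ : Matrix (Fin d) (Fin d) ℝ) * expDiag a' * l₂ = k₁ * expDiag a * k₂ * b := by
      rw [← h', ← h]; rfl
    calc M * expDiag a' = (k₁ : Matrix (Fin d) (Fin d) ℝ)ᵀ * (l₁ * expDiag a' * l₂) *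
          (l₂ : Matrix (Fin d) (Fin d) ℝ)ᵀ := by
          rw [Matrix.mul_assoc _ (_ * _), Matrix.mul_assoc _ _ (_ᵀ), mul_eq_one_comm.1 h₂',
            Matrix.mul_one, hM, Matrix.mul_assoc]
      _ = ((k₁ : Matrix (Fin d) (Fin d) ℝ)ᵀ * k₁) * expDiag a * N := by
          rw [h3, hN]; simp only [Matrix.mul_assoc]
      _ = _ := by rw [h₁, Matrix.one_mul]
  have hNle : ∀ i j, |N i j| ≤ L := by
    intro i j
    have hr : 0 ≤ r := (abs_nonneg _).trans (hb i j)
    refine abs_mul_apply_le (by positivity) (abs_mul_apply_le zero_le_one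
      (orthogonal_entry_le h₂) hb) (orthogonal_entry_le (orthogonal_transpose h₂')) i j
  obtain ⟨σ, hσ⟩ := exists_perm_abs_ge hMM
  have hup : ∀ i, a' i - a (σ i) ≤ c₁ := by
    intro i
    have e1 : M (σ i) i * Real.exp (a' i) = Real.exp (a (σ i)) * N (σ i) i := by
      rw [← mul_expDiag_apply, ← expDiag_mul_apply, hMN]
    have e2 : |M (σ i) i| * Real.exp (a' i) = Real.exp (a (σ i)) * |N (σ i) i| := by
      have := congrArg abs e1
      simpa [abs_mul] using this
    have e3 : ((d.factorial : ℕ) : ℝ)⁻¹ * Real.exp (a' i) ≤ Real.exp (a (σ i)) * L := by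
      calc _ ≤ |M (σ i) i| * Real.exp (a' i) := by gcongr; exact hσ i
        _ = _ := e2
        _ ≤ _ := by gcongr; exact hNle _ _
    have e4 : Real.exp (a' i - a (σ i)) ≤ L * d.factorial := by
      rw [Real.exp_sub, div_le_iff₀ (Real.exp_pos _)]
      rw [inv_mul_le_iff₀ hfac] at e3
      linarith
    refine le_trans ?_ (le_max_right _ _)
    rw [← Real.log_exp (a' i - a (σ i))]
    exact Real.log_le_log (Real.exp_pos _) e4
  have hsum : ∑ i, (a' i - a (σ i)) = 0 := by
    rw [Finset.sum_sub_distrib, ha', Equiv.sum_comp σ a, ha, sub_zero]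
  have habs := abs_le_of_sum_eq_zero hc₁0 hsum hup
  set e := d * c₁ with he
  have he0 : 0 ≤ e := by positivity
  have hle : ∀ i, a' i ^ 2 ≤ a (σ i) ^ 2 + (2 * s * e + e ^ 2) := by
    intro i
    have h4 := habs i
    have h5 := abs_le_of_mem_Dt hs hg (σ i)
    have h6 : a' i ^ 2 = a (σ i) ^ 2 + 2 * (a (σ i) * (a' i - a (σ i))) + (a' i - a (σ i)) ^ 2 := by
      ring
    have h7 : a (σ i) * (a' i - a (σ i)) ≤ s * e := by
      refine (le_abs_self _).trans ?_
      rw [abs_mul]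
      gcongr
    have h8 : (a' i - a (σ i)) ^ 2 ≤ e ^ 2 := sq_le_sq' (by linarith [abs_le.1 h4]) (abs_le.1 h4).2
    linarith
  calc ∑ i, a' i ^ 2 ≤ ∑ i, (a (σ i) ^ 2 + (2 * s * e + e ^ 2)) := Finset.sum_le_sum fun i _ => hle i
    _ = ∑ i, a i ^ 2 + d * (2 * s * e + e ^ 2) := by
      rw [Finset.sum_add_distrib, Equiv.sum_comp σ (fun i => a i ^ 2)]
      simp [mul_add]
    _ ≤ s ^ 2 + d * (2 * s * e + e ^ 2) := by gcongr
    _ ≤ (s + d * e) ^ 2 := by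
      have : (d : ℝ) ≤ d ^ 2 := by exact_mod_cast Nat.le_self_pow two_ne_zero d
      nlinarith [mul_le_mul_of_nonneg_right this (sq_nonneg e)]

lemma exists_Dt_mul_left (d : ℕ) (r : ℝ) : ∃ c : ℝ, 0 ≤ c ∧ ∀ s : ℝ, 0 ≤ s → ∀ g ∈ Dt d s,
    ∀ b : SLR d, (∀ i j, |b⁻¹ i j| ≤ r) → b * g ∈ Dt d (s + c) := by
  obtain ⟨c, hc, h⟩ := exists_Dt_mul_right d r
  refine ⟨c, hc, fun s hs g hg b hb => ?_⟩
  rw [← mem_Dt_inv_iff, _root_.mul_inv_rev]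
  exact h s hs _ (mem_Dt_inv hg) _ hb

lemma entry_le_of_mem_Dt {t : ℝ} (ht : 0 ≤ t) {g : SLR d} (hg : g ∈ Dt d t) (i j : Fin d) :
    |g i j| ≤ d * (d * Real.exp t) := by
  obtain ⟨k₁, k₂, a, h₁, h₂, -, -, h⟩ := exists_svd g
  rw [mem_Dt_iff h₁ h₂ h] at hg
  have hexp : ∀ i j, |expDiag a i j| ≤ Real.exp t := by
    intro i j
    unfold expDiag
    rw [Matrix.diagonal_apply]
    split_ifs
    · rw [Real.abs_exp]
      exact Real.exp_le_exp.2 ((le_abs_self _).trans (abs_le_of_mem_Dt ht hg i))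
    · simpa using (Real.exp_pos t).le
  have := abs_mul_apply_le (by positivity) (abs_mul_apply_le zero_le_one
      (orthogonal_entry_le h₁) hexp) (orthogonal_entry_le h₂) i j
  rw [← h] at this
  simpa using this

lemma isCompact_orthogonal (d : ℕ) : IsCompact {k : Matrix (Fin d) (Fin d) ℝ | kᵀ * k = 1} := by
  have h : IsCompact {m : Fin d → Fin d → ℝ | ∀ i j, m i j ∈ Set.Icc (-1 : ℝ) 1} := by
    have := isCompact_univ_pi (fun _ : Fin d => isCompact_univ_pi
      (fun _ : Fin d => isCompact_Icc (a := (-1 : ℝ)) (b := 1)))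
    convert this using 1
    ext m; simp only [Set.mem_ofPred_eq, Set.mem_univ_pi]
  have hcl : IsClosed {k : Matrix (Fin d) (Fin d) ℝ | kᵀ * k = 1} :=
    isClosed_eq (by fun_prop) continuous_const
  exact h.of_isClosed_subset hcl fun k hk i j => abs_le.1 (orthogonal_entry_le hk i j)

lemma continuous_expDiag : Continuous (expDiag : (Fin d → ℝ) → _) := by
  unfold expDiag
  fun_prop

lemma isClosed_Dt (d : ℕ) (t : ℝ) : IsClosed (Dt d t) := by
  set S : Set (Matrix (Fin d) (Fin d) ℝ) :=
    (fun p : Matrix (Fin d) (Fin d) ℝ × (Fin d → ℝ) × Matrix (Fin d) (Fin d) ℝ =>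
      p.1 * expDiag p.2.1 * p.2.2) '' ({k | kᵀ * k = 1} ×ˢ ({a | ∑ i, a i ^ 2 ≤ t ^ 2} ×ˢ
        {k | kᵀ * k = 1})) with hS
  have hcomp : IsCompact {a : Fin d → ℝ | ∑ i, a i ^ 2 ≤ t ^ 2} := by
    have h := isCompact_univ_pi (fun _ : Fin d => isCompact_Icc (a := -|t|) (b := |t|))
    refine h.of_isClosed_subset (isClosed_le (by fun_prop) continuous_const) fun a ha i _ => ?_
    exact abs_le.1 (abs_le_of_mem_Dt (abs_nonneg t) (by simpa using ha) i)
  have hScl : IsClosed S := by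
    refine (((isCompact_orthogonal d).prod (hcomp.prod (isCompact_orthogonal d))).image
      ?_).isClosed
    have := (continuous_expDiag (d := d)).comp (continuous_fst.comp continuous_snd :
      Continuous fun p : Matrix (Fin d) (Fin d) ℝ × (Fin d → ℝ) × Matrix (Fin d) (Fin d) ℝ => p.2.1)
    exact (continuous_fst.mul this).mul (continuous_snd.comp continuous_snd)
  have : Dt d t = (fun g : SLR d => (g : Matrix (Fin d) (Fin d) ℝ)) ⁻¹' S := by
    ext g
    constructor
    · intro hg
      obtain ⟨k₁, k₂, a, h₁, h₂, -, -, h⟩ := exists_svd g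
      exact ⟨(k₁, a, k₂), ⟨h₁, (mem_Dt_iff h₁ h₂ h).1 hg, h₂⟩, h.symm⟩
    · rintro ⟨⟨k₁, a, k₂⟩, ⟨h₁, ha, h₂⟩, h⟩
      exact (mem_Dt_iff h₁ h₂ h.symm).2 ha
  rw [this]
  exact hScl.preimage continuous_coe

lemma isCompact_Dt (d : ℕ) (t : ℝ) : IsCompact (Dt d t) := by
  refine (isCompact_entries_le (d * (d * Real.exp |t|))).of_isClosed_subset (isClosed_Dt d t) ?_
  intro g hg
  have : g ∈ Dt d |t| := by
    obtain ⟨μ, h1, h2⟩ := hg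
    exact ⟨μ, h1, by simpa using h2⟩
  exact entry_le_of_mem_Dt (abs_nonneg t) this

/-- An element of `Dt d (s + t)` splits as a product of an element of `Dt d s` and one
of `Dt d t`. -/
lemma exists_split {s t : ℝ} (hs : 0 ≤ s) (ht : 0 ≤ t) {g : SLR d} (hg : g ∈ Dt d (s + t)) :
    ∃ x ∈ Dt d s, ∃ y ∈ Dt d t, g = x * y := by
  obtain ⟨k₁, k₂, a, h₁, h₂, -, ha, h⟩ := exists_svd g
  rw [mem_Dt_iff h₁ h₂ h] at hg
  rcases (add_nonneg hs ht).eq_or_lt with h0 | h0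
  · have hs0 : s = 0 := by linarith
    have ht0 : t = 0 := by linarith
    subst hs0 ht0
    refine ⟨g, (mem_Dt_iff h₁ h₂ h).2 (by simpa using hg), 1, ?_, by simp⟩
    exact (mem_Dt_iff (k₁ := 1) (k₂ := 1) (a := 0) (by simp) (by simp)
      (by rw [expDiag_zero]; simp)).2 (by simp)
  · set u := s / (s + t) with hu
    set v := t / (s + t) with hv
    have huv : u + v = 1 := by rw [hu, hv]; field_simp
    have hsplit : expDiag a = expDiag (u • a) * expDiag (v • a) := by
      rw [← expDiag_add, ← add_smul, huv, one_smul]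
    have hdet : ∀ w : ℝ, (expDiag (w • a)).det = 1 := by
      intro w
      rw [det_expDiag]
      simp [← Finset.mul_sum, ha]
    have hsum : ∀ w r : ℝ, w = r / (s + t) → ∑ i, (w • a) i ^ 2 ≤ r ^ 2 := by
      intro w r hw
      simp only [Pi.smul_apply, smul_eq_mul, mul_pow, ← Finset.mul_sum]
      calc w ^ 2 * ∑ i, a i ^ 2 ≤ w ^ 2 * (s + t) ^ 2 := by gcongr
        _ = r ^ 2 := by rw [hw]; field_simp
    refine ⟨k₁ * ⟨expDiag (u • a), hdet u⟩, ?_, ⟨expDiag (v • a), hdet v⟩ * k₂, ?_, ?_⟩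
    · exact (mem_Dt_iff (k₂ := 1) h₁ (by simp) (by rw [Matrix.mul_one]; rfl)).2 (hsum u s hu)
    · exact (mem_Dt_iff (k₁ := 1) (by simp) h₂ (by rw [Matrix.one_mul]; rfl)).2 (hsum v t hv)
    · apply Subtype.ext
      change g.1 = (k₁.1 * expDiag (u • a)) * (expDiag (v • a) * k₂.1)
      rw [h, hsplit]
      simp only [Matrix.mul_assoc]

end

section

variable {d : ℕ}

lemma mul_transvection_apply {ι R : Type*} [Fintype ι] [DecidableEq ι] [CommRing R]
    (M : Matrix ι ι R) {i j : ι} (b : R) (k l : ι) :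
    (M * (1 + Matrix.single i j b)) k l = M k l + if l = j then M k i * b else 0 := by
  rw [Matrix.mul_add, Matrix.mul_one, Matrix.add_apply, Matrix.mul_apply]
  congr 1
  simp only [Matrix.single_apply]
  split_ifs with h
  · subst h; simp
  · refine Finset.sum_eq_zero fun x _ => ?_
    rw [if_neg (by tauto), mul_zero]

lemma diag2n_eq_prod {i j : Fin d} (hij : i ≠ j) {a : ℝ} (ha : a ≠ 0) :
    SpecialLinearGroup.diag2n hij a ha = SpecialLinearGroup.transvection hij a *
      SpecialLinearGroup.transvection hij.symm (-a⁻¹) *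
      SpecialLinearGroup.transvection hij a *
      SpecialLinearGroup.transvection hij (-1) *
      SpecialLinearGroup.transvection hij.symm 1 *
      SpecialLinearGroup.transvection hij (-1) := by
  apply Subtype.ext
  change Matrix.diagonal _ = (1 + Matrix.single i j a) * (1 + Matrix.single j i (-a⁻¹)) *
    (1 + Matrix.single i j a) * (1 + Matrix.single i j (-1)) * (1 + Matrix.single j i 1) *
    (1 + Matrix.single i j (-1))
  ext k l
  simp only [mul_transvection_apply, Matrix.add_apply, Matrix.single_apply, Matrix.one_apply,
    Matrix.diagonal_apply]
  have hji := hij.symm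
  by_cases hli : l = i
  · subst hli
    by_cases hki : k = l
    · subst hki; simp [hij, hji, ha]
    · by_cases hkj : k = j
      · subst hkj; simp [hij, hji, ha]
      · simp [hki, hkj, hij, hji, Ne.symm hki]
  · by_cases hlj : l = j
    · subst hlj
      by_cases hki : k = i
      · subst hki; simp [hij, hji, ha]
      · by_cases hkj : k = l
        · subst hkj; simp [hij, hji, ha]
        · simp [hki, hkj, hij, hji, Ne.symm hki]
    · by_cases hkl : k = l
      · subst hkl; simp [hli, hlj, Ne.symm hli, Ne.symm hlj]
      · simp [hli, hlj, Ne.symm hlj, hkl]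

/-- `SL(d, ℝ)` is generated by transvections. -/
lemma transvection_induction (hd : 2 ≤ d) {P : SLR d → Prop}
    (htransvec : ∀ (i j : Fin d) (hij : i ≠ j) (a : ℝ), P (SpecialLinearGroup.transvection hij a))
    (hmul : ∀ A B, P A → P B → P (A * B)) (g : SLR d) : P g := by
  have : Nontrivial (Fin d) := Fin.nontrivial_iff_two_le.2 hd
  refine SpecialLinearGroup.diagonal_transvection_induction' P g (fun i j hij c hc => ?_)
    htransvec hmul
  rw [diag2n_eq_prod hij hc]
  exact hmul _ _ (hmul _ _ (hmul _ _ (hmul _ _ (hmul _ _ (htransvec _ _ _ _) (htransvec _ _ _ _))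
    (htransvec _ _ _ _)) (htransvec _ _ _ _)) (htransvec _ _ _ _)) (htransvec _ _ _ _)

lemma diag2n_mul_transvection {i j : Fin d} (hij : i ≠ j) {a : ℝ} (ha : a ≠ 0) (b : ℝ) :
    SpecialLinearGroup.diag2n hij a ha * SpecialLinearGroup.transvection hij b =
      SpecialLinearGroup.transvection hij (a ^ 2 * b) * SpecialLinearGroup.diag2n hij a ha := by
  apply Subtype.ext
  change Matrix.diagonal _ * (1 + Matrix.single i j b) =
    (1 + Matrix.single i j (a ^ 2 * b)) * Matrix.diagonal _
  ext k l
  rw [mul_transvection_apply, Matrix.mul_diagonal]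
  simp only [Matrix.add_apply, Matrix.single_apply, Matrix.one_apply, Matrix.diagonal_apply]
  by_cases hlj : l = j
  · subst hlj
    by_cases hki : k = i
    · subst hki; simp [hij, hij.symm]; field_simp
    · simp [hki, Ne.symm hki]
      by_cases h : k = l <;> simp [h, hij.symm]
  · simp only [hlj, Ne.symm hlj]
    by_cases h : k = l <;> simp [h, hlj]

/-- The group `SL(d, ℝ)` is unimodular. -/
lemma modularCharacter_eq_one (hd : 2 ≤ d) (g : SLR d) : Measure.modularCharacterFun g = 1 := by
  refine transvection_induction hd (P := fun g => Measure.modularCharacterFun g = 1) ?_ ?_ g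
  · intro i j hij b
    set x := Measure.modularCharacterFun (SpecialLinearGroup.transvection hij b : SLR d) with hx
    have h1 := congrArg Measure.modularCharacterFun
      (diag2n_mul_transvection hij (two_ne_zero : (2 : ℝ) ≠ 0) b)
    have h4 : (2 : ℝ) ^ 2 * b = b + (b + (b + b)) := by ring
    rw [h4] at h1
    simp only [SpecialLinearGroup.transvection_add, Measure.modularCharacterFun_map_mul, ← hx] at h1
    have hD := Measure.modularCharacterFun_pos (SpecialLinearGroup.diag2n hij (2 : ℝ) two_ne_zero)
    have hxp : 0 < x := Measure.modularCharacterFun_pos _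
    rw [mul_comm] at h1
    have h2 := mul_right_cancel₀ hD.ne' h1
    have h3 : x ^ 3 = 1 := by
      have : x * x ^ 3 = x * 1 := by rw [mul_one]; nth_rw 3 [h2]; ring
      exact mul_left_cancel₀ hxp.ne' this
    simpa using h3
  · intro A B hA hB
    rw [Measure.modularCharacterFun_map_mul, hA, hB, one_mul]

lemma isMulRightInvariant (hd : 2 ≤ d) (μ : Measure (SLR d)) [μ.IsHaarMeasure] :
    μ.IsMulRightInvariant :=
  ⟨fun g => by
    rw [Measure.map_right_mul_eq_modularCharacterFun_smul, modularCharacter_eq_one hd, one_smul]⟩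

end

section

variable {d : ℕ}

/-- A symmetric open neighbourhood of the identity whose translates by the elements of
`SL(d, ℤ)` are disjoint, and which moves the sets `Dt d s` by a bounded amount. -/
structure IsSeparating (B : Set (SLR d)) (c : ℝ) : Prop where
  isOpen : IsOpen B
  one_mem : (1 : SLR d) ∈ B
  inv_mem : ∀ b ∈ B, b⁻¹ ∈ B
  separated : ∀ b ∈ B, ∀ b' ∈ B, ∀ γ : SpecialLinearGroup (Fin d) ℤ, b * b' = toSLR γ → γ = 1
  nonneg : 0 ≤ c
  mul_right : ∀ s : ℝ, 0 ≤ s → ∀ g ∈ Dt d s, ∀ b ∈ B, g * b ∈ Dt d (s + c)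
  mul_left : ∀ s : ℝ, 0 ≤ s → ∀ g ∈ Dt d s, ∀ b ∈ B, b * g ∈ Dt d (s + c)

lemma one_mem_Dt (t : ℝ) : (1 : SLR d) ∈ Dt d t :=
  (mem_Dt_iff (k₁ := 1) (k₂ := 1) (a := 0) (by simp) (by simp)
      (by rw [expDiag_zero]; simp)).2 (by simpa using sq_nonneg t)

lemma exists_isSeparating (d : ℕ) : ∃ (B : Set (SLR d)) (c : ℝ), IsSeparating B c := by
  obtain ⟨B, h1, h2, h3, h4, h5⟩ := exists_separating_nhd d
  obtain ⟨c, hc, h6⟩ := exists_Dt_mul_right d 2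
  obtain ⟨c', hc', h7⟩ := exists_Dt_mul_left d 2
  refine ⟨B, c + c', h1, h2, h3, h5, by positivity, fun s hs g hg b hb => ?_,
    fun s hs g hg b hb => ?_⟩
  · exact Dt_mono (by positivity) (by linarith) (h6 s hs g hg b (h4 b hb))
  · exact Dt_mono (by positivity) (by linarith) (h7 s hs g hg b (h4 _ (h3 b hb)))

lemma measurableSet_Dt (t : ℝ) : MeasurableSet (Dt d t) := (isClosed_Dt d t).measurableSet

lemma measure_Dt_lt_top (μ : Measure (SLR d)) [μ.IsHaarMeasure] (t : ℝ) : μ (Dt d t) < ⊤ :=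
  (isCompact_Dt d t).measure_lt_top

lemma isSeparating_pos {B : Set (SLR d)} {c : ℝ} (hB : IsSeparating B c) (μ : Measure (SLR d))
    [μ.IsHaarMeasure] : 0 < μ B := hB.isOpen.measure_pos μ ⟨1, hB.one_mem⟩

lemma isSeparating_subset {B : Set (SLR d)} {c : ℝ} (hB : IsSeparating B c) : B ⊆ Dt d c := by
  intro b hb
  simpa using hB.mul_left 0 le_rfl 1 (one_mem_Dt 0) b hb

lemma isSeparating_lt_top {B : Set (SLR d)} {c : ℝ} (hB : IsSeparating B c) (μ : Measure (SLR d))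
    [μ.IsHaarMeasure] : μ B < ⊤ :=
  (measure_mono (isSeparating_subset hB)).trans_lt (measure_Dt_lt_top μ c)

lemma packing_right {B : Set (SLR d)} {c : ℝ} (hB : IsSeparating B c) (μ : Measure (SLR d))
    [μ.IsHaarMeasure] (F : Finset (SpecialLinearGroup (Fin d) ℤ)) (z : SLR d) {Q : Set (SLR d)}
    (h : ∀ γ ∈ F, ∀ b ∈ B, z * toSLR γ * b ∈ Q) : F.card * μ B ≤ μ Q := by
  calc F.card * μ B = ∑ γ ∈ F, μ ((fun x => (z * toSLR γ)⁻¹ * x) ⁻¹' B) := by simp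
    _ = μ (⋃ γ ∈ F, (fun x => (z * toSLR γ)⁻¹ * x) ⁻¹' B) := by
      rw [measure_biUnion_finset]
      · intro γ _ γ' _ hne
        refine Set.disjoint_left.2 fun x hx hx' => hne ?_
        have := hB.separated _ hx _ (hB.inv_mem _ hx') (γ⁻¹ * γ') (by rw [map_mul, map_inv]; group)
        exact (inv_mul_eq_one.1 this)
      · exact fun γ _ => (hB.isOpen.preimage (continuous_const_mul _)).measurableSet
    _ ≤ μ Q := by
      refine measure_mono (Set.iUnion₂_subset fun γ hγ x hx => ?_)
      have := h γ hγ _ hx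
      rwa [mul_inv_cancel_left] at this

lemma packing_left (hd : 2 ≤ d) {B : Set (SLR d)} {c : ℝ} (hB : IsSeparating B c)
    (μ : Measure (SLR d))
    [μ.IsHaarMeasure] (F : Finset (SpecialLinearGroup (Fin d) ℤ)) (z : SLR d) {Q : Set (SLR d)}
    (h : ∀ γ ∈ F, ∀ b ∈ B, b * (toSLR γ * z) ∈ Q) : F.card * μ B ≤ μ Q := by
  have := isMulRightInvariant hd μ
  calc F.card * μ B = ∑ γ ∈ F, μ ((fun x => x * (toSLR γ * z)⁻¹) ⁻¹' B) := by simp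
    _ = μ (⋃ γ ∈ F, (fun x => x * (toSLR γ * z)⁻¹) ⁻¹' B) := by
      rw [measure_biUnion_finset]
      · intro γ _ γ' _ hne
        refine Set.disjoint_left.2 fun x hx hx' => hne ?_
        have := hB.separated _ (hB.inv_mem _ hx) _ hx' (γ * γ'⁻¹) (by rw [map_mul, map_inv]; group)
        exact (mul_inv_eq_one.1 this)
      · exact fun γ _ => (hB.isOpen.preimage (continuous_mul_const _)).measurableSet
    _ ≤ μ Q := by
      refine measure_mono (Set.iUnion₂_subset fun γ hγ x hx => ?_)
      have := h γ hγ _ hx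
      rwa [inv_mul_cancel_right] at this

/-- If every point of `Q` lies in at most `N` of the sets `S a`, all of which are contained in
`Q`, then the sum of the measures of the `S a` is at most `N` times the measure of `Q`. -/
lemma sum_measure_le {X α : Type*} [MeasurableSpace X] (μ : Measure X) (F : Finset α)
    (S : α → Set X) (hS : ∀ a ∈ F, MeasurableSet (S a)) {Q : Set X} (hQ : MeasurableSet Q)
    (hSQ : ∀ a ∈ F, S a ⊆ Q) {N : ENNReal}
    (hN : ∀ x ∈ Q, ∀ F' ⊆ F, (∀ a ∈ F', x ∈ S a) → (F'.card : ENNReal) ≤ N) :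
    ∑ a ∈ F, μ (S a) ≤ N * μ Q := by
  classical
  calc ∑ a ∈ F, μ (S a) = ∑ a ∈ F, ∫⁻ x, (S a).indicator 1 x ∂μ :=
        Finset.sum_congr rfl fun a ha => (lintegral_indicator_one (hS a ha)).symm
    _ = ∫⁻ x, ∑ a ∈ F, (S a).indicator 1 x ∂μ :=
        (lintegral_finsetSum _ fun a ha => measurable_one.indicator (hS a ha)).symm
    _ ≤ ∫⁻ x, Q.indicator (fun _ => N) x ∂μ := by
        refine lintegral_mono fun x => ?_
        have h1 : ∑ a ∈ F, (S a).indicator (1 : X → ENNReal) x =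
            ((F.filter fun a => x ∈ S a).card : ENNReal) := by
          simp only [Set.indicator_apply, Pi.one_apply]
          rw [Finset.sum_ite]
          simp
        change ∑ a ∈ F, (S a).indicator (1 : X → ENNReal) x ≤ _
        rw [h1]
        by_cases hx : x ∈ Q
        · rw [Set.indicator_of_mem hx]
          exact hN x hx _ (Finset.filter_subset _ _) fun a ha => (Finset.mem_filter.1 ha).2
        · rw [Set.indicator_of_notMem hx, Finset.filter_false_of_mem]
          · simp
          · exact fun a ha hxa => hx (hSQ a ha hxa)
    _ = N * μ Q := by rw [lintegral_indicator hQ, setLIntegral_const]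

/-- Elements between two balls: those `g ∈ Dt d (t + c)` with `y * g⁻¹ ∈ Dt d (s + c)` fill
at least the measure of `B`, whenever `y ∈ Dt d (s + t)`. -/
lemma measure_between (hd : 2 ≤ d) {B : Set (SLR d)} {c : ℝ} (hB : IsSeparating B c)
    (μ : Measure (SLR d)) [μ.IsHaarMeasure] {s t : ℝ} (hs : 0 ≤ s) (ht : 0 ≤ t) {y : SLR d}
    (hy : y ∈ Dt d (s + t)) : μ B ≤ μ {g | g ∈ Dt d (t + c) ∧ y * g⁻¹ ∈ Dt d (s + c)} := by
  have := isMulRightInvariant hd μ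
  obtain ⟨x, hx, z, hz, rfl⟩ := exists_split hs ht hy
  rw [← measure_preimage_mul_right μ z⁻¹ B]
  refine measure_mono fun g hg => ⟨?_, ?_⟩
  · have := hB.mul_left t ht z hz _ hg
    simpa using this
  · have := hB.mul_right s hs x hx _ (hB.inv_mem _ hg)
    simpa [mul_assoc] using this

lemma measure_Dt_add_le (hd : 2 ≤ d) {B : Set (SLR d)} {c : ℝ} (hB : IsSeparating B c)
    (μ : Measure (SLR d)) [μ.IsHaarMeasure] {s t : ℝ} (hs : 0 ≤ s) (ht : 0 ≤ t) :
    μ (Dt d (s + t)) * μ B ≤ μ (Dt d (s + c)) * μ (Dt d (t + c)) := by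
  have := isMulRightInvariant hd μ
  set R : Set (SLR d × SLR d) := {p | p.2 ∈ Dt d (t + c) ∧ p.1 * p.2⁻¹ ∈ Dt d (s + c)} with hR
  have hRm : MeasurableSet R := by
    have hc : IsClosed R := ((isClosed_Dt d (t + c)).preimage continuous_snd).inter
      ((isClosed_Dt d (s + c)).preimage (continuous_fst.mul continuous_snd.inv))
    exact hc.measurableSet
  calc μ (Dt d (s + t)) * μ B = ∫⁻ _ in Dt d (s + t), μ B ∂μ := by
        rw [setLIntegral_const, mul_comm]
    _ ≤ ∫⁻ y in Dt d (s + t), μ (Prod.mk y ⁻¹' R) ∂μ :=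
        setLIntegral_mono' (measurableSet_Dt _) fun y hy => measure_between hd hB μ hs ht hy
    _ ≤ ∫⁻ y, μ (Prod.mk y ⁻¹' R) ∂μ := setLIntegral_le_lintegral _ _
    _ = (μ.prod μ) R := (Measure.prod_apply hRm).symm
    _ = ∫⁻ g, μ ((fun y => (y, g)) ⁻¹' R) ∂μ := Measure.prod_apply_symm hRm
    _ ≤ ∫⁻ g, (Dt d (t + c)).indicator (fun _ => μ (Dt d (s + c))) g ∂μ := by
        refine lintegral_mono fun g => ?_
        by_cases hg : g ∈ Dt d (t + c)
        · rw [Set.indicator_of_mem hg, ← measure_preimage_mul_right μ g⁻¹ (Dt d (s + c))]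
          exact measure_mono fun y hy => hy.2
        · rw [Set.indicator_of_notMem hg]
          have : (fun y => (y, g)) ⁻¹' R = ∅ := Set.eq_empty_of_forall_notMem fun y hy => hg hy.1
          rw [this, measure_empty]
    _ = μ (Dt d (s + c)) * μ (Dt d (t + c)) := by
        rw [lintegral_indicator (measurableSet_Dt _), setLIntegral_const]

end

section

variable {d : ℕ}

lemma mem_Dt_of_entry_le (hd : 2 ≤ d) {r : ℝ} (hr : 1 ≤ r) {g : SLR d} (h : ∀ i j, |g i j| ≤ r) :
    g ∈ Dt d (d ^ 2 * Real.log (d ^ 2 * r)) := by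
  obtain ⟨k₁, k₂, a, h₁, h₂, -, hsum, hg⟩ := exists_svd g
  rw [mem_Dt_iff h₁ h₂ hg]
  have hd1 : (1 : ℝ) ≤ d := by exact_mod_cast (by omega : 1 ≤ d)
  have hL : 0 ≤ Real.log (d ^ 2 * r) :=
    Real.log_nonneg (one_le_mul_of_one_le_of_one_le (one_le_pow₀ hd1) hr)
  have he : expDiag a = (k₁ : Matrix (Fin d) (Fin d) ℝ)ᵀ * g * (k₂ : Matrix (Fin d) (Fin d) ℝ)ᵀ := by
    rw [hg]
    calc expDiag a = ((k₁ : Matrix (Fin d) (Fin d) ℝ)ᵀ * k₁) * expDiag a *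
          ((k₂ : Matrix (Fin d) (Fin d) ℝ) * (k₂ : Matrix (Fin d) (Fin d) ℝ)ᵀ) := by
            rw [h₁, mul_eq_one_comm.1 h₂, Matrix.one_mul, Matrix.mul_one]
      _ = _ := by simp only [Matrix.mul_assoc]
  have hle : ∀ i, a i ≤ Real.log (d ^ 2 * r) := by
    intro i
    have h3 := abs_mul_apply_le (by positivity) (abs_mul_apply_le zero_le_one
      (orthogonal_entry_le (orthogonal_transpose h₁)) h)
      (orthogonal_entry_le (orthogonal_transpose h₂)) i i
    rw [← he] at h3
    unfold expDiag at h3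
    rw [Matrix.diagonal_apply_eq, Real.abs_exp] at h3
    rw [Real.le_log_iff_exp_le (by positivity)]
    exact h3.trans (le_of_eq (by ring))
  have habs := abs_le_of_sum_eq_zero hL hsum hle
  calc ∑ i, a i ^ 2 ≤ ∑ _i : Fin d, (d * Real.log (d ^ 2 * r)) ^ 2 :=
        Finset.sum_le_sum fun i _ => sq_le_sq' (by linarith [abs_le.1 (habs i)]) (abs_le.1 (habs i)).2
    _ = d ^ 3 * Real.log (d ^ 2 * r) ^ 2 := by simp; ring
    _ ≤ d ^ 4 * Real.log (d ^ 2 * r) ^ 2 := by gcongr ?_ * _; exact pow_le_pow_right₀ hd1 (by norm_num)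
    _ = _ := by ring

lemma Dt_mem_nhds_one {t : ℝ} (ht : 0 < t) : Dt d t ∈ nhds (1 : SLR d) := by
  rcases Nat.eq_zero_or_pos d with rfl | hd
  · have : Dt 0 t = Set.univ := by
      ext g
      rw [Subsingleton.elim g 1]
      simp [one_mem_Dt]
    rw [this]
    exact Filter.univ_mem
  have hd1 : (1 : ℝ) ≤ d := by exact_mod_cast hd
  set η := t / d ^ 2 with hη
  have hη0 : 0 < η := by positivity
  have hcont : Continuous fun g : SLR d =>
      ((g : Matrix (Fin d) (Fin d) ℝ)ᵀ * (g : Matrix (Fin d) (Fin d) ℝ)).trace := by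
    have := continuous_coe (d := d)
    exact (this.matrix_transpose.mul this).matrix_trace
  have hmem : {g : SLR d | ((g : Matrix (Fin d) (Fin d) ℝ)ᵀ * (g : Matrix (Fin d) (Fin d) ℝ)).trace
      < d + 2 * η ^ 2} ∈ nhds (1 : SLR d) := by
    refine (isOpen_lt hcont continuous_const).mem_nhds ?_
    change ((1 : Matrix (Fin d) (Fin d) ℝ)ᵀ * 1).trace < _
    simp
    positivity
  refine Filter.mem_of_superset hmem fun g hg => ?_
  obtain ⟨k₁, k₂, a, h₁, h₂, -, hsum, hk⟩ := exists_svd g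
  rw [mem_Dt_iff h₁ h₂ hk]
  have htr : ((g : Matrix (Fin d) (Fin d) ℝ)ᵀ * (g : Matrix (Fin d) (Fin d) ℝ)).trace =
      ∑ i, Real.exp (2 * a i) := by
    have : (g : Matrix (Fin d) (Fin d) ℝ)ᵀ * (g : Matrix (Fin d) (Fin d) ℝ) =
        (k₂ : Matrix (Fin d) (Fin d) ℝ)ᵀ * (expDiag (a + a) * k₂) := by
      rw [hk, expDiag_add]
      simp only [transpose_mul, expDiag_transpose]
      calc (k₂ : Matrix (Fin d) (Fin d) ℝ)ᵀ * (expDiag a * (k₁ : Matrix (Fin d) (Fin d) ℝ)ᵀ) *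
            (k₁ * expDiag a * k₂)
          = (k₂ : Matrix (Fin d) (Fin d) ℝ)ᵀ * (expDiag a * ((k₁ : Matrix (Fin d) (Fin d) ℝ)ᵀ * k₁) *
            expDiag a * k₂) := by simp only [Matrix.mul_assoc]
        _ = _ := by rw [h₁, Matrix.mul_one]
    rw [this, Matrix.trace_mul_comm, Matrix.mul_assoc, mul_eq_one_comm.1 h₂, Matrix.mul_one]
    simp [expDiag, Matrix.trace, two_mul]
  have hlt : ∑ i, (Real.exp (2 * a i) - 1 - 2 * a i) < 2 * η ^ 2 := by
    have hg' : ∑ i, Real.exp (2 * a i) < d + 2 * η ^ 2 := by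
      rw [← htr]; exact hg
    rw [Finset.sum_sub_distrib, Finset.sum_sub_distrib, ← Finset.mul_sum, hsum]
    simp
    linarith
  have hnn : ∀ i, 0 ≤ Real.exp (2 * a i) - 1 - 2 * a i := fun i => by
    linarith [Real.add_one_le_exp (2 * a i)]
  have hle : ∀ i, a i ≤ η := by
    intro i
    by_contra! hi
    have h3 := Finset.single_le_sum (fun j _ => hnn j) (Finset.mem_univ i)
    have h4 := Real.quadratic_le_exp_of_nonneg (x := 2 * a i) (by linarith)
    nlinarith
  have habs := abs_le_of_sum_eq_zero hη0.le hsum hle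
  calc ∑ i, a i ^ 2 ≤ ∑ _i : Fin d, (d * η) ^ 2 :=
        Finset.sum_le_sum fun i _ => sq_le_sq' (by linarith [abs_le.1 (habs i)]) (abs_le.1 (habs i)).2
    _ = d ^ 3 * η ^ 2 := by simp; ring
    _ ≤ d ^ 4 * η ^ 2 := by gcongr ?_ * _; exact pow_le_pow_right₀ hd1 (by norm_num)
    _ = t ^ 2 := by rw [hη]; field_simp

lemma measureReal_Dt_pos (μ : Measure (SLR d)) [μ.IsHaarMeasure] {t : ℝ} (ht : 0 < t) :
    0 < μ.real (Dt d t) :=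
  ENNReal.toReal_pos (Measure.measure_pos_of_mem_nhds μ (Dt_mem_nhds_one ht)).ne'
    (measure_Dt_lt_top μ t).ne

lemma measureReal_Dt_mono (μ : Measure (SLR d)) [μ.IsHaarMeasure] {s t : ℝ} (hs : 0 ≤ s)
    (h : s ≤ t) : μ.real (Dt d s) ≤ μ.real (Dt d t) :=
  measureReal_mono (Dt_mono hs h) (measure_Dt_lt_top μ t).ne

/-- The volume of `Dt d t` grows exponentially, because it contains many unipotent integral
matrices. -/
lemma exists_two_pow_mul_le (hd : 2 ≤ d) {B : Set (SLR d)} {c : ℝ} (hB : IsSeparating B c)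
    (μ : Measure (SLR d)) [μ.IsHaarMeasure] :
    ∃ A : ℝ, 0 ≤ A ∧ ∀ m : ℕ, 2 ^ m * μ.real B ≤ μ.real (Dt d (d ^ 2 * Real.log 2 * m + A)) := by
  have hd1 : (1 : ℝ) ≤ d := by exact_mod_cast (by omega : 1 ≤ d)
  have hlog : 0 ≤ Real.log (d ^ 2) := Real.log_nonneg (one_le_pow₀ hd1)
  refine ⟨d ^ 2 * Real.log (d ^ 2) + c, by have := hB.nonneg; positivity, fun m => ?_⟩
  set i₀ : Fin d := ⟨0, by omega⟩
  set i₁ : Fin d := ⟨1, by omega⟩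
  have hij : i₀ ≠ i₁ := by simp [i₀, i₁]
  let x : ℕ → SpecialLinearGroup (Fin d) ℤ := fun n =>
    ⟨1 + Matrix.single i₀ i₁ (n : ℤ), Matrix.det_transvection_of_ne i₀ i₁ hij _⟩
  have hxe : ∀ n i j, (x n) i j = (1 : Matrix (Fin d) (Fin d) ℤ) i j +
    Matrix.single i₀ i₁ (n : ℤ) i j := fun n i j => rfl
  have hxinj : Function.Injective x := by
    intro n n' h
    have := congrArg (fun g : SpecialLinearGroup (Fin d) ℤ => g i₀ i₁) h
    simpa [hxe, hij] using this
  have h2 : ((2 : ℝ) ^ m) = ((2 ^ m : ℕ) : ℝ) := by push_cast; rfl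
  have hmem : ∀ n ∈ Finset.range (2 ^ m), toSLR (x n) ∈ Dt d (d ^ 2 * Real.log (d ^ 2 * 2 ^ m)) := by
    intro n hn
    have hn' : (n : ℝ) ≤ 2 ^ m := by
      rw [h2]; exact_mod_cast (Finset.mem_range.1 hn).le
    refine mem_Dt_of_entry_le hd (one_le_pow₀ (by norm_num)) fun i j => ?_
    rw [toSLR_apply, hxe, Matrix.one_apply, Matrix.single_apply]
    have h1 : (1 : ℝ) ≤ 2 ^ m := one_le_pow₀ (by norm_num)
    by_cases h3 : i₀ = i ∧ i₁ = j
    · rw [if_neg (by rw [← h3.1, ← h3.2]; exact hij), if_pos h3]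
      simpa using hn'
    · rw [if_neg h3]
      split_ifs <;> simp [h1]
  have hpack := packing_right hB μ ((Finset.range (2 ^ m)).image x) 1
    (Q := Dt d (d ^ 2 * Real.log (d ^ 2 * 2 ^ m) + c)) (by
      intro γ hγ b hb
      obtain ⟨n, hn, rfl⟩ := Finset.mem_image.1 hγ
      rw [one_mul]
      refine hB.mul_right _ ?_ _ (hmem n hn) b hb
      exact mul_nonneg (by positivity) (Real.log_nonneg
        (one_le_mul_of_one_le_of_one_le (one_le_pow₀ hd1) (one_le_pow₀ (by norm_num)))))
  rw [Finset.card_image_of_injective _ hxinj, Finset.card_range,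
    Real.log_mul (by positivity) (by positivity), Real.log_pow 2 m] at hpack
  have := ENNReal.toReal_mono (measure_Dt_lt_top μ _).ne hpack
  rw [ENNReal.toReal_mul] at this
  simp only [ENNReal.toReal_natCast] at this
  rw [h2]
  refine this.trans (le_of_eq ?_)
  congr 2
  ring_nf

/-- Exponential growth rate of the volume of `Dt d t`. -/
theorem exists_growth (hd : 2 ≤ d) (μ : Measure (SLR d)) [μ.IsHaarMeasure] :
    ∃ κ > (0 : ℝ), (∃ c > (0 : ℝ), ∀ t : ℝ, 1 ≤ t → c * Real.exp (κ * t) ≤ μ.real (Dt d t)) ∧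
      ∀ ε > (0 : ℝ), ∃ C > (0 : ℝ), ∀ t : ℝ, 0 ≤ t → μ.real (Dt d t) ≤ C * Real.exp ((κ + ε) * t) := by
  obtain ⟨B, c, hB⟩ := exists_isSeparating d
  set β := μ.real B with hβ
  have hc := hB.nonneg
  have hβ0 : 0 < β := ENNReal.toReal_pos (isSeparating_pos hB μ).ne' (isSeparating_lt_top hB μ).ne
  set V : ℝ → ℝ := fun t => μ.real (Dt d t) with hV
  have hVmono : ∀ {s t : ℝ}, 0 ≤ s → s ≤ t → V s ≤ V t := fun hs h => measureReal_Dt_mono μ hs h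
  have hVβ : ∀ t, c ≤ t → β ≤ V t := fun t ht =>
    (measureReal_mono (isSeparating_subset hB) (measure_Dt_lt_top μ c).ne).trans (hVmono hc ht)
  have hsub : ∀ s t : ℝ, 0 ≤ s → 0 ≤ t → V (s + t) * β ≤ V (s + c) * V (t + c) := by
    intro s t hs ht
    have := ENNReal.toReal_mono (ENNReal.mul_lt_top (measure_Dt_lt_top μ _)
      (measure_Dt_lt_top μ _)).ne (measure_Dt_add_le hd hB μ hs ht)
    rwa [ENNReal.toReal_mul, ENNReal.toReal_mul] at this
  let u : ℕ → ℝ := fun n => Real.log (V (n + 2 * c) / β)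
  have hq : ∀ t, c ≤ t → 1 ≤ V t / β := fun t ht => (one_le_div hβ0).2 (hVβ t ht)
  have hn2c : ∀ n : ℕ, c ≤ n + 2 * c := fun n => by
    have : (0 : ℝ) ≤ n := n.cast_nonneg
    linarith
  have hu0 : ∀ n, 0 ≤ u n := fun n => Real.log_nonneg (hq _ (hn2c n))
  have hexpu : ∀ n : ℕ, V (n + 2 * c) = β * Real.exp (u n) := fun n => by
    rw [Real.exp_log (by linarith [hq _ (hn2c n)])]
    field_simp
  have hsuba : Subadditive u := by
    intro m n
    change Real.log _ ≤ Real.log _ + Real.log _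
    rw [← Real.log_mul (by linarith [hq _ (hn2c m)]) (by linarith [hq _ (hn2c n)])]
    refine Real.log_le_log (by linarith [hq _ (hn2c (m + n))]) ?_
    have := hsub (m + c) (n + c) (by positivity) (by positivity)
    rw [div_mul_div_comm, div_le_div_iff₀ hβ0 (by positivity)]
    push_cast
    have e1 : (m : ℝ) + n + 2 * c = m + c + (n + c) := by ring
    have e2 : (m : ℝ) + 2 * c = m + c + c := by ring
    have e3 : (n : ℝ) + 2 * c = n + c + c := by ring
    rw [e1, e2, e3]
    nlinarith
  have hbdd : BddBelow (Set.range fun n : ℕ => u n / n) :=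
    ⟨0, by rintro _ ⟨n, rfl⟩; exact div_nonneg (hu0 n) n.cast_nonneg⟩
  have hlim := hsuba.tendsto_lim hbdd
  set κ := hsuba.lim with hκ
  have hκpos : 0 < κ := by
    obtain ⟨A, hA0, hA⟩ := exists_two_pow_mul_le hd hB μ
    have hlog2 : 0 < Real.log 2 := Real.log_pos (by norm_num)
    obtain ⟨q, hq'⟩ := exists_nat_ge (d ^ 2 * Real.log 2 + A)
    have hqpos : (0 : ℝ) < q := by
      have : (0 : ℝ) < d := by exact_mod_cast (by omega : 0 < d)
      exact lt_of_lt_of_le (by positivity) hq'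
    have hle : Real.log 2 / q ≤ κ := by
      have hsubseq : Filter.Tendsto (fun m : ℕ => (m + 1) * q) Filter.atTop Filter.atTop := by
        refine Filter.tendsto_atTop_mono (fun m => ?_) (Filter.tendsto_add_atTop_nat 1)
        have : 0 < q := by exact_mod_cast hqpos
        exact Nat.le_mul_of_pos_right _ this
      refine ge_of_tendsto (hlim.comp hsubseq) (Filter.Eventually.of_forall fun m => ?_)
      have h1 : (m + 1 : ℕ) * Real.log 2 ≤ u ((m + 1) * q) := by
        rw [← Real.log_pow]
        refine Real.log_le_log (by positivity) ?_
        rw [le_div_iff₀ hβ0]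
        refine (hA (m + 1)).trans (hVmono (by positivity) ?_)
        push_cast
        have hm : (1 : ℝ) ≤ m + 1 := by have : (0 : ℝ) ≤ m := m.cast_nonneg; linarith
        nlinarith [mul_le_mul_of_nonneg_left hq' (by linarith : (0 : ℝ) ≤ m + 1),
          mul_le_mul_of_nonneg_right hm hA0]
      change _ ≤ u ((m + 1) * q) / (((m + 1) * q : ℕ) : ℝ)
      push_cast at h1 ⊢
      rw [div_le_div_iff₀ hqpos (by positivity)]
      nlinarith
    exact lt_of_lt_of_le (by positivity) hle
  refine ⟨κ, hκpos, ?_, ?_⟩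
  · set c₁ := β * Real.exp (-(κ * (2 * c + 1))) with hc₁
    set c₂ := V 1 * Real.exp (-(κ * (2 * c + 2))) with hc₂
    have hV1 : 0 < V 1 := measureReal_Dt_pos μ one_pos
    refine ⟨min c₁ c₂, lt_min (by positivity) (by positivity), fun t ht => ?_⟩
    rcases le_or_gt (2 * c + 2) t with h | h
    · set n := ⌊t - 2 * c⌋₊ with hn
      have hn1 : t - 2 * c < n + 1 := Nat.lt_floor_add_one _
      have hn2 : (n : ℝ) ≤ t - 2 * c := Nat.floor_le (by linarith)
      have hn0 : (0 : ℝ) < n := by linarith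
      have h1 : κ ≤ u n / n := hsuba.lim_le_div hbdd (by exact_mod_cast hn0.ne')
      rw [le_div_iff₀ hn0] at h1
      calc min c₁ c₂ * Real.exp (κ * t) ≤ c₁ * Real.exp (κ * t) := by gcongr; exact min_le_left _ _
        _ = β * Real.exp (κ * (t - 2 * c - 1)) := by
          rw [hc₁, mul_assoc, ← Real.exp_add]; ring_nf
        _ ≤ β * Real.exp (u n) := by
          gcongr
          exact (mul_le_mul_of_nonneg_left (by linarith) hκpos.le).trans h1
        _ = V (n + 2 * c) := (hexpu n).symm
        _ ≤ V t := hVmono (by positivity) (by linarith)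
    · calc min c₁ c₂ * Real.exp (κ * t) ≤ c₂ * Real.exp (κ * (2 * c + 2)) := by
            gcongr; exact min_le_right _ _
        _ = V 1 := by rw [hc₂, mul_assoc, ← Real.exp_add]; simp
        _ ≤ V t := hVmono zero_le_one ht
  · intro ε hε
    have hev := hlim.eventually (gt_mem_nhds (show κ < κ + ε by linarith))
    obtain ⟨N, hN⟩ := Filter.eventually_atTop.1 hev
    have hVnn : 0 ≤ V (N + 1 + 2 * c) := measureReal_nonneg
    refine ⟨β * Real.exp (κ + ε) + V (N + 1 + 2 * c), by positivity, fun t ht => ?_⟩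
    have hexp1 : 1 ≤ Real.exp ((κ + ε) * t) := Real.one_le_exp (by positivity)
    set n := ⌈t⌉₊ with hn
    have hn1 : t ≤ n := Nat.le_ceil t
    have hn2 : (n : ℝ) < t + 1 := Nat.ceil_lt_add_one ht
    have h1 : V t ≤ V (n + 2 * c) := hVmono ht (by linarith)
    rcases le_or_gt (N + 1) n with h | h
    · have h2 := hN n (by omega)
      have hn0 : (0 : ℝ) < n := by exact_mod_cast (by omega : 0 < n)
      rw [div_lt_iff₀ hn0] at h2
      calc V t ≤ β * Real.exp (u n) := by rw [← hexpu]; exact h1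
        _ ≤ β * Real.exp ((κ + ε) * (t + 1)) := by
          gcongr
          exact h2.le.trans (mul_le_mul_of_nonneg_left hn2.le (by linarith))
        _ = β * Real.exp (κ + ε) * Real.exp ((κ + ε) * t) := by
          rw [mul_assoc, ← Real.exp_add]; ring_nf
        _ ≤ _ := by gcongr; linarith
    · have h3 : (n : ℝ) ≤ N + 1 := by exact_mod_cast h.le
      calc V t ≤ V (n + 2 * c) := h1
        _ ≤ V (N + 1 + 2 * c) := hVmono (by positivity) (by linarith)
        _ ≤ V (N + 1 + 2 * c) * Real.exp ((κ + ε) * t) := le_mul_of_one_le_right hVnn hexp1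
        _ ≤ _ := by gcongr; linarith [mul_pos hβ0 (Real.exp_pos (κ + ε))]

end

section

section Rep

variable {d : ℕ} {ι : Type*} [Fintype ι] [DecidableEq ι] {R S : Type*} [CommRing R] [CommRing S]

/-- The block matrix `M ⊕ 1`. -/
def extMat (M : Matrix (Fin d) (Fin d) R) : Matrix (Option (Fin d)) (Option (Fin d)) R
  | some i, some j => M i j
  | none, none => 1
  | _, _ => 0

/-- The tensor power over `ι` of the representation `M ↦ M ⊕ 1`. -/
def tensorMat (ι : Type*) [Fintype ι] [DecidableEq ι] (M : Matrix (Fin d) (Fin d) R) :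
    Matrix (ι → Option (Fin d)) (ι → Option (Fin d)) R :=
  Matrix.of fun I J => ∏ l, extMat M (I l) (J l)

lemma tensorMat_apply (M : Matrix (Fin d) (Fin d) R) (I J : ι → Option (Fin d)) :
    tensorMat ι M I J = ∏ l, extMat M (I l) (J l) := rfl

lemma extMat_mul (M N : Matrix (Fin d) (Fin d) R) : extMat (M * N) = extMat M * extMat N := by
  ext i j
  rw [Matrix.mul_apply, Fintype.sum_option]
  rcases i with _ | i <;> rcases j with _ | j <;> simp [extMat, Matrix.mul_apply]

lemma extMat_diagonal (a : Fin d → R) :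
    extMat (Matrix.diagonal a) = Matrix.diagonal fun i => i.elim 1 a := by
  ext i j
  rcases i with _ | i <;> rcases j with _ | j <;> simp [extMat, Matrix.diagonal_apply]

lemma tensorMat_mul (M N : Matrix (Fin d) (Fin d) R) :
    tensorMat ι (M * N) = tensorMat ι M * tensorMat ι N := by
  ext I J
  simp only [Matrix.mul_apply, tensorMat_apply, extMat_mul, ← Finset.prod_mul_distrib]
  rw [Finset.prod_univ_sum, Fintype.piFinset_univ]

lemma tensorMat_diagonal (a : Fin d → R) :
    tensorMat ι (Matrix.diagonal a) = Matrix.diagonal fun I => ∏ l, (I l).elim 1 a := by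
  ext I J
  rw [tensorMat_apply, extMat_diagonal]
  simp only [Matrix.diagonal_apply]
  by_cases h : I = J
  · subst h; simp
  · rw [if_neg h]
    obtain ⟨l, hl⟩ := Function.ne_iff.1 h
    exact Finset.prod_eq_zero (Finset.mem_univ l) (if_neg hl)

lemma tensorMat_one : tensorMat ι (1 : Matrix (Fin d) (Fin d) R) = 1 := by
  rw [← Matrix.diagonal_one, tensorMat_diagonal, ← Matrix.diagonal_one]
  congr 1
  ext I
  refine Finset.prod_eq_one fun l _ => ?_
  rcases I l with _ | i <;> rfl

lemma tensorMat_transpose (M : Matrix (Fin d) (Fin d) R) :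
    tensorMat ι Mᵀ = (tensorMat ι M)ᵀ := by
  ext I J
  rw [Matrix.transpose_apply, tensorMat_apply, tensorMat_apply]
  refine Finset.prod_congr rfl fun l _ => ?_
  rcases I l with _ | i <;> rcases J l with _ | j <;> rfl

lemma tensorMat_map (f : R →+* S) (M : Matrix (Fin d) (Fin d) R) :
    tensorMat ι (M.map f) = (tensorMat ι M).map f := by
  ext I J
  rw [Matrix.map_apply, tensorMat_apply, tensorMat_apply, map_prod]
  refine Finset.prod_congr rfl fun l _ => ?_
  rcases I l with _ | i <;> rcases J l with _ | j <;> simp [extMat]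

end Rep

section RealRep

variable {d : ℕ} {ι : Type*} [Fintype ι] [DecidableEq ι]

/-- The vectors of the tensor representation. -/
abbrev TVec (ι : Type*) (d : ℕ) := (ι → Option (Fin d)) → ℝ

/-- The action of `SL(d, ℝ)` on the tensor representation. -/
def act (g : SLR d) (v : TVec ι d) : TVec ι d := tensorMat ι g.1 *ᵥ v

lemma act_mul (g h : SLR d) (v : TVec ι d) : act (g * h) v = act g (act h v) := by
  unfold act
  rw [Matrix.mulVec_mulVec, ← tensorMat_mul]
  rfl

lemma act_one (v : TVec ι d) : act (1 : SLR d) v = v := by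
  unfold act
  change tensorMat ι (1 : Matrix (Fin d) (Fin d) ℝ) *ᵥ v = v
  rw [tensorMat_one, Matrix.one_mulVec]

lemma act_add (g : SLR d) (v w : TVec ι d) : act g (v + w) = act g v + act g w :=
  Matrix.mulVec_add _ _ _

lemma act_smul (g : SLR d) (r : ℝ) (v : TVec ι d) : act g (r • v) = r • act g v :=
  Matrix.mulVec_smul _ _ _

/-- The character of the diagonal torus through which it acts on a coordinate. -/
def weight (I : ι → Option (Fin d)) (a : Fin d → ℝ) : ℝ := ∑ l, (I l).elim 0 a

lemma tensorMat_expDiag (a : Fin d → ℝ) :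
    tensorMat ι (expDiag a) = Matrix.diagonal fun I => Real.exp (weight I a) := by
  rw [expDiag, tensorMat_diagonal]
  congr 1
  ext I
  rw [weight, Real.exp_sum]
  refine Finset.prod_congr rfl fun l _ => ?_
  rcases I l with _ | i <;> simp

/-- The number of times that the index `i` occurs in `I`. -/
def content (I : ι → Option (Fin d)) (i : Fin d) : ℕ := (Finset.univ.filter fun l => I l = some i).card

lemma weight_eq_sum {ι : Type*} [Fintype ι] (I : ι → Option (Fin d)) (a : Fin d → ℝ) :
    weight I a = ∑ i, (content I i : ℝ) * a i := by
  have : ∀ l, (I l).elim 0 a = ∑ i, if I l = some i then a i else 0 := by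
    intro l
    rcases I l with _ | i <;> simp
  simp only [weight, this]
  rw [Finset.sum_comm]
  refine Finset.sum_congr rfl fun i _ => ?_
  rw [← Finset.sum_filter, Finset.sum_const, nsmul_eq_mul, content]

/-- A coordinate that is expanded by all the elements of the Weyl chamber. -/
def IsDominant (I : ι → Option (Fin d)) : Prop :=
  Antitone (content I) ∧ ∃ i j, content I i ≠ content I j

lemma weight_ge {ι : Type*} [Fintype ι] (I : ι → Option (Fin d)) (hI : IsDominant I) {a : Fin d → ℝ} (ha : Antitone a)
    (hsum : ∑ i, a i = 0) {s : ℝ} (h : s ^ 2 ≤ ∑ i, a i ^ 2) :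
    s / (2 * d ^ 2) ≤ weight I a := by
  obtain ⟨hanti, i, j, hij⟩ := hI
  have hd : 0 < d := i.pos
  set p : Fin d := ⟨0, hd⟩
  set q : Fin d := ⟨d - 1, by omega⟩
  have hp : ∀ i, p ≤ i := fun i => Fin.mk_le_of_le_val (Nat.zero_le _)
  have hq : ∀ i : Fin d, i ≤ q := fun i => by
    change i.1 ≤ d - 1
    omega
  have hn : (content I q : ℝ) + 1 ≤ content I p := by
    have h1 := hanti (hp i)
    have h2 := hanti (hp j)
    have h3 := hanti (hq i)
    have h4 := hanti (hq j)
    exact_mod_cast (by omega : content I q + 1 ≤ content I p)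
  have hpq := ha (hp q)
  have hd' : (1 : ℝ) ≤ d := by exact_mod_cast hd
  have hap : 0 ≤ a p := by
    have : ∑ i, a i ≤ ∑ _i : Fin d, a p := Finset.sum_le_sum fun i _ => ha (hp i)
    rw [hsum] at this
    simp at this
    exact nonneg_of_mul_nonneg_right this (by positivity)
  have haq : a q ≤ 0 := by
    have : ∑ _i : Fin d, a q ≤ ∑ i, a i := Finset.sum_le_sum fun i _ => ha (hq i)
    rw [hsum] at this
    simp at this
    by_contra! h
    nlinarith
  have hrange : s ≤ d * (a p - a q) := by
    refine le_of_sq_le_sq ?_ (mul_nonneg (by positivity) (by linarith))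
    calc s ^ 2 ≤ ∑ i, a i ^ 2 := h
      _ ≤ ∑ _i : Fin d, (a p - a q) ^ 2 := by
        refine Finset.sum_le_sum fun i _ => sq_le_sq' ?_ ?_
        · linarith [ha (hq i)]
        · linarith [ha (hp i)]
      _ = d * (a p - a q) ^ 2 := by simp
      _ ≤ d ^ 2 * (a p - a q) ^ 2 := by gcongr ?_ * _; exact le_self_pow₀ hd' two_ne_zero
      _ = _ := by ring
  have hdouble : 2 * d * weight I a =
      ∑ i, ∑ j, ((content I i : ℝ) - content I j) * (a i - a j) := by
    have e : ∀ i j, ((content I i : ℝ) - content I j) * (a i - a j) =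
      (content I i * a i + content I j * a j) - (content I i * a j + content I j * a i) :=
      fun i j => by ring
    have e2 : ∑ i, (content I i : ℝ) * (d * a i) = d * ∑ i, (content I i : ℝ) * a i := by
      rw [Finset.mul_sum]
      exact Finset.sum_congr rfl fun i _ => by ring
    have e3 : ∑ i, (d : ℝ) * (content I i * a i) = d * ∑ i, (content I i : ℝ) * a i :=
      (Finset.mul_sum _ _ _).symm
    simp only [e, Finset.sum_sub_distrib, Finset.sum_add_distrib, ← Finset.mul_sum, ← Finset.sum_mul,
      hsum, Finset.sum_const, Finset.card_univ, Fintype.card_fin, nsmul_eq_mul, weight_eq_sum]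
    linarith
  have hnn : ∀ i j, 0 ≤ ((content I i : ℝ) - content I j) * (a i - a j) := by
    intro i j
    rcases le_total i j with h | h
    · have h1 : (content I j : ℝ) ≤ content I i := by exact_mod_cast hanti h
      exact mul_nonneg (by linarith) (by linarith [ha h])
    · have h1 : (content I i : ℝ) ≤ content I j := by exact_mod_cast hanti h
      exact mul_nonneg_of_nonpos_of_nonpos (by linarith) (by linarith [ha h])
  have hge : a p - a q ≤ 2 * d * weight I a := by
    rw [hdouble]
    calc a p - a q ≤ ((content I p : ℝ) - content I q) * (a p - a q) :=
          le_mul_of_one_le_left (by linarith) (by linarith)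
      _ ≤ ∑ j, ((content I p : ℝ) - content I j) * (a p - a j) :=
          Finset.single_le_sum (f := fun j => ((content I p : ℝ) - content I j) * (a p - a j))
            (fun j _ => hnn p j) (Finset.mem_univ q)
      _ ≤ _ := Finset.single_le_sum
          (f := fun i => ∑ j, ((content I i : ℝ) - content I j) * (a i - a j))
            (fun i _ => Finset.sum_nonneg fun j _ => hnn i j) (Finset.mem_univ p)
  rw [div_le_iff₀ (by positivity)]
  nlinarith

variable (d ι) in
/-- The invariant vectors. -/
def invSub : Submodule ℝ (TVec ι d) where
  carrier := {v | ∀ g : SLR d, act g v = v}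
  add_mem' := fun hv hw g => by rw [act_add, hv g, hw g]
  zero_mem' := fun g => Matrix.mulVec_zero _
  smul_mem' := fun r v hv g => by rw [act_smul, hv g]

variable (d ι) in
/-- The vectors orthogonal to the invariant vectors. -/
def perpSub : Submodule ℝ (TVec ι d) where
  carrier := {u | ∀ v ∈ invSub d ι, u ⬝ᵥ v = 0}
  add_mem' := fun hv hw v h => by rw [add_dotProduct, hv v h, hw v h, add_zero]
  zero_mem' := fun v _ => zero_dotProduct v
  smul_mem' := fun r u hu v h => by rw [smul_dotProduct, hu v h, smul_zero]

lemma act_dotProduct (g : SLR d) (u v : TVec ι d) :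
    act g u ⬝ᵥ v = u ⬝ᵥ act (g.transpose) v := by
  unfold act
  change _ = u ⬝ᵥ tensorMat ι (g.1)ᵀ *ᵥ v
  rw [tensorMat_transpose, Matrix.mulVec_transpose, dotProduct_comm, Matrix.dotProduct_mulVec,
    dotProduct_comm]

lemma act_mem_perpSub (g : SLR d) {u : TVec ι d} (hu : u ∈ perpSub d ι) : act g u ∈ perpSub d ι := by
  intro v hv
  rw [act_dotProduct, hv, hu v hv]

lemma exists_perp_part (u : TVec ι d) : ∃ u' ∈ perpSub d ι, u - u' ∈ invSub d ι := by
  let e : TVec ι d ≃ₗ[ℝ] EuclideanSpace ℝ (ι → Option (Fin d)) := (WithLp.linearEquiv 2 ℝ _).symm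
  have hin : ∀ x y : TVec ι d, inner ℝ (e x) (e y) = y ⬝ᵥ x := by
    intro x y
    simp [e, PiLp.inner_apply, dotProduct]
  obtain ⟨y, hy, z, hz, hyz⟩ :=
    Submodule.exists_add_mem_mem_orthogonal (K := (invSub d ι).map e.toLinearMap) (v := e u)
  obtain ⟨v, hv, rfl⟩ := hy
  refine ⟨e.symm z, fun w hw => ?_, ?_⟩
  · have := hz (e w) ⟨w, hw, rfl⟩
    rw [← e.apply_symm_apply z, hin] at this
    exact this
  · have : u - e.symm z = v := by
      apply e.injective
      rw [map_sub, e.apply_symm_apply, hyz]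
      simp
    rwa [this]

end RealRep

end

section

variable {d : ℕ} {ι : Type*} [Fintype ι] [DecidableEq ι]

lemma exists_signed_perm (hd : 0 < d) (σ : Equiv.Perm (Fin d)) :
    ∃ (s : SLR d) (e : Fin d → ℝ), (∀ i, e i ≠ 0) ∧ ∀ i j, s i j = if σ i = j then e i else 0 := by
  set i₀ : Fin d := ⟨0, hd⟩
  set e : Fin d → ℝ := Function.update 1 i₀ ((Equiv.Perm.sign σ : ℤ) : ℝ) with he
  have hsq : ((Equiv.Perm.sign σ : ℤ) : ℝ) * ((Equiv.Perm.sign σ : ℤ) : ℝ) = 1 := by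
    rcases Int.units_eq_one_or (Equiv.Perm.sign σ) with h | h <;> simp [h]
  have hdet : (Matrix.diagonal e * σ.permMatrix ℝ).det = 1 := by
    rw [Matrix.det_mul, Matrix.det_diagonal, Matrix.det_permutation, he,
      Finset.prod_update_of_mem (Finset.mem_univ _)]
    simpa using hsq
  refine ⟨⟨_, hdet⟩, e, fun i => ?_, fun i j => ?_⟩
  · rw [he]
    by_cases h : i = i₀
    · subst h
      rw [Function.update_self]
      intro h0
      rw [h0] at hsq
      simp at hsq
    · rw [Function.update_of_ne h]
      simp
  · change (Matrix.diagonal e * σ.permMatrix ℝ) i j = _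
    rw [Matrix.diagonal_mul, Equiv.Perm.permMatrix, PEquiv.toMatrix_apply]
    simp [eq_comm]

lemma act_signed_perm {s : SLR d} {e : Fin d → ℝ} {σ : Equiv.Perm (Fin d)}
    (hs : ∀ i j, s i j = if σ i = j then e i else 0) (v : TVec ι d) (I : ι → Option (Fin d)) :
    act s v I = (∏ l, (I l).elim 1 e) * v (fun l => (I l).map σ) := by
  unfold act
  rw [Matrix.mulVec, dotProduct, Finset.sum_eq_single (fun l => (I l).map σ)]
  · rw [tensorMat_apply]
    congr 1
    refine Finset.prod_congr rfl fun l _ => ?_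
    rcases I l with _ | i
    · rfl
    · change s i (σ i) = e i
      rw [hs, if_pos rfl]
  · intro J _ hJ
    obtain ⟨l, hl⟩ := Function.ne_iff.1 hJ
    rw [tensorMat_apply, Finset.prod_eq_zero (Finset.mem_univ l), zero_mul]
    rcases hI : I l with _ | i <;> rcases hJl : J l with _ | j
    · simp [hI, hJl] at hl
    · rfl
    · rfl
    · change s i j = 0
      rw [hs, if_neg]
      intro h
      simp [hI, hJl, h] at hl
  · intro h
    exact absurd (Finset.mem_univ _) h

lemma content_map {ι : Type*} [Fintype ι] (I : ι → Option (Fin d)) (σ : Equiv.Perm (Fin d)) (i : Fin d) :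
    content (fun l => (I l).map σ) (σ i) = content I i := by
  unfold content
  congr 1
  ext l
  simp only [Finset.mem_filter, Finset.mem_univ, true_and]
  rcases I l with _ | j <;> simp

lemma exists_sorted {ι : Type*} [Fintype ι] (I : ι → Option (Fin d)) : ∃ (σ : Equiv.Perm (Fin d))
    (J : ι → Option (Fin d)), Antitone (content J) ∧ (fun l => (J l).map σ) = I := by
  set f : Fin d → ℕᵒᵈ := fun i => OrderDual.toDual (content I i) with hf
  have hmono := Tuple.monotone_sort f
  set σ := Tuple.sort f
  have h : (fun l => ((fun l => (I l).map σ.symm) l).map σ) = I := by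
    ext l : 1
    rcases hl : I l with _ | i <;> simp [hl]
  refine ⟨σ, fun l => (I l).map σ.symm, fun i j hij => ?_, h⟩
  have := hmono hij
  have h1 : ∀ i, content (fun l => (I l).map σ.symm) i = content I (σ i) := by
    intro i
    rw [← content_map _ σ i, h]
  rw [h1, h1]
  exact this

lemma weight_eq_zero {ι : Type*} [Fintype ι] {I : ι → Option (Fin d)} (hI : ∀ i j, content I i = content I j)
    {a : Fin d → ℝ} (hsum : ∑ i, a i = 0) : weight I a = 0 := by
  rcases Nat.eq_zero_or_pos d with rfl | hd
  · rw [weight_eq_sum]; simp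
  · rw [weight_eq_sum, Finset.sum_congr rfl fun i _ => by rw [hI i ⟨0, hd⟩], ← Finset.mul_sum, hsum,
      mul_zero]

/-- A vector all of whose translates have vanishing dominant coordinates is invariant. -/
lemma mem_invSub_of_dominant_eq_zero (hd : 2 ≤ d) {u : TVec ι d}
    (h : ∀ (g : SLR d) (I : ι → Option (Fin d)), IsDominant I → act g u I = 0) :
    u ∈ invSub d ι := by
  have h1 : ∀ (g : SLR d) (I : ι → Option (Fin d)), (∃ i j, content I i ≠ content I j) →
      act g u I = 0 := by
    rintro g I ⟨i, j, hij⟩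
    obtain ⟨σ, J, hJ, rfl⟩ := exists_sorted I
    obtain ⟨s, e, he, hs⟩ := exists_signed_perm (by omega : 0 < d) σ
    have h2 := h (s * g) J ⟨hJ, σ.symm i, σ.symm j, by
      rw [← content_map J σ, ← content_map J σ]; simpa using hij⟩
    rw [act_mul, act_signed_perm hs] at h2
    refine (mul_eq_zero.1 h2).resolve_left (Finset.prod_ne_zero_iff.2 fun l _ => ?_)
    rcases J l with _ | i
    · exact one_ne_zero
    · exact he i
  have h2 : ∀ (g D : SLR d) (a : Fin d → ℝ), ∑ i, a i = 0 → D.1 = expDiag a →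
      act D (act g u) = act g u := by
    intro g D a ha hD
    conv_lhs => unfold act
    rw [hD, tensorMat_expDiag]
    ext I
    rw [Matrix.mulVec_diagonal]
    by_cases hI : ∃ i j, content I i ≠ content I j
    · change _ * act g u I = _
      rw [h1 g I hI, mul_zero]
    · push Not at hI
      rw [weight_eq_zero hI ha, Real.exp_zero, one_mul]
      rfl
  refine fun g => transvection_induction hd (P := fun g => act g u = u) ?_ ?_ g
  · intro i j hij b
    set D : SLR d := SpecialLinearGroup.diag2n hij (2 : ℝ) two_ne_zero with hD
    have hDe : D.1 = expDiag (fun k => if k = i then Real.log 2 else if k = j then -Real.log 2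
        else 0) := by
      rw [hD, SpecialLinearGroup.diag2n_coe, expDiag]
      congr 1
      ext k
      split_ifs
      · rw [Real.exp_log two_pos]
      · rw [Real.exp_neg, Real.exp_log two_pos]
      · rw [Real.exp_zero]
    have hsum : ∑ k, (if k = i then Real.log 2 else if k = j then -Real.log 2 else 0) = 0 := by
      have e : ∀ k, (if k = i then Real.log 2 else if k = j then -Real.log 2 else 0) =
        (if k = i then Real.log 2 else 0) + (if k = j then -Real.log 2 else 0) := by
        intro k
        by_cases hk : k = i
        · subst hk; simp [hij]
        · simp [hk]
      simp only [e, Finset.sum_add_distrib]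
      simp
    set x : SLR d := SpecialLinearGroup.transvection hij (b / 3) with hx
    have hDx := diag2n_mul_transvection hij (two_ne_zero : (2 : ℝ) ≠ 0) (b / 3)
    have e4 : (2 : ℝ) ^ 2 * (b / 3) = b / 3 + b := by ring
    rw [e4, SpecialLinearGroup.transvection_add, ← hD, ← hx] at hDx
    have h3 : act (x * SpecialLinearGroup.transvection hij b * D) u = act x u := by
      rw [← hDx, act_mul, h2 x D _ hsum hDe]
    rw [mul_assoc, act_mul, act_mul] at h3
    have h4 : act D u = u := by
      have := h2 1 D _ hsum hDe
      rwa [act_one] at this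
    rw [h4] at h3
    have := congrArg (act x⁻¹) h3
    rwa [← act_mul, ← act_mul x⁻¹ x, inv_mul_cancel, act_one, act_one] at this
  · intro A B hA hB
    rw [act_mul, hB, hA]

/-- A nonzero vector orthogonal to the invariant ones has a translate with a nonzero
dominant coordinate. -/
lemma exists_dominant_ne_zero (hd : 2 ≤ d) {u : TVec ι d} (hu : u ∈ perpSub d ι) (h0 : u ≠ 0) :
    ∃ (g : SLR d) (I : ι → Option (Fin d)), IsDominant I ∧ act g u I ≠ 0 := by
  by_contra! h
  exact h0 (dotProduct_self_eq_zero.1 (hu u (mem_invSub_of_dominant_eq_zero hd h)))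

end

section

section Curves

variable {d : ℕ}

/-- Evaluation of a polynomial curve in `SL(d)` at a real number. -/
noncomputable def evalAt (r : ℝ) : SpecialLinearGroup (Fin d) ℝ[X] →* SLR d :=
  SpecialLinearGroup.map (evalRingHom r)

lemma evalAt_apply (r : ℝ) (b : SpecialLinearGroup (Fin d) ℝ[X]) (i j : Fin d) :
    evalAt r b i j = (b i j).eval r := rfl

lemma evalAt_map_comp (r : ℝ) (p : ℝ[X]) (b : SpecialLinearGroup (Fin d) ℝ[X]) :
    evalAt r (SpecialLinearGroup.map (compRingHom p) b) = evalAt (p.eval r) b := by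
  refine Matrix.SpecialLinearGroup.ext _ _ fun i j => ?_
  rw [evalAt_apply, evalAt_apply]
  change ((b i j).comp p).eval r = _
  rw [eval_comp]

lemma exists_curve (hd : 2 ≤ d) (g : SLR d) :
    ∃ b : SpecialLinearGroup (Fin d) ℝ[X], evalAt 0 b = 1 ∧ evalAt 1 b = g := by
  refine transvection_induction hd
    (P := fun g => ∃ b : SpecialLinearGroup (Fin d) ℝ[X], evalAt 0 b = 1 ∧ evalAt 1 b = g) ?_ ?_ g
  · intro i j hij a
    refine ⟨SpecialLinearGroup.transvection hij (C a * X), ?_, ?_⟩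
    · refine Matrix.SpecialLinearGroup.ext _ _ fun k l => ?_
      rw [evalAt_apply]
      change eval 0 (Matrix.transvection i j (C a * X) k l) = (1 : Matrix (Fin d) (Fin d) ℝ) k l
      rw [Matrix.transvection, Matrix.add_apply, Matrix.single_apply, Matrix.one_apply,
        Matrix.one_apply]
      split_ifs <;> simp
    · refine Matrix.SpecialLinearGroup.ext _ _ fun k l => ?_
      rw [evalAt_apply]
      change eval 1 (Matrix.transvection i j (C a * X) k l) = Matrix.transvection i j a k l
      rw [Matrix.transvection, Matrix.transvection, Matrix.add_apply, Matrix.add_apply,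
        Matrix.single_apply, Matrix.single_apply, Matrix.one_apply, Matrix.one_apply]
      split_ifs <;> simp
  · rintro A B ⟨b, hb0, hb1⟩ ⟨c, hc0, hc1⟩
    exact ⟨b * c, by rw [map_mul, hb0, hc0, one_mul], by rw [map_mul, hb1, hc1]⟩

/-- Polynomial curves interpolate any finite sequence of points of `SL(d, ℝ)`. -/
lemma exists_curve_interpolating (hd : 2 ≤ d) (h : ℕ → SLR d) (m : ℕ) :
    ∃ b : SpecialLinearGroup (Fin d) ℝ[X], ∀ i < m, evalAt (i : ℝ) b = h i := by
  induction m with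
  | zero => exact ⟨1, fun i hi => absurd hi (Nat.not_lt_zero i)⟩
  | succ m ih =>
    obtain ⟨b, hb⟩ := ih
    obtain ⟨c, hc0, hc1⟩ := exists_curve hd ((evalAt (m : ℝ) b)⁻¹ * h m)
    set p : ℝ[X] := ∏ i ∈ Finset.range m, (X - C (i : ℝ)) with hp
    have hpm : p.eval (m : ℝ) ≠ 0 := by
      rw [hp, eval_prod, Finset.prod_ne_zero_iff]
      intro i hi
      have : i ≠ m := (Finset.mem_range.1 hi).ne
      simpa [sub_eq_zero] using this.symm
    refine ⟨b * SpecialLinearGroup.map (compRingHom (C (p.eval (m : ℝ))⁻¹ * p)) c, fun i hi => ?_⟩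
    rw [map_mul, evalAt_map_comp, eval_mul, eval_C]
    rcases Nat.lt_succ_iff_lt_or_eq.1 hi with hi | rfl
    · have : p.eval (i : ℝ) = 0 := by
        rw [hp, eval_prod]
        exact Finset.prod_eq_zero (Finset.mem_range.2 hi) (by simp)
      rw [this, mul_zero, hc0, mul_one, hb i hi]
    · rw [inv_mul_cancel₀ hpm, hc1, mul_inv_cancel_left]

/-- A polynomial of bounded degree that is large somewhere on a segment is small at only
boundedly many points of a subdivision. -/
lemma card_small_values_le {f : ℝ[X]} {D M : ℕ} {L r ε : ℝ} (hf : f.natDegree ≤ D) (hL : 0 < L)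
    (hM : 0 < M) (hr : 0 ≤ r) (hrL : r ≤ L) (hε : ε * ((D + 1) * (M : ℝ) ^ D) ≤ |f.eval r|)
    (F : Finset ℕ) (hF : ∀ j ∈ F, j < M ∧ |f.eval (L * j / M)| < ε) : F.card ≤ D := by
  by_contra! hcard
  obtain ⟨s, hsF, hs⟩ := Finset.exists_subset_card_eq (Nat.succ_le_of_lt hcard)
  have hM' : (0 : ℝ) < M := by exact_mod_cast hM
  set v : ℕ → ℝ := fun j => L * j / M with hv
  have hinj : Set.InjOn v s := by
    intro i _ j _ hij
    simp only [hv] at hij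
    field_simp at hij
    exact_mod_cast hij
  have hdeg : f.degree < s.card := by
    refine degree_le_natDegree.trans_lt ?_
    rw [hs]
    exact_mod_cast Nat.lt_succ_of_le hf
  have hbasis : ∀ i ∈ s, |(Lagrange.basis s v i).eval r| ≤ (M : ℝ) ^ D := by
    intro i hi
    rw [Lagrange.basis, eval_prod, Finset.abs_prod]
    have hc : (s.erase i).card = D := by rw [Finset.card_erase_of_mem hi, hs]; rfl
    rw [← hc, ← Finset.prod_const]
    refine Finset.prod_le_prod (fun _ _ => abs_nonneg _) fun j hj => ?_
    obtain ⟨hji, hjs⟩ := Finset.mem_erase.1 hj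
    rw [Lagrange.basisDivisor, eval_mul, eval_C, eval_sub, eval_X, eval_C, abs_mul, abs_inv,
      inv_mul_eq_div]
    have h1 : L / M ≤ |v i - v j| := by
      have : (1 : ℝ) ≤ |(i : ℝ) - j| := by
        have : (1 : ℤ) ≤ |(i : ℤ) - j| := Int.one_le_abs (sub_ne_zero.2 (by exact_mod_cast hji.symm))
        exact_mod_cast this
      calc L / M ≤ L / M * |(i : ℝ) - j| := le_mul_of_one_le_right (by positivity) this
        _ = |v i - v j| := by
          rw [← abs_of_pos (show 0 < L / M by positivity), ← abs_mul]
          congr 1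
          simp only [hv]
          ring
    have h2 : |r - v j| ≤ L := by
      have hj' : (j : ℝ) ≤ M := by exact_mod_cast (hF j (hsF hjs)).1.le
      have h3 : 0 ≤ v j := by simp only [hv]; positivity
      have h4 : v j ≤ L := by
        simp only [hv]
        rw [div_le_iff₀ hM']
        exact mul_le_mul_of_nonneg_left hj' hL.le
      rw [abs_le]
      constructor <;> linarith
    have h5 : 0 < L / M := by positivity
    rw [div_le_iff₀ (h5.trans_le h1)]
    calc |r - v j| ≤ L := h2
      _ = M * (L / M) := by field_simp
      _ ≤ _ := mul_le_mul_of_nonneg_left h1 hM'.le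
  have key : |f.eval r| < ε * ((D + 1) * (M : ℝ) ^ D) := by
    rw [Lagrange.eq_interpolate hinj hdeg, Lagrange.interpolate_apply, eval_finsetSum]
    refine (Finset.abs_sum_le_sum_abs _ _).trans_lt ?_
    have : ε * ((D + 1) * (M : ℝ) ^ D) = ∑ _i ∈ s, ε * (M : ℝ) ^ D := by
      rw [Finset.sum_const, hs, nsmul_eq_mul]
      push_cast
      ring
    rw [this]
    refine Finset.sum_lt_sum_of_nonempty (Finset.card_pos.1 (by omega)) fun i hi => ?_
    rw [eval_mul, eval_C, abs_mul]
    exact (mul_le_mul_of_nonneg_left (hbasis i hi) (abs_nonneg _)).trans_lt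
      (mul_lt_mul_of_pos_right (hF i (hsF hi)).2 (by positivity))
  linarith

end Curves

section Compactness

variable {d : ℕ} {ι : Type*} [Fintype ι] [DecidableEq ι]

lemma continuous_extMat (i j : Option (Fin d)) : Continuous fun g : SLR d => extMat g.1 i j := by
  rcases i with _ | i <;> rcases j with _ | j
  · exact continuous_const
  · exact continuous_const
  · exact continuous_const
  · exact continuous_entry i j

lemma continuous_act : Continuous fun p : SLR d × TVec ι d => act p.1 p.2 := by
  refine continuous_pi fun I => ?_
  change Continuous fun p : SLR d × TVec ι d => ∑ J, (∏ l, extMat p.1.1 (I l) (J l)) * p.2 J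
  refine continuous_finsetSum _ fun J _ => Continuous.mul ?_ ?_
  · exact continuous_finsetProd _ fun l _ => (continuous_extMat _ _).comp continuous_fst
  · exact (continuous_apply J).comp continuous_snd

lemma isCompact_orthogonal_SLR (d : ℕ) : IsCompact {k : SLR d | k.1ᵀ * k.1 = 1} :=
  isClosedEmbedding_coe.isCompact_preimage (isCompact_orthogonal d)

lemma isCompact_unit_perpSub : IsCompact {u : TVec ι d | u ∈ perpSub d ι ∧ ‖u‖ = 1} := by
  have h : {u : TVec ι d | u ∈ perpSub d ι ∧ ‖u‖ = 1} = Metric.sphere 0 1 ∩ perpSub d ι := by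
    ext u
    simp [and_comm]
  rw [h]
  exact (isCompact_sphere _ _).inter_right (perpSub d ι).closed_of_finiteDimensional

lemma exists_finite_translates (hd : 2 ≤ d) (ι : Type*) [Fintype ι] [DecidableEq ι] :
    ∃ H : List (SLR d), ∃ c > (0 : ℝ), ∀ k : SLR d, k.1ᵀ * k.1 = 1 → ∀ u ∈ perpSub d ι, ‖u‖ = 1 →
      ∃ h ∈ H, ∃ I, IsDominant I ∧ c ≤ |act (k * h) u I| := by
  have hcomp := (isCompact_orthogonal_SLR d).prod (isCompact_unit_perpSub (d := d) (ι := ι))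
  have main : ∃ H : List (SLR d), ∃ c > (0 : ℝ), ∀ p ∈ {k : SLR d | k.1ᵀ * k.1 = 1} ×ˢ
      {u : TVec ι d | u ∈ perpSub d ι ∧ ‖u‖ = 1},
      ∃ h ∈ H, ∃ I, IsDominant I ∧ c ≤ |act (p.1 * h) p.2 I| := by
    refine hcomp.induction_on (p := fun s => ∃ H : List (SLR d), ∃ c > (0 : ℝ), ∀ p ∈ s,
      ∃ h ∈ H, ∃ I, IsDominant I ∧ c ≤ |act (p.1 * h) p.2 I|) ?_ ?_ ?_ ?_
    · exact ⟨[], 1, one_pos, fun p hp => absurd hp (Set.notMem_empty p)⟩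
    · rintro s t hst ⟨H, c, hc, h⟩
      exact ⟨H, c, hc, fun p hp => h p (hst hp)⟩
    · rintro s t ⟨H, c, hc, h⟩ ⟨H', c', hc', h'⟩
      refine ⟨H ++ H', min c c', lt_min hc hc', ?_⟩
      rintro p (hp | hp)
      · obtain ⟨x, hx, I, hI, hcI⟩ := h p hp
        exact ⟨x, List.mem_append_left _ hx, I, hI, (min_le_left _ _).trans hcI⟩
      · obtain ⟨x, hx, I, hI, hcI⟩ := h' p hp
        exact ⟨x, List.mem_append_right _ hx, I, hI, (min_le_right _ _).trans hcI⟩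
    · rintro ⟨k, u⟩ ⟨-, hu, hu1⟩
      obtain ⟨g, I, hI, hgI⟩ := exists_dominant_ne_zero hd hu (by
        rintro rfl
        simp at hu1)
      set c := |act g u I| / 2 with hc
      have hc0 : 0 < c := by have := abs_pos.2 hgI; positivity
      have hcont : Continuous fun p : SLR d × TVec ι d => |act (p.1 * (k⁻¹ * g)) p.2 I| := by
        have : Continuous fun p : SLR d × TVec ι d => ((p.1 * (k⁻¹ * g), p.2) : SLR d × TVec ι d) :=
          (continuous_fst.mul continuous_const).prodMk continuous_snd
        exact ((continuous_apply I).comp (continuous_act.comp this)).abs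
      refine ⟨{p | c < |act (p.1 * (k⁻¹ * g)) p.2 I|}, mem_nhdsWithin_of_mem_nhds
        ((isOpen_lt continuous_const hcont).mem_nhds ?_), [k⁻¹ * g], c, hc0, fun p hp =>
          ⟨_, List.mem_singleton_self _, I, hI, le_of_lt hp⟩⟩
      simp only [Set.mem_ofPred_eq, mul_inv_cancel_left]
      rw [hc]
      linarith
  obtain ⟨H, c, hc, h⟩ := main
  exact ⟨H, c, hc, fun k hk u hu hu1 => h (k, u) ⟨hk, hu, hu1⟩⟩

/-- A polynomial curve along which every unit vector orthogonal to the invariants gets, somewhere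
on a fixed segment, a dominant coordinate bounded from below. -/
lemma exists_expanding_curve (hd : 2 ≤ d) (ι : Type*) [Fintype ι] [DecidableEq ι] :
    ∃ (b : SpecialLinearGroup (Fin d) ℝ[X]) (L : ℝ), 0 < L ∧ ∃ c > (0 : ℝ),
      ∀ k : SLR d, k.1ᵀ * k.1 = 1 → ∀ u ∈ perpSub d ι, ‖u‖ = 1 →
      ∃ r, 0 ≤ r ∧ r ≤ L ∧ ∃ I, IsDominant I ∧ c ≤ |act (k * evalAt r b) u I| := by
  obtain ⟨H, c, hc, h⟩ := exists_finite_translates hd ι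
  obtain ⟨b, hb⟩ := exists_curve_interpolating hd (fun i => H.getD i 1) H.length
  refine ⟨b, H.length + 1, by positivity, c, hc, fun k hk u hu hu1 => ?_⟩
  obtain ⟨x, hx, I, hI, hcI⟩ := h k hk u hu hu1
  obtain ⟨i, hi, rfl⟩ := List.getElem_of_mem hx
  refine ⟨i, by positivity, ?_, I, hI, ?_⟩
  · have : (i : ℝ) ≤ H.length := by exact_mod_cast hi.le
    linarith
  · rw [hb i hi]
    simpa [hi] using hcI

/-- The coordinates along a polynomial curve are polynomials of bounded degree. -/
lemma exists_coordinate_poly (b : SpecialLinearGroup (Fin d) ℝ[X]) (ι : Type*) [Fintype ι]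
    [DecidableEq ι] : ∃ D : ℕ, ∀ (k : SLR d) (u : TVec ι d) (I : ι → Option (Fin d)),
      ∃ f : ℝ[X], f.natDegree ≤ D ∧ ∀ r, f.eval r = act (k * evalAt r b) u I := by
  refine ⟨Finset.univ.sup fun K => Finset.univ.sup fun J => (tensorMat ι b.1 K J).natDegree,
    fun k u I => ⟨∑ K, ∑ J, C (tensorMat ι k.1 I K * u J) * tensorMat ι b.1 K J, ?_, fun r => ?_⟩⟩
  · refine natDegree_sum_le_of_forall_le _ _ fun K _ => natDegree_sum_le_of_forall_le _ _ fun J _ => ?_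
    refine (natDegree_C_mul_le _ _).trans ?_
    refine (Finset.le_sup (f := fun J => (tensorMat ι b.1 K J).natDegree) (Finset.mem_univ J)).trans ?_
    exact Finset.le_sup (f := fun K => Finset.univ.sup fun J => (tensorMat ι b.1 K J).natDegree)
      (Finset.mem_univ K)
  · rw [act_mul]
    have h : tensorMat ι (evalAt r b).1 = (tensorMat ι b.1).map (evalRingHom r) := by
      rw [← tensorMat_map]
      rfl
    unfold act
    rw [h]
    simp only [Matrix.mulVec, dotProduct, eval_finsetSum, eval_mul, eval_C, Matrix.map_apply,
      coe_evalRingHom, Finset.mul_sum]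
    refine Finset.sum_congr rfl fun K _ => Finset.sum_congr rfl fun J _ => ?_
    ring

end Compactness

end

section

variable {d : ℕ} {ι : Type*} [Fintype ι] [DecidableEq ι]

lemma abs_tensorMat_le_one {k : Matrix (Fin d) (Fin d) ℝ} (hk : kᵀ * k = 1)
    (I J : ι → Option (Fin d)) : |tensorMat ι k I J| ≤ 1 := by
  rw [tensorMat_apply, Finset.abs_prod]
  refine Finset.prod_le_one (fun _ _ => abs_nonneg _) fun l _ => ?_
  rcases I l with _ | i <;> rcases J l with _ | j
  · simp [extMat]
  · simp [extMat]
  · simp [extMat]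
  · exact orthogonal_entry_le hk i j

lemma exp_weight_mul_le {z k₁ k₂ : SLR d} {a : Fin d → ℝ} (hk₁ : k₁.1ᵀ * k₁.1 = 1)
    (hz : z.1 = k₁.1 * expDiag a * k₂.1) (v : TVec ι d) (I : ι → Option (Fin d)) :
    Real.exp (weight I a) * |act k₂ v I| ≤ Fintype.card (ι → Option (Fin d)) * ‖act z v‖ := by
  have h : Real.exp (weight I a) * act k₂ v I = (tensorMat ι k₁.1ᵀ *ᵥ act z v) I := by
    have : k₁.1ᵀ * z.1 = expDiag a * k₂.1 := by
      rw [hz, ← Matrix.mul_assoc, ← Matrix.mul_assoc, hk₁, Matrix.one_mul]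
    unfold act
    rw [Matrix.mulVec_mulVec, ← tensorMat_mul, this, tensorMat_mul, ← Matrix.mulVec_mulVec,
      tensorMat_expDiag, Matrix.mulVec_diagonal]
  rw [← abs_of_pos (Real.exp_pos (weight I a)), ← abs_mul, h, Matrix.mulVec, dotProduct]
  refine (Finset.abs_sum_le_sum_abs _ _).trans ?_
  rw [← nsmul_eq_mul, ← Finset.card_univ, ← Finset.sum_const]
  refine Finset.sum_le_sum fun J _ => ?_
  rw [abs_mul]
  calc |tensorMat ι k₁.1ᵀ I J| * |act z v J| ≤ 1 * ‖act z v‖ :=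
        mul_le_mul (abs_tensorMat_le_one (orthogonal_transpose hk₁) I J)
          (norm_le_pi_norm (act z v) J) (abs_nonneg _) zero_le_one
    _ = _ := one_mul _

lemma exists_entry_bound (b : SpecialLinearGroup (Fin d) ℝ[X]) (L : ℝ) :
    ∃ R : ℝ, ∀ r, 0 ≤ r → r ≤ L → ∀ i j, |evalAt r b i j| ≤ R := by
  have h : ∀ p : Fin d × Fin d, ∃ R : ℝ, ∀ r ∈ Set.Icc 0 L, ‖(b p.1 p.2).eval r‖ ≤ R := fun p =>
    isCompact_Icc.exists_bound_of_continuousOn (b p.1 p.2).continuous.continuousOn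
  choose R hR using h
  refine ⟨∑ p, |R p|, fun r h0 hL i j => ?_⟩
  calc |evalAt r b i j| ≤ R (i, j) := hR (i, j) r ⟨h0, hL⟩
    _ ≤ |R (i, j)| := le_abs_self _
    _ ≤ _ := Finset.single_le_sum (f := fun p => |R p|) (fun p _ => abs_nonneg _) (Finset.mem_univ _)

lemma isClosed_small (s C₁ : ℝ) (u : TVec ι d) : IsClosed {y : SLR d | y ∈ Dt d s ∧ ‖act y u‖ ≤ C₁} :=
  (isClosed_Dt d s).inter (isClosed_le
    (continuous_act.comp (continuous_id.prodMk continuous_const)).norm continuous_const)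

/-- The comparison of the volume of a set of contracting elements with volumes of balls, through
translations along a polynomial curve. -/
lemma exists_small_measure_le (hd : 2 ≤ d) (μ : Measure (SLR d)) [μ.IsHaarMeasure] (ι : Type*)
    [Fintype ι] [DecidableEq ι] : ∃ (D : ℕ) (c A : ℝ), 0 ≤ c ∧ 0 < A ∧ ∀ C₁ : ℝ, 0 ≤ C₁ →
      ∀ u ∈ perpSub d ι, ‖u‖ = 1 → ∀ s, 0 ≤ s → ∀ M : ℕ, 0 < M →
      A * (C₁ + 1) * Real.exp (-(s / (4 * d ^ 2))) * (M : ℝ) ^ D ≤ 1 →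
      M * μ.real {y | y ∈ Dt d s ∧ ‖act y u‖ ≤ C₁} ≤
        M * μ.real (Dt d (s / 2)) + D * μ.real (Dt d (s + c)) := by
  have := isMulRightInvariant hd μ
  obtain ⟨b, L, hL, c₀, hc₀, hb⟩ := exists_expanding_curve hd ι
  obtain ⟨D, hD⟩ := exists_coordinate_poly b ι
  obtain ⟨R, hR⟩ := exists_entry_bound b⁻¹ L
  obtain ⟨c, hc, hcR⟩ := exists_Dt_mul_right d R
  set N : ℝ := ((Fintype.card (ι → Option (Fin d)) : ℕ) : ℝ) with hN
  have hN0 : 0 < N := by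
    rw [hN]
    exact_mod_cast Fintype.card_pos
  refine ⟨D, c, N * (D + 1) / c₀, hc, by positivity, fun C₁ hC₁ u hu hu1 s hs M hM hMA => ?_⟩
  have hM' : (0 : ℝ) < M := by exact_mod_cast hM
  set E : Set (SLR d) := {y | y ∈ Dt d s ∧ ‖act y u‖ ≤ C₁} with hE
  have hEm : MeasurableSet E := (isClosed_small s C₁ u).measurableSet
  set B : ℕ → SLR d := fun j => evalAt (L * j / M) b with hBdef
  set S : ℕ → Set (SLR d) := fun j => (fun z => z * B j) ⁻¹' E with hS
  have hSm : ∀ j, MeasurableSet (S j) := fun j => (continuous_mul_const (B j)).measurable hEm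
  have hSE : ∀ j, μ (S j) = μ E := fun j => measure_preimage_mul_right μ (B j) E
  have hSsub : ∀ j ∈ Finset.range M, S j ⊆ Dt d (s + c) := by
    intro j hj z hz
    have h1 : ∀ k l, |(B j)⁻¹ k l| ≤ R := by
      have : (B j)⁻¹ = evalAt (L * j / M) b⁻¹ := (map_inv _ _).symm
      rw [this]
      refine hR _ (by positivity) ?_
      rw [div_le_iff₀ hM']
      exact mul_le_mul_of_nonneg_left (by exact_mod_cast (Finset.mem_range.1 hj).le) hL.le
    have := hcR s hs _ hz.1 _ h1
    simpa using this
  have hfew : ∀ z ∉ Dt d (s / 2), ∀ F ⊆ Finset.range M, (∀ j ∈ F, z ∈ S j) → F.card ≤ D := by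
    intro z hz F hF hFS
    obtain ⟨k₁, k₂, a, hk₁, hk₂, hanti, hsum, hzk⟩ := exists_svd z
    rw [mem_Dt_iff hk₁ hk₂ hzk, not_le] at hz
    obtain ⟨r, hr0, hrL, I, hI, hrI⟩ := hb k₂ hk₂ u hu hu1
    obtain ⟨f, hfD, hf⟩ := hD k₂ u I
    have hw := weight_ge I hI hanti hsum hz.le
    refine card_small_values_le (M := M) (ε := N * (C₁ + 1) * Real.exp (-(s / (4 * d ^ 2)))) hfD hL hM
      hr0 hrL ?_ F fun j hj => ⟨Finset.mem_range.1 (hF hj), ?_⟩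
    · rw [hf]
      refine le_trans ?_ hrI
      have : N * (C₁ + 1) * Real.exp (-(s / (4 * d ^ 2))) * ((D + 1) * (M : ℝ) ^ D) =
        (N * (D + 1) / c₀ * (C₁ + 1) * Real.exp (-(s / (4 * d ^ 2))) * (M : ℝ) ^ D) * c₀ := by
        field_simp
      rw [this]
      exact mul_le_of_le_one_left hc₀.le hMA
    · rw [hf]
      have h1 := exp_weight_mul_le hk₁ hzk (act (B j) u) I
      rw [← act_mul, ← act_mul] at h1
      have h2 : ‖act (z * B j) u‖ ≤ C₁ := (hFS j hj).2
      have h3 : Real.exp (weight I a) * |act (k₂ * B j) u I| < N * (C₁ + 1) := by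
        refine h1.trans_lt ?_
        rw [← hN]
        exact mul_lt_mul_of_pos_left (by linarith) hN0
      have h4 : s / (4 * d ^ 2) ≤ weight I a := by
        refine le_trans (le_of_eq ?_) hw
        have : (d : ℝ) ≠ 0 := by positivity
        field_simp
        ring
      calc |act (k₂ * B j) u I|
          = Real.exp (-weight I a) * (Real.exp (weight I a) * |act (k₂ * B j) u I|) := by
            rw [← mul_assoc, ← Real.exp_add, neg_add_cancel, Real.exp_zero, one_mul]
        _ < Real.exp (-weight I a) * (N * (C₁ + 1)) := mul_lt_mul_of_pos_left h3 (Real.exp_pos _)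
        _ ≤ Real.exp (-(s / (4 * d ^ 2))) * (N * (C₁ + 1)) := by
          gcongr
        _ = _ := by ring
  have key : (M : ENNReal) * μ E ≤ M * μ (Dt d (s / 2)) + D * μ (Dt d (s + c)) := by
    calc (M : ENNReal) * μ E = ∑ j ∈ Finset.range M, μ (S j) := by
          simp [hSE]
      _ ≤ ∑ j ∈ Finset.range M, (μ (Dt d (s / 2)) + μ (S j \ Dt d (s / 2))) := by
          refine Finset.sum_le_sum fun j _ => ?_
          refine (measure_mono ?_).trans (measure_union_le _ _)
          exact fun z hz => by
            by_cases h : z ∈ Dt d (s / 2)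
            · exact Or.inl h
            · exact Or.inr ⟨hz, h⟩
      _ = M * μ (Dt d (s / 2)) + ∑ j ∈ Finset.range M, μ (S j \ Dt d (s / 2)) := by
          rw [Finset.sum_add_distrib]
          simp
      _ ≤ _ := by
          refine add_le_add_right (sum_measure_le μ _ _ (fun j _ => (hSm j).diff (measurableSet_Dt _))
            (measurableSet_Dt _) (fun j hj => Set.sdiff_subset.trans (hSsub j hj)) ?_) _
          intro z _ F hF hFS
          rcases F.eq_empty_or_nonempty with rfl | ⟨j, hj⟩
          · simp
          · exact_mod_cast hfew z (hFS j hj).2 F hF fun j hj => (hFS j hj).1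
  have hfin : ∀ t, μ (Dt d t) ≠ ⊤ := fun t => (measure_Dt_lt_top μ t).ne
  have h1 := ENNReal.toReal_mono (ENNReal.add_ne_top.2 ⟨ENNReal.mul_ne_top (ENNReal.natCast_ne_top M)
    (hfin _), ENNReal.mul_ne_top (ENNReal.natCast_ne_top D) (hfin _)⟩) key
  rw [ENNReal.toReal_add (ENNReal.mul_ne_top (ENNReal.natCast_ne_top M) (hfin _))
    (ENNReal.mul_ne_top (ENNReal.natCast_ne_top D) (hfin _)), ENNReal.toReal_mul, ENNReal.toReal_mul,
    ENNReal.toReal_mul, ENNReal.toReal_natCast, ENNReal.toReal_natCast] at h1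
  exact h1

/-- The volume of the set of elements that do not expand a given vector orthogonal to the
invariants is exponentially smaller than that of the ball. -/
lemma exists_small_measure_le_exp (hd : 2 ≤ d) (μ : Measure (SLR d)) [μ.IsHaarMeasure] (ι : Type*)
    [Fintype ι] [DecidableEq ι] {κ : ℝ} (hκ : 0 < κ)
    (hgrowth : ∀ ε > 0, ∃ C > 0, ∀ t, 0 ≤ t → μ.real (Dt d t) ≤ C * Real.exp ((κ + ε) * t)) :
    ∃ δ > 0, ∀ C₁ : ℝ, 0 ≤ C₁ → ∃ C > 0, ∀ u ∈ perpSub d ι, u ≠ 0 → ∀ s, 0 ≤ s →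
      μ.real {y | y ∈ Dt d s ∧ ‖act y u‖ ≤ C₁ * ‖u‖} ≤ C * Real.exp ((κ - δ) * s) := by
  obtain ⟨D, c, A, hc, hA, hmain⟩ := exists_small_measure_le hd μ ι
  have hd' : (0 : ℝ) < d := by positivity
  set η : ℝ := 1 / (8 * d ^ 2 * (D + 1)) with hη
  have hη0 : 0 < η := by positivity
  have hηD : η * D ≤ 1 / (8 * d ^ 2) := by
    rw [hη, div_mul_eq_mul_div, div_le_div_iff₀ (by positivity) (by positivity)]
    nlinarith [sq_nonneg (d : ℝ)]
  set δ : ℝ := min (κ / 4) (η / 2) with hδ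
  have hδ0 : 0 < δ := lt_min (by positivity) (by positivity)
  have hδκ : δ ≤ κ / 4 := min_le_left _ _
  have hδη : δ ≤ η / 2 := min_le_right _ _
  set ε : ℝ := min (κ / 2) (η / 2) with hε
  have hε0 : 0 < ε := lt_min (by positivity) (by positivity)
  have hεκ : ε ≤ κ / 2 := min_le_left _ _
  have hεη : ε ≤ η / 2 := min_le_right _ _
  obtain ⟨C, hC, hV⟩ := hgrowth ε hε0
  refine ⟨δ, hδ0, fun C₁ hC₁ => ?_⟩
  set s₀ : ℝ := 8 * d ^ 2 * |Real.log (A * (C₁ + 1) * 2 ^ D)| with hs₀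
  have hs₀0 : 0 ≤ s₀ := by positivity
  have hunit : ∀ u ∈ perpSub d ι, ‖u‖ = 1 → ∀ s, 0 ≤ s →
      μ.real {y | y ∈ Dt d s ∧ ‖act y u‖ ≤ C₁} ≤
        (μ.real (Dt d s₀) + C + D * C * Real.exp ((κ + ε) * c)) * Real.exp ((κ - δ) * s) := by
    intro u hu hu1 s hs
    rcases le_total s s₀ with hss | hss
    · calc μ.real {y | y ∈ Dt d s ∧ ‖act y u‖ ≤ C₁} ≤ μ.real (Dt d s₀) :=
            measureReal_mono (fun y hy => Dt_mono hs hss hy.1) (measure_Dt_lt_top μ s₀).ne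
        _ = μ.real (Dt d s₀) * 1 := (mul_one _).symm
        _ ≤ _ := by
          refine mul_le_mul ?_ (Real.one_le_exp (mul_nonneg (by linarith) hs)) zero_le_one
            (by positivity)
          have : 0 < C + D * C * Real.exp ((κ + ε) * c) := by positivity
          linarith
    · set M : ℕ := ⌊Real.exp (η * s)⌋₊ + 1 with hM
      have hMge : Real.exp (η * s) ≤ M := by
        rw [hM]
        push_cast
        exact (Nat.lt_floor_add_one _).le
      have hMle : (M : ℝ) ≤ 2 * Real.exp (η * s) := by
        rw [hM]
        push_cast
        have h1 := Nat.floor_le (Real.exp_pos (η * s)).le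
        have h2 : 1 ≤ Real.exp (η * s) := Real.one_le_exp (by positivity)
        linarith
      have hM0 : (0 : ℝ) < M := (Real.exp_pos _).trans_le hMge
      have hcond : A * (C₁ + 1) * Real.exp (-(s / (4 * d ^ 2))) * (M : ℝ) ^ D ≤ 1 := by
        have h1 : (M : ℝ) ^ D ≤ 2 ^ D * Real.exp (s / (8 * d ^ 2)) := by
          calc (M : ℝ) ^ D ≤ (2 * Real.exp (η * s)) ^ D := by gcongr
            _ = 2 ^ D * Real.exp (η * D * s) := by
              rw [mul_pow, ← Real.exp_nat_mul]
              ring_nf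
            _ ≤ 2 ^ D * Real.exp (1 / (8 * d ^ 2) * s) := by gcongr
            _ = _ := by ring_nf
        have h2 : A * (C₁ + 1) * 2 ^ D ≤ Real.exp (s / (8 * d ^ 2)) := by
          rw [← Real.log_le_iff_le_exp (by positivity), le_div_iff₀ (by positivity)]
          refine le_trans ?_ hss
          rw [hs₀, mul_comm]
          gcongr
          exact le_abs_self _
        calc A * (C₁ + 1) * Real.exp (-(s / (4 * d ^ 2))) * (M : ℝ) ^ D
            ≤ A * (C₁ + 1) * Real.exp (-(s / (4 * d ^ 2))) * (2 ^ D * Real.exp (s / (8 * d ^ 2))) := by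
              gcongr
          _ = (A * (C₁ + 1) * 2 ^ D) * (Real.exp (-(s / (4 * d ^ 2))) * Real.exp (s / (8 * d ^ 2))) := by
              ring
          _ ≤ Real.exp (s / (8 * d ^ 2)) *
              (Real.exp (-(s / (4 * d ^ 2))) * Real.exp (s / (8 * d ^ 2))) := by gcongr
          _ = 1 := by
              rw [← Real.exp_add, ← Real.exp_add, Real.exp_eq_one_iff]
              field_simp
              ring
      have h := hmain C₁ hC₁ u hu hu1 s hs M (Nat.succ_pos _) hcond
      set X := μ.real {y | y ∈ Dt d s ∧ ‖act y u‖ ≤ C₁}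
      have h1 : X ≤ μ.real (Dt d (s / 2)) + D * μ.real (Dt d (s + c)) / M := by
        rw [← sub_le_iff_le_add', le_div_iff₀ hM0]
        linarith
      have h2 : μ.real (Dt d (s / 2)) ≤ C * Real.exp ((κ - δ) * s) := by
        refine (hV _ (by positivity)).trans ?_
        gcongr C * Real.exp ?_
        nlinarith
      have h3 : D * μ.real (Dt d (s + c)) / M ≤
          D * C * Real.exp ((κ + ε) * c) * Real.exp ((κ - δ) * s) := by
        calc D * μ.real (Dt d (s + c)) / M
            ≤ D * (C * Real.exp ((κ + ε) * (s + c))) / Real.exp (η * s) := by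
              gcongr
              exact hV _ (by positivity)
          _ = D * C * Real.exp ((κ + ε) * c) * Real.exp ((κ + ε - η) * s) := by
              have : Real.exp ((κ + ε) * (s + c)) =
                  Real.exp ((κ + ε) * c) * Real.exp ((κ + ε - η) * s) * Real.exp (η * s) := by
                rw [← Real.exp_add, ← Real.exp_add]
                ring_nf
              rw [this]
              field_simp
          _ ≤ _ := mul_le_mul_of_nonneg_left (Real.exp_le_exp.2
              (mul_le_mul_of_nonneg_right (by linarith) hs)) (by positivity)
      have h4 : 0 ≤ μ.real (Dt d s₀) * Real.exp ((κ - δ) * s) := by positivity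
      linarith
  refine ⟨μ.real (Dt d s₀) + C + D * C * Real.exp ((κ + ε) * c), by positivity,
    fun u hu hu0 s hs => ?_⟩
  have hn : 0 < ‖u‖ := norm_pos_iff.2 hu0
  have h := hunit (‖u‖⁻¹ • u) ((perpSub d ι).smul_mem _ hu)
    (by rw [norm_smul, norm_inv, norm_norm, inv_mul_cancel₀ hn.ne']) s hs
  simp only [act_smul, norm_smul, norm_inv, norm_norm, inv_mul_le_iff₀ hn] at h
  simpa only [mul_comm C₁] using h

end

section

section Polynomials

variable {d : ℕ}

/-- The space of linear combinations of the entries of the tensor representation. -/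
def coordSpan (d k : ℕ) : Submodule ℝ (Matrix (Fin d) (Fin d) ℝ → ℝ) :=
  Submodule.span ℝ (Set.range fun (p : (Fin k → Option (Fin d)) × (Fin k → Option (Fin d))) M =>
    tensorMat (Fin k) M p.1 p.2)

lemma extMat_mul_mem_coordSpan (p q : Option (Fin d)) {k : ℕ} {φ : Matrix (Fin d) (Fin d) ℝ → ℝ}
    (hφ : φ ∈ coordSpan d k) : (fun M => extMat M p q * φ M) ∈ coordSpan d (k + 1) := by
  induction hφ using Submodule.span_induction with
  | mem φ h =>
    obtain ⟨⟨I, J⟩, rfl⟩ := h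
    refine Submodule.subset_span ⟨(Fin.cons p I, Fin.cons q J), ?_⟩
    ext M
    simp only [tensorMat_apply, Fin.prod_univ_succ, Fin.cons_zero, Fin.cons_succ]
  | zero =>
    convert (coordSpan d (k + 1)).zero_mem using 1
    ext M
    exact mul_zero _
  | add φ ψ _ _ h₁ h₂ =>
    convert (coordSpan d (k + 1)).add_mem h₁ h₂ using 1
    ext M
    simp [mul_add]
  | smul a φ _ h =>
    convert (coordSpan d (k + 1)).smul_mem a h using 1
    ext M
    simp only [Pi.smul_apply, smul_eq_mul]
    ring

lemma coordSpan_mono {k l : ℕ} (h : k ≤ l) : coordSpan d k ≤ coordSpan d l := by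
  induction l, h using Nat.le_induction with
  | base => exact le_rfl
  | succ l _ ih =>
    intro φ hφ
    simpa [extMat] using extMat_mul_mem_coordSpan (none : Option (Fin d)) none (ih hφ)

lemma exists_aeval_mem_coordSpan (h : MvPolynomial (Fin d × Fin d) ℤ) : ∃ k : ℕ,
    (fun M : Matrix (Fin d) (Fin d) ℝ =>
      MvPolynomial.aeval (fun p : Fin d × Fin d => M p.1 p.2) h) ∈ coordSpan d k := by
  induction h using MvPolynomial.induction_on with
  | C a =>
    refine ⟨0, ?_⟩
    have h1 : (fun M : Matrix (Fin d) (Fin d) ℝ => tensorMat (Fin 0) M ![] ![]) ∈ coordSpan d 0 :=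
      Submodule.subset_span ⟨(![], ![]), rfl⟩
    convert (coordSpan d 0).smul_mem (a : ℝ) h1 using 1
    ext M
    simp [tensorMat_apply]
  | add p q hp hq =>
    obtain ⟨k, hk⟩ := hp
    obtain ⟨l, hl⟩ := hq
    refine ⟨max k l, ?_⟩
    convert (coordSpan d (max k l)).add_mem (coordSpan_mono (le_max_left k l) hk)
      (coordSpan_mono (le_max_right k l) hl) using 1
    ext M
    simp
  | mul_X p i hp =>
    obtain ⟨k, hk⟩ := hp
    refine ⟨k + 1, ?_⟩
    convert extMat_mul_mem_coordSpan (some i.1) (some i.2) hk using 1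
    ext M
    simp [extMat, mul_comm]

/-- Polynomials in the entries of a matrix are linear functionals of a tensor power. -/
lemma exists_linear_functional (h : MvPolynomial (Fin d × Fin d) ℤ) : ∃ (k : ℕ)
    (Λ : Matrix (Fin k → Option (Fin d)) (Fin k → Option (Fin d)) ℝ →ₗ[ℝ] ℝ),
    ∀ M : Matrix (Fin d) (Fin d) ℝ, MvPolynomial.aeval (fun p : Fin d × Fin d => M p.1 p.2) h =
      Λ (tensorMat (Fin k) M) := by
  obtain ⟨k, hk⟩ := exists_aeval_mem_coordSpan h
  obtain ⟨c, hc⟩ := (Submodule.mem_span_range_iff_exists_fun ℝ).1 hk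
  refine ⟨k, ∑ p, c p • Matrix.entryLinearMap ℝ ℝ p.1 p.2, fun M => ?_⟩
  rw [← congrFun hc M]
  simp [LinearMap.sum_apply]

end Polynomials

section Minors

lemma exists_minor_ne_zero {ρ : Type*} [Fintype ρ] {j : ℕ} (A : Fin j → ρ → ℤ)
    (hA : LinearIndependent ℤ A) : ∃ f : Fin j → ρ, (Matrix.of fun a b => A b (f a)).det ≠ 0 := by
  classical
  have h1 : LinearIndependent ℤ fun b r => (A b r : ℚ) := by
    let φ : (ρ → ℤ) →ₗ[ℤ] (ρ → ℚ) := LinearMap.compLeft (Algebra.linearMap ℤ ℚ) ρ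
    refine hA.map' φ (LinearMap.ker_eq_bot.2 fun x y hxy => ?_)
    ext r
    have := congrFun hxy r
    simpa [φ] using this
  have h2 : LinearIndependent ℚ fun b r => (A b r : ℚ) := (LinearIndependent.iff_fractionRing ℤ ℚ).1 h1
  set N : Matrix ρ (Fin j) ℚ := Matrix.of fun r b => (A b r : ℚ) with hN
  have hrank : Module.finrank ℚ (Submodule.span ℚ (Set.range N.row)) = j := by
    rw [← Matrix.rank_eq_finrank_span_row, Matrix.rank_eq_finrank_span_cols]
    have := finrank_span_eq_card h2
    rwa [Fintype.card_fin] at this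
  obtain ⟨f, hf, -, hfi⟩ := Submodule.exists_fun_fin_finrank_span_eq ℚ (Set.range N.row)
  choose g hg using hf
  refine ⟨fun a => g (Fin.cast hrank.symm a), fun h0 => ?_⟩
  have h3 : LinearIndependent ℚ (N.submatrix (fun a => g (Fin.cast hrank.symm a)) id).row := by
    have e : (N.submatrix (fun a => g (Fin.cast hrank.symm a)) id).row = f ∘ Fin.cast hrank.symm := by
      ext a b
      simp [← hg]
    rw [e]
    exact hfi.comp (Fin.cast hrank.symm) (Fin.cast_injective _)
  have h4 := (Matrix.isUnit_iff_isUnit_det _).1 (Matrix.linearIndependent_rows_iff_isUnit.1 h3)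
  refine h4.ne_zero ?_
  have : N.submatrix (fun a => g (Fin.cast hrank.symm a)) id =
    (Matrix.of fun a b => A b (g (Fin.cast hrank.symm a))).map (Int.castRingHom ℚ) := by
    ext a b
    simp [hN]
  rw [this, ← RingHom.mapMatrix_apply, ← RingHom.map_det, h0, map_zero]

end Minors

end

section

variable {d j k : ℕ}

/-- The vector of the minors of a family of matrices with prescribed column indices, as a function
of the row indices. -/
noncomputable def minorVec
    (A : Fin j → Matrix (Fin k → Option (Fin d)) (Fin k → Option (Fin d)) ℝ)
    (Y : Fin j → Fin k → Option (Fin d)) : TVec (Fin j × Fin k) d :=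
  fun F => (Matrix.of fun a b => A b (fun l => F (a, l)) (Y a)).det

lemma act_minorVec (g : SLR d)
    (A : Fin j → Matrix (Fin k → Option (Fin d)) (Fin k → Option (Fin d)) ℝ)
    (Y : Fin j → Fin k → Option (Fin d)) :
    act g (minorVec A Y) = minorVec (fun b => tensorMat (Fin k) g.1 * A b) Y := by
  ext F
  have h : (Matrix.of fun a b => (tensorMat (Fin k) g.1 * A b) (fun l => F (a, l)) (Y a)) =
      fun a => ∑ K, tensorMat (Fin k) g.1 (fun l => F (a, l)) K • fun b => A b K (Y a) := by
    ext a b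
    simp [Matrix.mul_apply, Finset.sum_apply]
  rw [minorVec, h]
  change _ = Matrix.detRowAlternating _
  rw [← AlternatingMap.coe_multilinearMap, MultilinearMap.map_sum]
  rw [← (Equiv.curry (Fin j) (Fin k) (Option (Fin d))).sum_comp]
  unfold act
  rw [Matrix.mulVec, dotProduct]
  refine Finset.sum_congr rfl fun F' _ => ?_
  rw [MultilinearMap.map_smul_univ, smul_eq_mul]
  congr 1
  rw [tensorMat_apply, Fintype.prod_prod_type]
  rfl

lemma minorVec_linearCombination
    (A : Fin j → Matrix (Fin k → Option (Fin d)) (Fin k → Option (Fin d)) ℝ)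
    (Y : Fin j → Fin k → Option (Fin d)) (P : Matrix (Fin j) (Fin j) ℝ) :
    minorVec (fun b => ∑ c, P c b • A c) Y = P.det • minorVec A Y := by
  ext F
  rw [Pi.smul_apply, smul_eq_mul, mul_comm, minorVec, minorVec, ← Matrix.det_mul]
  congr 1
  ext a b
  simp [Matrix.mul_apply, Matrix.sum_apply, mul_comm]

/-- Families of matrices with the same minors, not all of them zero, have the same span. -/
lemma mem_span_of_minorVec_eq
    {A A' : Fin j → Matrix (Fin k → Option (Fin d)) (Fin k → Option (Fin d)) ℝ}
    (h : ∀ Y, minorVec A' Y = minorVec A Y)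
    (f : Fin j → (Fin k → Option (Fin d)) × (Fin k → Option (Fin d)))
    (hf : (Matrix.of fun a b => A b (f a).1 (f a).2).det ≠ 0) (b : Fin j) :
    A' b ∈ Submodule.span ℝ (Set.range A) := by
  have hminor : ∀ f : Fin j → (Fin k → Option (Fin d)) × (Fin k → Option (Fin d)),
      (Matrix.of fun a b => A' b (f a).1 (f a).2).det =
        (Matrix.of fun a b => A b (f a).1 (f a).2).det := fun f =>
    congrFun (h fun a => (f a).2) fun p => (f p.1).1 p.2
  set Q := Matrix.of fun a b => A b (f a).1 (f a).2 with hQ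
  set Q' := Matrix.of fun a b => A' b (f a).1 (f a).2 with hQ'
  have hcramer : ∀ r : (Fin k → Option (Fin d)) × (Fin k → Option (Fin d)),
      Q'ᵀ.cramer (fun b => A' b r.1 r.2) = Qᵀ.cramer (fun b => A b r.1 r.2) := by
    intro r
    ext a
    rw [Matrix.cramer_transpose_apply, Matrix.cramer_transpose_apply]
    convert hminor (Function.update f a r) using 2
    all_goals
      ext a' b
      by_cases ha : a' = a
      · subst ha; simp
      · simp [ha, hQ, hQ']
  have hrow : ∀ r : (Fin k → Option (Fin d)) × (Fin k → Option (Fin d)),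
      Q.det * A' b r.1 r.2 =
        ∑ a, Q' a b * ∑ c, Qᵀ.adjugate a c * A c r.1 r.2 := by
    intro r
    have h1 := congrFun (Matrix.mulVec_cramer Q'ᵀ (fun b => A' b r.1 r.2)) b
    rw [hcramer, Matrix.cramer_eq_adjugate_mulVec, Matrix.det_transpose, hQ', hminor f, ← hQ] at h1
    rw [Pi.smul_apply, smul_eq_mul] at h1
    exact h1.symm
  have : A' b = ∑ c, (Q.det⁻¹ * ∑ a, Q' a b * Qᵀ.adjugate a c) • A c := by
    ext I J
    have h1 := hrow (I, J)
    rw [Matrix.sum_apply]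
    simp only [Matrix.smul_apply, smul_eq_mul]
    have h2 : A' b I J = Q.det⁻¹ * (Q.det * A' b I J) := by
      rw [inv_mul_cancel_left₀ hf]
    rw [h2, h1]
    simp only [Finset.mul_sum, Finset.sum_mul]
    rw [Finset.sum_comm]
    refine Finset.sum_congr rfl fun c _ => Finset.sum_congr rfl fun a _ => ?_
    ring
  rw [this]
  exact Submodule.sum_mem _ fun c _ => Submodule.smul_mem _ _ (Submodule.subset_span ⟨c, rfl⟩)

lemma tensorMat_toSLR (γ : SpecialLinearGroup (Fin d) ℤ) :
    tensorMat (Fin k) (toSLR γ).1 = (Int.castRingHom ℝ).mapMatrix (tensorMat (Fin k) γ.1) := by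
  rw [RingHom.mapMatrix_apply, ← tensorMat_map]
  rfl

/-- If a subspace contains an integral point of the group but not a whole coset, then the integral
matrices preserving it have a common eigenvector orthogonal to the invariants in some tensor
representation, which is not contracted. -/
lemma exists_common_eigenvector
    (U : Submodule ℝ (Matrix (Fin k → Option (Fin d)) (Fin k → Option (Fin d)) ℝ))
    {γ₀ : SpecialLinearGroup (Fin d) ℤ} (hγ₀ : tensorMat (Fin k) (toSLR γ₀).1 ∈ U) {g₀ : SLR d}
    (hg₀ : tensorMat (Fin k) (g₀ * toSLR γ₀).1 ∉ U) :
    ∃ j ≤ Module.finrank ℤ (Matrix (Fin k → Option (Fin d)) (Fin k → Option (Fin d)) ℤ),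
      ∃ u ∈ perpSub d (Fin j × Fin k), u ≠ 0 ∧ ∀ y : SpecialLinearGroup (Fin d) ℤ,
        (∀ A ∈ U, tensorMat (Fin k) (toSLR y).1 * A ∈ U) →
        ∃ l : ℝ, 1 ≤ |l| ∧ act (toSLR y) u = l • u := by
  let φ : Matrix (Fin k → Option (Fin d)) (Fin k → Option (Fin d)) ℤ →ₗ[ℤ]
    Matrix (Fin k → Option (Fin d)) (Fin k → Option (Fin d)) ℝ :=
    (Int.castRingHom ℝ).mapMatrix.toAddMonoidHom.toIntLinearMap
  have hφ : ∀ M, φ M = (Int.castRingHom ℝ).mapMatrix M := fun M => rfl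
  let W : Submodule ℤ (Matrix (Fin k → Option (Fin d)) (Fin k → Option (Fin d)) ℤ) :=
    (U.restrictScalars ℤ).comap φ
  have hWmem : ∀ M, M ∈ W ↔ φ M ∈ U := fun M => Iff.rfl
  set j := Module.finrank ℤ W with hj
  let β : Module.Basis (Fin j) ℤ W := Module.finBasis ℤ W
  set A : Fin j → Matrix (Fin k → Option (Fin d)) (Fin k → Option (Fin d)) ℝ :=
    fun b => φ (β b).1 with hA
  have hAU : ∀ b, A b ∈ U := fun b => (β b).2
  have hrepr : ∀ M (hM : M ∈ W), φ M = ∑ c, ((β.repr ⟨M, hM⟩ c : ℤ) : ℝ) • A c := by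
    intro M hM
    have h1 := congrArg (fun w : W => φ w.1) (β.sum_repr ⟨M, hM⟩)
    simp only [Submodule.coe_sum, Submodule.coe_smul, map_sum, map_smul] at h1
    rw [← h1]
    exact Finset.sum_congr rfl fun c _ => (Int.cast_smul_eq_zsmul ℝ _ _).symm
  obtain ⟨f, hf⟩ := exists_minor_ne_zero
    (fun (b : Fin j) (p : (Fin k → Option (Fin d)) × (Fin k → Option (Fin d))) =>
      (β b).1 p.1 p.2) (by
    let ψ : W →ₗ[ℤ] ((Fin k → Option (Fin d)) × (Fin k → Option (Fin d)) → ℤ) :=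
      { toFun := fun w p => w.1 p.1 p.2
        map_add' := fun _ _ => rfl
        map_smul' := fun _ _ => rfl }
    exact β.linearIndependent.map' ψ (LinearMap.ker_eq_bot.2 fun w w' h => Subtype.ext (by
      ext I J
      exact congrFun h (I, J))))
  have hfR : (Matrix.of fun a b => A b (f a).1 (f a).2).det ≠ 0 := by
    have : (Matrix.of fun a b => A b (f a).1 (f a).2) =
        (Int.castRingHom ℝ).mapMatrix (Matrix.of fun a b => (β b).1 (f a).1 (f a).2) := by
      ext a b
      rfl
    rw [this, ← RingHom.map_det]
    exact Int.cast_ne_zero.2 hf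
  have hY : ∃ Y, minorVec A Y ∉ invSub d (Fin j × Fin k) := by
    by_contra! hinv
    have hspan := mem_span_of_minorVec_eq (A' := fun b => tensorMat (Fin k) g₀.1 * A b)
      (fun Y => by rw [← act_minorVec]; exact hinv Y g₀) f hfR
    have hle : Submodule.span ℝ (Set.range A) ≤ U := Submodule.span_le.2 (by
      rintro _ ⟨b, rfl⟩
      exact hAU b)
    have h1 : tensorMat (Fin k) γ₀.1 ∈ W := by
      rw [hWmem, hφ, ← tensorMat_toSLR]
      exact hγ₀
    have h2 : tensorMat (Fin k) (g₀ * toSLR γ₀).1 =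
        ∑ c, ((β.repr ⟨_, h1⟩ c : ℤ) : ℝ) • (tensorMat (Fin k) g₀.1 * A c) := by
      change tensorMat (Fin k) (g₀.1 * (toSLR γ₀).1) = _
      rw [tensorMat_mul, tensorMat_toSLR, ← hφ, hrepr _ h1, Matrix.mul_sum]
      exact Finset.sum_congr rfl fun c _ => Matrix.mul_smul _ _ _
    exact hg₀ (h2 ▸ Submodule.sum_mem _ fun c _ => Submodule.smul_mem _ _ (hle (hspan c)))
  obtain ⟨Y, hY⟩ := hY
  obtain ⟨u, hu, huv⟩ := exists_perp_part (minorVec A Y)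
  refine ⟨j, Submodule.finrank_le W, u, hu, ?_, fun y hy => ?_⟩
  · rintro rfl
    exact hY (by simpa using huv)
  have hyW : ∀ b, tensorMat (Fin k) y.1 * (β b).1 ∈ W := by
    intro b
    rw [hWmem, hφ, map_mul, ← tensorMat_toSLR]
    exact hy _ (hAU b)
  set P : Matrix (Fin j) (Fin j) ℤ := Matrix.of fun c b => β.repr ⟨_, hyW b⟩ c with hP
  set l : ℝ := (P.map (Int.castRingHom ℝ)).det with hl
  have hlP : l = (P.det : ℝ) := by
    rw [hl, ← RingHom.mapMatrix_apply, ← RingHom.map_det]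
    rfl
  have hact : act (toSLR y) (minorVec A Y) = l • minorVec A Y := by
    rw [act_minorVec, hl, ← minorVec_linearCombination]
    congr 1
    ext1 b
    rw [tensorMat_toSLR]
    change (Int.castRingHom ℝ).mapMatrix _ * (Int.castRingHom ℝ).mapMatrix _ = _
    rw [← map_mul, ← hφ, hrepr _ (hyW b)]
    rfl
  have hl1 : 1 ≤ |l| := by
    have h0 : P.det ≠ 0 := by
      intro h0
      rw [hlP, h0, Int.cast_zero, zero_smul] at hact
      have h1 := congrArg (act (toSLR y)⁻¹) hact
      rw [← act_mul, inv_mul_cancel, act_one] at h1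
      refine hY (h1 ▸ ?_)
      unfold act
      rw [Matrix.mulVec_zero]
      exact Submodule.zero_mem _
    rw [hlP]
    exact_mod_cast Int.one_le_abs h0
  refine ⟨l, hl1, ?_⟩
  set v := minorVec A Y - u with hv
  have huv' : u = minorVec A Y - v := by rw [hv]; abel
  have h1 : act (toSLR y) u - l • u ∈ invSub d (Fin j × Fin k) := by
    have : act (toSLR y) u - l • u = (l - 1) • v := by
      have hneg : act (toSLR y) u = act (toSLR y) (minorVec A Y) + (-1 : ℝ) • act (toSLR y) v := by
        rw [← act_smul, ← act_add, huv']
        congr 1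
        simp [sub_eq_add_neg]
      rw [hneg, hact, huv _, huv']
      module
    rw [this]
    exact Submodule.smul_mem _ _ huv
  have h2 : act (toSLR y) u - l • u ∈ perpSub d (Fin j × Fin k) :=
    Submodule.sub_mem _ (act_mem_perpSub _ hu) (Submodule.smul_mem _ _ hu)
  exact sub_eq_zero.1 (dotProduct_self_eq_zero.1 (h2 _ h1))

end

section

variable {d : ℕ} {ι : Type*} [Fintype ι] [DecidableEq ι]

lemma exists_norm_act_le (c : ℝ) : ∃ C : ℝ, 1 ≤ C ∧ ∀ b ∈ Dt d c, ∀ v : TVec ι d,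
    ‖act b v‖ ≤ C * ‖v‖ := by
  have hK : IsCompact ((Dt d c) ×ˢ (Metric.closedBall (0 : TVec ι d) 1)) :=
    (isCompact_Dt d c).prod (isCompact_closedBall _ _)
  obtain ⟨C, hC⟩ := hK.exists_bound_of_continuousOn (continuous_act (d := d) (ι := ι)).continuousOn
  refine ⟨max C 1, le_max_right _ _, fun b hb v => ?_⟩
  rcases eq_or_ne v 0 with rfl | hv
  · simp [act]
  have hv' : 0 < ‖v‖ := norm_pos_iff.2 hv
  have h1 := hC (b, ‖v‖⁻¹ • v) ⟨hb, by simp [norm_smul, hv'.ne']⟩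
  simp only [act_smul, norm_smul, norm_inv, norm_norm] at h1
  rw [inv_mul_le_iff₀ hv', mul_comm] at h1
  exact h1.trans (mul_le_mul_of_nonneg_right (le_max_left _ _) hv'.le)

/-- The elements of `Dt d t` whose inverse moves `γ` into `Dt d s`. -/
def between (s t : ℝ) (γ : SpecialLinearGroup (Fin d) ℤ) : Set (SLR d) :=
  {g | g ∈ Dt d t ∧ toSLR γ * g⁻¹ ∈ Dt d s}

/-- The elements of `between s t γ` for which the vector `u` is not expanded. -/
def smallBetween (u : TVec ι d) (s t : ℝ) (γ : SpecialLinearGroup (Fin d) ℤ) : Set (SLR d) :=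
  {g | g ∈ between s t γ ∧ ‖act (g * (toSLR γ)⁻¹) u‖ ≤ ‖u‖}

lemma isClosed_between (s t : ℝ) (γ : SpecialLinearGroup (Fin d) ℤ) : IsClosed (between s t γ) := by
  have h : Continuous fun g : SLR d => toSLR γ * g⁻¹ :=
    (continuous_const_mul (toSLR γ)).comp continuous_inv
  exact (isClosed_Dt d t).inter ((isClosed_Dt d s).preimage h)

lemma continuous_act_mul_const (a : SLR d) (u : TVec ι d) :
    Continuous fun g : SLR d => act (g * a) u := by
  have h : Continuous fun g : SLR d => (g * a, u) :=
    (continuous_mul_const a).prodMk continuous_const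
  have h' := continuous_act.comp h
  exact h'

lemma isClosed_smallBetween (u : TVec ι d) (s t : ℝ) (γ : SpecialLinearGroup (Fin d) ℤ) :
    IsClosed (smallBetween u s t γ) := by
  have h := continuous_act_mul_const (toSLR γ)⁻¹ u
  exact (isClosed_between s t γ).inter (isClosed_le h.norm continuous_const)

lemma sum_measure_between_sdiff_le (hd : 2 ≤ d) {B : Set (SLR d)} {c : ℝ} (hB : IsSeparating B c)
    (μ : Measure (SLR d)) [μ.IsHaarMeasure] {C₁ : ℝ} (hC₁ : 0 ≤ C₁)
    (hact : ∀ b ∈ B, ∀ v : TVec ι d, ‖act b v‖ ≤ C₁ * ‖v‖) {s t : ℝ} (hs : 0 ≤ s)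
    {K : ENNReal} (hK : ∀ w ∈ perpSub d ι, w ≠ 0 →
      μ {y | y ∈ Dt d (s + c) ∧ ‖act y w‖ ≤ C₁ * ‖w‖} ≤ K)
    {u : TVec ι d} (hu : u ∈ perpSub d ι) (F : Finset (SpecialLinearGroup (Fin d) ℤ))
    (hF : ∀ γ ∈ F, ∀ γ' ∈ F, ∀ x : SLR d, toSLR γ * x⁻¹ ∈ Dt d s → toSLR γ' * x⁻¹ ∈ Dt d s →
      ∃ l : ℝ, 1 ≤ |l| ∧ act (toSLR (γ * γ'⁻¹)) u = l • u) :
    ∑ γ ∈ F, μ (between s t γ \ smallBetween u s t γ) ≤ K / μ B * μ (Dt d t) := by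
  refine sum_measure_le μ F _ (fun γ _ => (isClosed_between s t γ).measurableSet.diff
    (isClosed_smallBetween u s t γ).measurableSet) (measurableSet_Dt _) (fun γ _ g hg => hg.1.1)
    fun x _ F' hF' hx => ?_
  rw [ENNReal.le_div_iff_mul_le (Or.inl (isSeparating_pos hB μ).ne')
    (Or.inl (isSeparating_lt_top hB μ).ne)]
  rcases F'.eq_empty_or_nonempty with rfl | ⟨γ, hγ⟩
  · simp
  set w := act (x * (toSLR γ)⁻¹) u with hw
  have hwu : ‖u‖ < ‖w‖ := by
    by_contra! h
    exact (hx γ hγ).2 ⟨(hx γ hγ).1, h⟩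
  refine le_trans (packing_left hd hB μ F' x⁻¹ (Q := {y | y ∈ Dt d (s + c) ∧
    ‖act y w‖ ≤ C₁ * ‖w‖}) fun γ' hγ' b hb => ⟨?_, ?_⟩)
    (hK w (act_mem_perpSub _ hu) (norm_pos_iff.1 ((norm_nonneg _).trans_lt hwu)))
  · exact hB.mul_left _ hs _ (hx γ' hγ').1.2 b hb
  · obtain ⟨l, hl, hlu⟩ := hF γ (hF' hγ) γ' (hF' hγ') x (hx γ hγ).1.2 (hx γ' hγ').1.2
    have hl0 : l ≠ 0 := by
      rintro rfl
      norm_num at hl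
    have h1 : act (toSLR γ' * x⁻¹) w = l⁻¹ • u := by
      have h2 : toSLR γ' * x⁻¹ * (x * (toSLR γ)⁻¹) = (toSLR (γ * γ'⁻¹))⁻¹ := by
        rw [map_mul, map_inv]; group
      have h3 : u = l⁻¹ • act (toSLR (γ * γ'⁻¹)) u := by
        rw [hlu, smul_smul, inv_mul_cancel₀ hl0, one_smul]
      rw [hw, ← act_mul, h2]
      conv_lhs => rw [h3]
      rw [act_smul, ← act_mul, inv_mul_cancel, act_one]
    rw [act_mul, h1]
    refine (hact b hb _).trans (mul_le_mul_of_nonneg_left ?_ hC₁)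
    rw [norm_smul, norm_inv, Real.norm_eq_abs]
    calc |l|⁻¹ * ‖u‖ ≤ 1 * ‖u‖ :=
          mul_le_mul_of_nonneg_right (inv_le_one_of_one_le₀ hl) (norm_nonneg _)
      _ ≤ ‖w‖ := by linarith

lemma sum_measure_smallBetween_le (hd : 2 ≤ d) {B : Set (SLR d)} {c : ℝ} (hB : IsSeparating B c)
    (μ : Measure (SLR d)) [μ.IsHaarMeasure] {s t : ℝ} (ht : 0 ≤ t) (u : TVec ι d)
    (F : Finset (SpecialLinearGroup (Fin d) ℤ)) :
    ∑ γ ∈ F, μ (smallBetween u s t γ) ≤ μ (Dt d (t + c)) / μ B *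
      μ {y | y ∈ Dt d s ∧ ‖act y u‖ ≤ ‖u‖} := by
  have := isMulRightInvariant hd μ
  have h1 : ∑ γ ∈ F, μ ((fun z => z * toSLR γ) ⁻¹' smallBetween u s t γ) ≤
      μ (Dt d (t + c)) / μ B * μ {y | y ∈ Dt d s ∧ ‖act y u‖ ≤ ‖u‖} := by
    refine sum_measure_le μ F _
      (fun γ _ => ((isClosed_smallBetween u s t γ).preimage (continuous_mul_const _)).measurableSet)
      (isClosed_small _ _ _).measurableSet (fun γ _ z hz => ?_) fun z _ F' hF' hz => ?_
    · have h2 : toSLR γ * (z * toSLR γ)⁻¹ ∈ Dt d s := hz.1.2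
      have h3 : ‖act (z * toSLR γ * (toSLR γ)⁻¹) u‖ ≤ ‖u‖ := hz.2
      rw [_root_.mul_inv_rev, mul_inv_cancel_left] at h2
      rw [mul_inv_cancel_right] at h3
      exact ⟨mem_Dt_inv_iff.1 h2, h3⟩
    · rw [ENNReal.le_div_iff_mul_le (Or.inl (isSeparating_pos hB μ).ne')
        (Or.inl (isSeparating_lt_top hB μ).ne)]
      exact packing_right hB μ F' z fun γ hγ b hb => hB.mul_right _ ht _ (hz γ hγ).1.1 b hb
  simpa only [measure_preimage_mul_right] using h1

lemma measure_between_le (hd : 2 ≤ d) (μ : Measure (SLR d)) [μ.IsHaarMeasure] (s t : ℝ)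
    (γ : SpecialLinearGroup (Fin d) ℤ) : μ (between s t γ) ≤ μ (Dt d s) := by
  have := isMulRightInvariant hd μ
  rw [← measure_preimage_mul_right μ (toSLR γ)⁻¹ (Dt d s)]
  refine measure_mono fun g hg => ?_
  have h1 : (toSLR γ * g⁻¹)⁻¹ ∈ Dt d s := mem_Dt_inv hg.2
  rwa [_root_.mul_inv_rev, inv_inv] at h1

/-- The counting inequality. A finite set `F` of integral elements of a ball of radius `s + t`,
most of whose quotients stretch the vector `u` by a factor at least one, is small provided that few
elements of a ball contract a given vector. -/
lemma card_mul_measure_le (hd : 2 ≤ d) {B : Set (SLR d)} {c : ℝ} (hB : IsSeparating B c)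
    (μ : Measure (SLR d)) [μ.IsHaarMeasure] {C₁ : ℝ} (hC₁ : 1 ≤ C₁)
    (hact : ∀ b ∈ B, ∀ v : TVec ι d, ‖act b v‖ ≤ C₁ * ‖v‖) {s t : ℝ} (hs : 0 ≤ s) (ht : 0 ≤ t)
    {K : ENNReal} (hK : ∀ w ∈ perpSub d ι, w ≠ 0 →
      μ {y | y ∈ Dt d (s + c + c) ∧ ‖act y w‖ ≤ C₁ * ‖w‖} ≤ K)
    {u : TVec ι d} (hu : u ∈ perpSub d ι) (hu0 : u ≠ 0)
    (F Z : Finset (SpecialLinearGroup (Fin d) ℤ)) (hF : ∀ γ ∈ F, toSLR γ ∈ Dt d (s + t))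
    (hZ : ∀ γ ∈ F, ∀ γ' ∈ F, ∀ x : SLR d, toSLR γ * x⁻¹ ∈ Dt d (s + c) →
      toSLR γ' * x⁻¹ ∈ Dt d (s + c) → γ' ∉ Z →
      ∃ l : ℝ, 1 ≤ |l| ∧ act (toSLR (γ * γ'⁻¹)) u = l • u) :
    F.card * μ B ≤ K / μ B * μ (Dt d (t + c)) + μ (Dt d (t + c + c)) / μ B * K
      + Z.card * μ (Dt d (s + c)) := by
  classical
  have hc := hB.nonneg
  have hR := sum_measure_between_sdiff_le hd hB μ (zero_le_one.trans hC₁) hact (t := t + c)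
    (add_nonneg hs hc) hK hu (F.filter (· ∉ Z)) fun γ hγ γ' hγ' x h h' =>
      hZ γ (Finset.mem_filter.1 hγ).1 γ' (Finset.mem_filter.1 hγ').1 x h h'
        (Finset.mem_filter.1 hγ').2
  have hsub : μ {y | y ∈ Dt d (s + c) ∧ ‖act y u‖ ≤ ‖u‖} ≤
      μ {y | y ∈ Dt d (s + c + c) ∧ ‖act y u‖ ≤ C₁ * ‖u‖} :=
    measure_mono fun y hy => ⟨Dt_mono (add_nonneg hs hc) (by linarith) hy.1,
      hy.2.trans (le_mul_of_one_le_left (norm_nonneg _) hC₁)⟩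
  have hS := (sum_measure_smallBetween_le hd hB μ (s := s + c) (add_nonneg ht hc) u
    (F.filter (· ∉ Z))).trans (mul_le_mul_right (hsub.trans (hK u hu hu0)) _)
  have hT : ∑ γ ∈ F.filter (· ∈ Z), μ (between (s + c) (t + c) γ) ≤ Z.card * μ (Dt d (s + c)) := by
    refine (Finset.sum_le_sum fun γ _ => measure_between_le hd μ _ _ γ).trans ?_
    rw [Finset.sum_const, nsmul_eq_mul]
    refine mul_le_mul_left (Nat.cast_le.2 (Finset.card_le_card fun γ hγ => ?_)) _
    exact (Finset.mem_filter.1 hγ).2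
  have hRS : ∑ γ ∈ F.filter (· ∉ Z), μ (between (s + c) (t + c) γ) ≤
      K / μ B * μ (Dt d (t + c)) + μ (Dt d (t + c + c)) / μ B * K := by
    refine le_trans ?_ (add_le_add hR hS)
    rw [← Finset.sum_add_distrib]
    refine Finset.sum_le_sum fun γ _ => (measure_mono ?_).trans (measure_union_le _ _)
    exact fun g hg => (em (g ∈ smallBetween u (s + c) (t + c) γ)).elim Or.inr fun h => Or.inl ⟨hg, h⟩
  calc (F.card : ENNReal) * μ B = ∑ γ ∈ F, μ B := by rw [Finset.sum_const, nsmul_eq_mul]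
    _ ≤ ∑ γ ∈ F, μ (between (s + c) (t + c) γ) :=
        Finset.sum_le_sum fun γ hγ => measure_between hd hB μ hs ht (hF γ hγ)
    _ = ∑ γ ∈ F.filter (· ∉ Z), μ (between (s + c) (t + c) γ) +
        ∑ γ ∈ F.filter (· ∈ Z), μ (between (s + c) (t + c) γ) :=
        (Finset.sum_filter_not_add_sum_filter _ _ _).symm
    _ ≤ _ := add_le_add hRS hT

end

section

variable {d : ℕ} {ι : Type*} [Fintype ι] [DecidableEq ι]

/-- All quotients `γ * γ'⁻¹` of elements of `F` lying in a common translate of `Dt d s`, with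
`γ'` outside `Z`, act on `u` by a scalar of absolute value at least one. -/
def QuotientsStretch (u : TVec ι d) (s : ℝ) (F Z : Finset (SpecialLinearGroup (Fin d) ℤ)) : Prop :=
  ∀ γ ∈ F, ∀ γ' ∈ F, ∀ x : SLR d, toSLR γ * x⁻¹ ∈ Dt d s → toSLR γ' * x⁻¹ ∈ Dt d s → γ' ∉ Z →
    ∃ l : ℝ, 1 ≤ |l| ∧ act (toSLR (γ * γ'⁻¹)) u = l • u

lemma exists_card_le (hd : 2 ≤ d) {B : Set (SLR d)} {c : ℝ} (hB : IsSeparating B c)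
    (μ : Measure (SLR d)) [μ.IsHaarMeasure] (ι : Type*) [Fintype ι] [DecidableEq ι] {κ : ℝ}
    (hκ : 0 < κ)
    (hgrowth : ∀ ε > 0, ∃ C > 0, ∀ t, 0 ≤ t → μ.real (Dt d t) ≤ C * Real.exp ((κ + ε) * t)) :
    ∃ δ > 0, ∃ C > 0, ∀ u ∈ perpSub d ι, u ≠ 0 → ∀ s t, 0 ≤ s → 0 ≤ t →
      ∀ F Z : Finset (SpecialLinearGroup (Fin d) ℤ), (∀ γ ∈ F, toSLR γ ∈ Dt d (s + t)) →
        QuotientsStretch u (s + c) F Z →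
        (F.card : ℝ) ≤ C * (Real.exp ((κ - δ) * s) * μ.real (Dt d (t + c + c)) +
          Z.card * μ.real (Dt d (s + c))) := by
  obtain ⟨δ, hδ, hsmall⟩ := exists_small_measure_le_exp hd μ ι hκ hgrowth
  obtain ⟨C₁, hC₁, hact⟩ := exists_norm_act_le (d := d) (ι := ι) c
  obtain ⟨C, hC, hmain⟩ := hsmall C₁ (by linarith)
  have hc := hB.nonneg
  set b := μ.real B with hb
  have hb0 : 0 < b := ENNReal.toReal_pos (isSeparating_pos hB μ).ne' (isSeparating_lt_top hB μ).ne
  have hμB : μ B = ENNReal.ofReal b := (ENNReal.ofReal_toReal (isSeparating_lt_top hB μ).ne).symm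
  have hD : ∀ t, μ (Dt d t) = ENNReal.ofReal (μ.real (Dt d t)) := fun t =>
    (ENNReal.ofReal_toReal (measure_Dt_lt_top μ t).ne).symm
  have hD0 : ∀ t, 0 ≤ μ.real (Dt d t) := fun t => measureReal_nonneg
  refine ⟨δ, hδ, 2 * (C * Real.exp ((κ - δ) * (c + c))) / b ^ 2 + b⁻¹, by positivity,
    fun u hu hu0 s t hs ht F Z hF hZ => ?_⟩
  set k := C * Real.exp ((κ - δ) * (s + c + c)) with hk
  have hk0 : 0 ≤ k := by positivity
  have h1 := card_mul_measure_le hd hB μ hC₁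
    (fun b' hb' => hact b' (isSeparating_subset hB hb')) hs ht (K := ENNReal.ofReal k)
    (fun w hw hw0 => ?_) hu hu0 F Z hF hZ
  · rw [hμB, hD, hD, hD, ← ENNReal.ofReal_natCast, ← ENNReal.ofReal_natCast,
      ← ENNReal.ofReal_div_of_pos hb0, ← ENNReal.ofReal_div_of_pos hb0,
      ← ENNReal.ofReal_mul (by positivity), ← ENNReal.ofReal_mul (by positivity),
      ← ENNReal.ofReal_mul (by positivity), ← ENNReal.ofReal_mul (by positivity),
      ← ENNReal.ofReal_add (by positivity) (by positivity),
      ← ENNReal.ofReal_add (by positivity) (by positivity),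
      ENNReal.ofReal_le_ofReal_iff (by positivity)] at h1
    have h2 : μ.real (Dt d (t + c)) ≤ μ.real (Dt d (t + c + c)) :=
      measureReal_Dt_mono μ (by positivity) (by linarith)
    have hke : k = C * Real.exp ((κ - δ) * (c + c)) * Real.exp ((κ - δ) * s) := by
      rw [hk, mul_assoc, ← Real.exp_add]
      ring_nf
    set W := μ.real (Dt d (t + c + c))
    set Y := μ.real (Dt d (s + c))
    have hW : 0 ≤ W := hD0 _
    have hY : 0 ≤ Y := hD0 _
    have h3 : (F.card : ℝ) * b ≤ 2 * k / b * W + Z.card * Y := by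
      have h4 : k / b * μ.real (Dt d (t + c)) ≤ k / b * W :=
        mul_le_mul_of_nonneg_left h2 (by positivity)
      have h5 : W / b * k = k / b * W := by ring
      have h6 : 2 * k / b * W = k / b * W + k / b * W := by ring
      linarith
    have h7 : (F.card : ℝ) ≤ 2 * k / b ^ 2 * W + b⁻¹ * (Z.card * Y) := by
      rw [← mul_le_mul_iff_left₀ hb0]
      refine h3.trans (le_of_eq ?_)
      field_simp
    refine h7.trans ?_
    set e := Real.exp ((κ - δ) * s)
    set e' := Real.exp ((κ - δ) * (c + c))
    have he : 0 < e := Real.exp_pos _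
    have he' : 0 < e' := Real.exp_pos _
    have h8 : (2 * (C * e') / b ^ 2 + b⁻¹) * (e * W + Z.card * Y) =
        2 * (C * e' * e) / b ^ 2 * W + b⁻¹ * (Z.card * Y) +
        (2 * (C * e') / b ^ 2 * (Z.card * Y) + b⁻¹ * (e * W)) := by ring
    rw [h8, hke]
    exact le_add_of_nonneg_right (by positivity)
  · rw [← ENNReal.ofReal_toReal (a := μ {y | _})
      ((measure_mono fun y hy => hy.1).trans_lt (measure_Dt_lt_top μ (s + c + c))).ne]
    exact ENNReal.ofReal_le_ofReal (hmain w hw hw0 _ (by positivity))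

/-- The constants in `exists_card_le` may be chosen uniformly over finitely many tensor powers. -/
lemma exists_card_le_uniform (hd : 2 ≤ d) {B : Set (SLR d)} {c : ℝ} (hB : IsSeparating B c)
    (μ : Measure (SLR d)) [μ.IsHaarMeasure] (k m : ℕ) {κ : ℝ} (hκ : 0 < κ)
    (hgrowth : ∀ ε > 0, ∃ C > 0, ∀ t, 0 ≤ t → μ.real (Dt d t) ≤ C * Real.exp ((κ + ε) * t)) :
    ∃ δ > 0, ∃ C > 0, ∀ j ≤ m, ∀ u ∈ perpSub d (Fin j × Fin k), u ≠ 0 → ∀ s t, 0 ≤ s → 0 ≤ t →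
      ∀ F Z : Finset (SpecialLinearGroup (Fin d) ℤ), (∀ γ ∈ F, toSLR γ ∈ Dt d (s + t)) →
        QuotientsStretch u (s + c) F Z →
        (F.card : ℝ) ≤ C * (Real.exp ((κ - δ) * s) * μ.real (Dt d (t + c + c)) +
          Z.card * μ.real (Dt d (s + c))) := by
  induction m with
  | zero =>
    obtain ⟨δ, hδ, C, hC, h⟩ := exists_card_le hd hB μ (Fin 0 × Fin k) hκ hgrowth
    refine ⟨δ, hδ, C, hC, fun j hj => ?_⟩
    obtain rfl := Nat.le_zero.1 hj
    exact h
  | succ m ih =>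
    obtain ⟨δ, hδ, C, hC, h⟩ := exists_card_le hd hB μ (Fin (m + 1) × Fin k) hκ hgrowth
    obtain ⟨δ', hδ', C', hC', h'⟩ := ih
    have hmono : ∀ δ₁ C₁ : ℝ, min δ δ' ≤ δ₁ → C₁ ≤ max C C' → ∀ s t x : ℝ, 0 ≤ s → 0 ≤ x →
        C₁ * (Real.exp ((κ - δ₁) * s) * μ.real (Dt d (t + c + c)) + x * μ.real (Dt d (s + c))) ≤
        max C C' * (Real.exp ((κ - min δ δ') * s) * μ.real (Dt d (t + c + c)) +
          x * μ.real (Dt d (s + c))) := by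
      intro δ₁ C₁ h₁ h₂ s t x hs hx
      have h3 : Real.exp ((κ - δ₁) * s) ≤ Real.exp ((κ - min δ δ') * s) :=
        Real.exp_le_exp.2 (mul_le_mul_of_nonneg_right (by linarith) hs)
      exact mul_le_mul h₂ (add_le_add_left (mul_le_mul_of_nonneg_right h3 measureReal_nonneg) _)
        (by positivity) (by positivity)
    refine ⟨min δ δ', lt_min hδ hδ', max C C', lt_max_of_lt_left hC, fun j hj => ?_⟩
    rcases Nat.le_succ_iff.1 hj with hj | rfl
    · exact fun u hu hu0 s t hs ht F Z hF hZ => (h' j hj u hu hu0 s t hs ht F Z hF hZ).trans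
        (hmono _ _ (min_le_right _ _) (le_max_right _ _) _ _ _ hs (by positivity))
    · exact fun u hu hu0 s t hs ht F Z hF hZ => (h u hu hu0 s t hs ht F Z hF hZ).trans
        (hmono _ _ (min_le_left _ _) (le_max_left _ _) _ _ _ hs (by positivity))

end

section

variable {d : ℕ}

lemma finite_entries_le (R : ℝ) :
    {γ : SpecialLinearGroup (Fin d) ℤ | ∀ i j, |((γ.1 i j : ℤ) : ℝ)| ≤ R}.Finite := by
  have h := (Fintype.piFinset fun _ : Fin d => Fintype.piFinset fun _ : Fin d =>
    Finset.Icc (-⌊R⌋) ⌊R⌋).finite_toSet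
  refine (h.preimage (f := fun γ : SpecialLinearGroup (Fin d) ℤ => fun i j => γ.1 i j)
    fun γ _ γ' _ hγ => Subtype.ext hγ).subset fun γ hγ => ?_
  simp only [Set.mem_preimage, SetLike.mem_coe, Fintype.mem_piFinset, Finset.mem_Icc]
  exact fun i j => abs_le.1 (Int.le_floor.2 (by exact_mod_cast hγ i j))

lemma card_entries_le {R : ℝ} (hR : 1 ≤ R) :
    ((finite_entries_le (d := d) R).toFinset.card : ℝ) ≤ (3 * R) ^ (d * d) := by
  set N := ⌊R⌋ with hN
  have hN0 : 0 ≤ N := Int.floor_nonneg.2 (by linarith)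
  have h1 : (finite_entries_le (d := d) R).toFinset.card ≤
      (Fintype.piFinset fun _ : Fin d => Fintype.piFinset fun _ : Fin d =>
        Finset.Icc (-N) N).card := by
    refine Finset.card_le_card_of_injOn (fun γ => fun i j => γ.1 i j) (fun γ hγ => ?_)
      fun γ _ γ' _ hγ => Subtype.ext hγ
    have hγ' : ∀ i j, |((γ.1 i j : ℤ) : ℝ)| ≤ R := by simpa using hγ
    simp only [SetLike.mem_coe, Fintype.mem_piFinset, Finset.mem_Icc]
    exact fun i j => abs_le.1 (Int.le_floor.2 (by exact_mod_cast hγ' i j))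
  have h2 : ((N + 1 - -N).toNat : ℝ) ≤ 3 * R := by
    have h3 : (((N + 1 - -N).toNat : ℤ) : ℝ) = ((N + 1 - -N : ℤ) : ℝ) := by
      rw [Int.toNat_of_nonneg (by omega)]
    have h4 : (N : ℝ) ≤ R := Int.floor_le R
    push_cast at h3
    have h5 : ((N + 1 - -N).toNat : ℝ) = N + 1 - -N := by exact_mod_cast h3
    rw [h5]
    linarith
  calc ((finite_entries_le (d := d) R).toFinset.card : ℝ)
      ≤ (((N + 1 - -N).toNat ^ (d * d) : ℕ) : ℝ) := by
        refine Nat.cast_le.2 (h1.trans (le_of_eq ?_))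
        simp [Fintype.card_piFinset, pow_mul]
    _ ≤ (3 * R) ^ (d * d) := by
        push_cast
        exact pow_le_pow_left₀ (by positivity) h2 _

/-- The number of integral quotients of elements of `Dt d s` grows at most exponentially. -/
lemma exists_card_quotients_le (hd : 2 ≤ d) : ∃ A > 0, ∃ P > 0, ∀ s : ℝ, 0 ≤ s →
    ∃ Y : Finset (SpecialLinearGroup (Fin d) ℤ), (Y.card : ℝ) ≤ A * Real.exp (P * s) ∧
      ∀ y, ∀ a ∈ Dt d s, ∀ b ∈ Dt d s, toSLR y = a * b → y ∈ Y := by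
  have hd0 : (0 : ℝ) < d := by positivity
  have hd1 : (1 : ℝ) ≤ d := by exact_mod_cast (by omega : 1 ≤ d)
  refine ⟨(3 * (d : ℝ) ^ 5) ^ (d * d), by positivity, 2 * (d * d), by positivity, fun s hs => ?_⟩
  have hR1 : 1 ≤ (d : ℝ) ^ 5 * Real.exp (2 * s) :=
    one_le_mul_of_one_le_of_one_le (one_le_pow₀ hd1) (Real.one_le_exp (by positivity))
  refine ⟨(finite_entries_le ((d : ℝ) ^ 5 * Real.exp (2 * s))).toFinset, ?_, ?_⟩
  · refine (card_entries_le hR1).trans (le_of_eq ?_)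
    rw [← mul_assoc, mul_pow, ← Real.exp_nat_mul]
    congr 2
    push_cast
    ring
  · intro y a ha b hb hab
    rw [Set.Finite.mem_toFinset]
    intro i j
    have h1 : ((y.1 i j : ℤ) : ℝ) = ∑ l, a.1 i l * b.1 l j := by
      have h2 : (toSLR y).1 i j = (a * b).1 i j := by rw [hab]
      exact h2
    rw [h1]
    calc |∑ l, a.1 i l * b.1 l j| ≤ ∑ l, |a.1 i l * b.1 l j| := Finset.abs_sum_le_sum_abs _ _
      _ ≤ ∑ _l : Fin d, (d * (d * Real.exp s)) * (d * (d * Real.exp s)) := by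
          refine Finset.sum_le_sum fun l _ => ?_
          rw [abs_mul]
          exact mul_le_mul (entry_le_of_mem_Dt hs ha i l) (entry_le_of_mem_Dt hs hb l j)
            (abs_nonneg _) (by positivity)
      _ = (d : ℝ) ^ 5 * Real.exp (2 * s) := by
          rw [two_mul, Real.exp_add, Finset.sum_const, Finset.card_univ, Fintype.card_fin,
            nsmul_eq_mul]
          ring

lemma exp_bound_of_growth {κ δ₀ δ' θ C₁ C₂ C' A P c t : ℝ} (hδ₀ : 0 < δ₀)
    (hθ0 : 0 < θ) (hθ : θ * (P + κ + 1) ≤ δ' / 2)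
    (hC₁ : 0 < C₁) (hC₂ : 0 < C₂) (hC' : 0 < C') (hA : 0 < A)
    (ht : 0 ≤ t) {V₁ V₂ N : ℝ} (hV₂0 : 0 ≤ V₂)
    (hV₁ : V₁ ≤ C₁ * Real.exp ((κ + δ₀ * θ / 2) * ((1 - θ) * t + c + c)))
    (hV₂ : V₂ ≤ C₂ * Real.exp ((κ + 1) * (θ * t + c)))
    (hN : N ≤ A * Real.exp (P * (θ * t + c)) * (C' * Real.exp ((κ - δ') * t))) :
    Real.exp ((κ - δ₀) * (θ * t)) * V₁ + N * V₂ ≤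
      (C₁ * Real.exp ((κ + δ₀ * θ / 2) * (c + c)) + A * C' * C₂ * Real.exp ((P + κ + 1) * c)) *
        Real.exp ((κ - min (δ₀ * θ / 2) (δ' / 2)) * t) := by
  have h1 : Real.exp ((κ - δ₀) * (θ * t)) * V₁ ≤
      C₁ * Real.exp ((κ + δ₀ * θ / 2) * (c + c)) *
        Real.exp ((κ - min (δ₀ * θ / 2) (δ' / 2)) * t) := by
    calc Real.exp ((κ - δ₀) * (θ * t)) * V₁ ≤ Real.exp ((κ - δ₀) * (θ * t)) *
          (C₁ * Real.exp ((κ + δ₀ * θ / 2) * ((1 - θ) * t + c + c))) :=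
          mul_le_mul_of_nonneg_left hV₁ (by positivity)
      _ = C₁ * Real.exp ((κ + δ₀ * θ / 2) * (c + c)) *
          Real.exp (((κ - δ₀) * θ + (κ + δ₀ * θ / 2) * (1 - θ)) * t) := by
          rw [mul_left_comm, ← Real.exp_add, mul_assoc, ← Real.exp_add]
          ring_nf
      _ ≤ _ := by
          refine mul_le_mul_of_nonneg_left (Real.exp_le_exp.2 (mul_le_mul_of_nonneg_right ?_ ht))
            (by positivity)
          have := min_le_left (δ₀ * θ / 2) (δ' / 2)
          have : 0 ≤ δ₀ * θ / 2 * θ := by positivity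
          nlinarith
  have h2 : N * V₂ ≤ A * C' * C₂ * Real.exp ((P + κ + 1) * c) *
        Real.exp ((κ - min (δ₀ * θ / 2) (δ' / 2)) * t) := by
    calc N * V₂ ≤ A * Real.exp (P * (θ * t + c)) * (C' * Real.exp ((κ - δ') * t)) *
          (C₂ * Real.exp ((κ + 1) * (θ * t + c))) :=
          mul_le_mul hN hV₂ hV₂0 (by positivity)
      _ = A * C' * C₂ * (Real.exp (P * (θ * t + c)) * Real.exp ((κ - δ') * t) *
          Real.exp ((κ + 1) * (θ * t + c))) := by ring
      _ = A * C' * C₂ * Real.exp ((P + κ + 1) * c) *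
          Real.exp ((κ - δ' + θ * (P + κ + 1)) * t) := by
          rw [← Real.exp_add, ← Real.exp_add, mul_assoc _ (Real.exp _), ← Real.exp_add]
          ring_nf
      _ ≤ _ := by
          refine mul_le_mul_of_nonneg_left (Real.exp_le_exp.2 (mul_le_mul_of_nonneg_right ?_ ht))
            (by positivity)
          have := min_le_right (δ₀ * θ / 2) (δ' / 2)
          linarith
  linarith

/-- Integral elements whose tensor power lies in a fixed proper subspace are rare. -/
lemma exists_card_mem_submodule_le (hd : 2 ≤ d) (μ : Measure (SLR d)) [μ.IsHaarMeasure] {k : ℕ}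
    {κ : ℝ} (hκ : 0 < κ)
    (hgrowth : ∀ ε > 0, ∃ C > 0, ∀ t, 0 ≤ t → μ.real (Dt d t) ≤ C * Real.exp ((κ + ε) * t))
    (U₀ : Submodule ℝ (Matrix (Fin k → Option (Fin d)) (Fin k → Option (Fin d)) ℝ))
    {g₁ : SLR d} (hg₁ : tensorMat (Fin k) g₁.1 ∉ U₀) (n : ℕ) :
    ∃ δ > 0, ∃ C > 0, ∀ U ≤ U₀, Module.finrank ℝ U ≤ n → ∀ t, 0 ≤ t →
      ∀ F : Finset (SpecialLinearGroup (Fin d) ℤ),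
        (∀ γ ∈ F, toSLR γ ∈ Dt d t ∧ tensorMat (Fin k) (toSLR γ).1 ∈ U) →
        (F.card : ℝ) ≤ C * Real.exp ((κ - δ) * t) := by
  classical
  induction n with
  | zero =>
    refine ⟨1, one_pos, 1, one_pos, fun U _ hU0 t _ F hF => ?_⟩
    rcases F.eq_empty_or_nonempty with rfl | ⟨γ, hγ⟩
    · simpa using (Real.exp_pos _).le
    · exfalso
      have h1 := (hF γ hγ).2
      rw [Submodule.finrank_eq_zero.1 (Nat.le_zero.1 hU0), Submodule.mem_bot] at h1
      have h2 : g₁.1 = (g₁ * (toSLR γ)⁻¹).1 * (toSLR γ).1 := by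
        change g₁.1 = (g₁ * (toSLR γ)⁻¹ * toSLR γ).1
        rw [inv_mul_cancel_right]
      apply hg₁
      rw [h2, tensorMat_mul, h1, mul_zero]
      exact U₀.zero_mem
  | succ n ih =>
    obtain ⟨δ', hδ', C', hC', ih⟩ := ih
    obtain ⟨B, c, hB⟩ := exists_isSeparating d
    have hc := hB.nonneg
    obtain ⟨δ₀, hδ₀, C₀, hC₀, hcount⟩ := exists_card_le_uniform hd hB μ k
      (Module.finrank ℤ (Matrix (Fin k → Option (Fin d)) (Fin k → Option (Fin d)) ℤ)) hκ hgrowth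
    obtain ⟨A, hA, P, hP, hY⟩ := exists_card_quotients_le hd
    set θ : ℝ := min (1 / 2) (δ' / 2 / (P + κ + 1)) with hθdef
    have hθ0 : 0 < θ := lt_min (by norm_num) (by positivity)
    have hθ1 : θ < 1 := (min_le_left _ _).trans_lt (by norm_num)
    have hθ : θ * (P + κ + 1) ≤ δ' / 2 :=
      (le_div_iff₀ (by positivity)).1 (min_le_right _ _)
    obtain ⟨C₁, hC₁, hV₁⟩ := hgrowth (δ₀ * θ / 2) (by positivity)
    obtain ⟨C₂, hC₂, hV₂⟩ := hgrowth 1 one_pos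
    refine ⟨min (δ₀ * θ / 2) (δ' / 2), lt_min (by positivity) (by positivity),
      C₀ * (C₁ * Real.exp ((κ + δ₀ * θ / 2) * (c + c)) +
        A * C' * C₂ * Real.exp ((P + κ + 1) * c)), by positivity, fun U hU hUn t ht F hF => ?_⟩
    have hs : 0 ≤ θ * t := by positivity
    have hr : 0 ≤ (1 - θ) * t := mul_nonneg (by linarith) ht
    rcases F.eq_empty_or_nonempty with rfl | ⟨γ₀, hγ₀⟩
    · simp only [Finset.card_empty, Nat.cast_zero]
      positivity
    obtain ⟨j, hj, u, hu, hu0, heig⟩ := exists_common_eigenvector U (g₀ := g₁ * (toSLR γ₀)⁻¹)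
      (hF γ₀ hγ₀).2 (fun h => hg₁ (hU (by rwa [inv_mul_cancel_right] at h)))
    obtain ⟨Y, hYcard, hYmem⟩ := hY (θ * t + c) (by positivity)
    let Z : Finset (SpecialLinearGroup (Fin d) ℤ) :=
      (Y.filter fun y => ¬ ∀ M ∈ U, tensorMat (Fin k) (toSLR y).1 * M ∈ U).biUnion fun y =>
        F.filter fun γ => tensorMat (Fin k) (toSLR y).1 * tensorMat (Fin k) (toSLR γ).1 ∈ U
    have hZ : (Z.card : ℝ) ≤
        A * Real.exp (P * (θ * t + c)) * (C' * Real.exp ((κ - δ') * t)) := by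
      refine (Nat.cast_le.2 Finset.card_biUnion_le).trans ?_
      rw [Nat.cast_sum]
      refine (Finset.sum_le_card_nsmul _ _ (C' * Real.exp ((κ - δ') * t)) fun y hy => ?_).trans ?_
      · have hyU := (Finset.mem_filter.1 hy).2
        refine ih (U ⊓ U.comap (LinearMap.mulLeft ℝ (tensorMat (Fin k) (toSLR y).1)))
          (inf_le_left.trans hU) ?_ t ht _ fun γ hγ => ?_
        · refine Nat.lt_succ_iff.1 (lt_of_lt_of_le (Submodule.finrank_lt_finrank_of_lt ?_) hUn)
          refine inf_le_left.lt_of_ne fun h => hyU fun M hM => ?_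
          rw [← h] at hM
          exact hM.2
        · have hγ' := Finset.mem_filter.1 hγ
          exact ⟨(hF γ hγ'.1).1, (hF γ hγ'.1).2, hγ'.2⟩
      · rw [nsmul_eq_mul]
        exact mul_le_mul_of_nonneg_right
          ((Nat.cast_le.2 (Finset.card_filter_le _ _)).trans hYcard) (by positivity)
    have hst : θ * t + (1 - θ) * t = t := by ring
    have hmain := hcount j hj u hu hu0 (θ * t) ((1 - θ) * t) hs hr F Z
      (fun γ hγ => by rw [hst]; exact (hF γ hγ).1) fun γ hγ γ' hγ' x hx hx' hnot => by
        refine heig (γ * γ'⁻¹) ?_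
        by_contra hcon
        refine hnot (Finset.mem_biUnion.2 ⟨γ * γ'⁻¹, Finset.mem_filter.2 ⟨?_, hcon⟩,
          Finset.mem_filter.2 ⟨hγ', ?_⟩⟩)
        · refine hYmem _ _ hx _ (mem_Dt_inv hx') ?_
          rw [map_mul, map_inv]
          group
        · rw [← tensorMat_mul]
          have h1 : (toSLR (γ * γ'⁻¹)).1 * (toSLR γ').1 = (toSLR γ).1 := by
            change (toSLR (γ * γ'⁻¹) * toSLR γ').1 = _
            rw [← map_mul, inv_mul_cancel_right]
          rw [h1]
          exact (hF γ hγ).2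
    refine hmain.trans ?_
    rw [mul_assoc]
    exact mul_le_mul_of_nonneg_left (exp_bound_of_growth hδ₀ hθ0 hθ hC₁ hC₂ hC' hA ht
      measureReal_nonneg (hV₁ _ (by positivity)) (hV₂ _ (by positivity)) hZ) hC₀.le

end

section

variable {d : ℕ}

lemma aeval_toSLR_eq_zero_iff (h : MvPolynomial (Fin d × Fin d) ℤ)
    (γ : SpecialLinearGroup (Fin d) ℤ) :
    MvPolynomial.aeval (fun p : Fin d × Fin d => (toSLR γ).1 p.1 p.2) h = (0 : ℝ) ↔
      MvPolynomial.eval (fun p : Fin d × Fin d => γ.1 p.1 p.2) h = 0 := by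
  have h1 := MvPolynomial.map_aeval (fun p : Fin d × Fin d => γ.1 p.1 p.2) (Int.castRingHom ℝ) h
  have h2 : (Int.castRingHom ℝ).comp (algebraMap ℤ ℤ) = algebraMap ℤ ℝ := RingHom.ext_int _ _
  rw [h2, MvPolynomial.aeval_eq_eval] at h1
  have h3 : MvPolynomial.aeval (fun p : Fin d × Fin d => (toSLR γ).1 p.1 p.2) h =
      ((MvPolynomial.eval (fun p : Fin d × Fin d => γ.1 p.1 p.2) h : ℤ) : ℝ) := h1.symm
  rw [h3, Int.cast_eq_zero]

lemma finite_toSLR_mem_Dt {t : ℝ} (ht : 0 ≤ t) :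
    {γ : SpecialLinearGroup (Fin d) ℤ | toSLR γ ∈ Dt d t}.Finite :=
  (finite_entries_le (d * (d * Real.exp t))).subset fun _ hγ i j => entry_le_of_mem_Dt ht hγ i j

lemma exp_le_rpow_of_growth {κ δ c t V : ℝ} (hκ : 0 < κ) (hδ : δ ≤ κ) (hc : 0 < c)
    (hV : c * Real.exp (κ * t) ≤ V) :
    Real.exp ((κ - δ) * t) ≤ (c ^ (1 - δ / κ))⁻¹ * V ^ (1 - δ / κ) := by
  have h0 : 0 ≤ 1 - δ / κ := by
    have := (div_le_one hκ).2 hδ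
    linarith
  have hV0 : 0 ≤ V := (by positivity : 0 ≤ c * Real.exp (κ * t)).trans hV
  rw [← Real.inv_rpow hc.le, ← Real.mul_rpow (by positivity) hV0]
  have h1 : Real.exp ((κ - δ) * t) = Real.exp (κ * t) ^ (1 - δ / κ) := by
    rw [← Real.exp_mul]
    congr 1
    field_simp
  rw [h1]
  exact Real.rpow_le_rpow (Real.exp_pos _).le ((le_inv_mul_iff₀ hc).2 hV) h0

end

end SLCount

open SLCount in
theorem stmt12 (d : ℕ) (hd : 2 ≤ d)
    (μ : Measure (Matrix.SpecialLinearGroup (Fin d) ℝ)) [μ.IsHaarMeasure]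
    (h : MvPolynomial (Fin d × Fin d) ℤ)
    (hnv : ∃ g : Matrix.SpecialLinearGroup (Fin d) ℝ,
      MvPolynomial.aeval (fun p : Fin d × Fin d =>
        (g : Matrix (Fin d) (Fin d) ℝ) p.1 p.2) h ≠ 0) :
    ∃ κ > (0 : ℝ), ∃ C > (0 : ℝ), ∀ t : ℝ, t > 1 →
      {γ : Matrix.SpecialLinearGroup (Fin d) ℤ | toSLR γ ∈ Dt d t ∧
        MvPolynomial.eval (fun p : Fin d × Fin d =>
          (γ : Matrix (Fin d) (Fin d) ℤ) p.1 p.2) h = 0}.Finite ∧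
      ({γ : Matrix.SpecialLinearGroup (Fin d) ℤ | toSLR γ ∈ Dt d t ∧
        MvPolynomial.eval (fun p : Fin d × Fin d =>
          (γ : Matrix (Fin d) (Fin d) ℤ) p.1 p.2) h = 0}.ncard : ℝ)
        ≤ C * (μ (Dt d t)).toReal ^ ((1 : ℝ) - κ) := by
  obtain ⟨g₁, hg₁⟩ := hnv
  obtain ⟨k, Λ, hΛ⟩ := exists_linear_functional h
  obtain ⟨κ, hκ, ⟨c, hc, hlow⟩, hgrowth⟩ := exists_growth hd μ
  have hg₁' : tensorMat (Fin k) g₁.1 ∉ LinearMap.ker Λ := fun hmem =>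
    hg₁ ((hΛ g₁.1).trans (LinearMap.mem_ker.1 hmem))
  obtain ⟨δ, hδ, C, hC, hcount⟩ := exists_card_mem_submodule_le hd μ hκ hgrowth _ hg₁'
    (Module.finrank ℝ (LinearMap.ker Λ))
  have hc' : 0 < c ^ (1 - min δ κ / κ) := Real.rpow_pos_of_pos hc _
  refine ⟨min δ κ / κ, div_pos (lt_min hδ hκ) hκ, C * (c ^ (1 - min δ κ / κ))⁻¹, by positivity,
    fun t ht => ?_⟩
  have ht0 : 0 ≤ t := by linarith
  have hfin : {γ : Matrix.SpecialLinearGroup (Fin d) ℤ | toSLR γ ∈ Dt d t ∧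
      MvPolynomial.eval (fun p : Fin d × Fin d => γ.1 p.1 p.2) h = 0}.Finite :=
    (finite_toSLR_mem_Dt ht0).subset fun γ hγ => hγ.1
  refine ⟨hfin, ?_⟩
  rw [Set.ncard_eq_toFinset_card _ hfin]
  refine (hcount _ le_rfl le_rfl t ht0 hfin.toFinset fun γ hγ => ?_).trans ?_
  · have hγ' := hfin.mem_toFinset.1 hγ
    refine ⟨hγ'.1, LinearMap.mem_ker.2 ?_⟩
    rw [← hΛ]
    exact (aeval_toSLR_eq_zero_iff h γ).2 hγ'.2
  · rw [mul_assoc]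
    refine mul_le_mul_of_nonneg_left ?_ hC.le
    calc Real.exp ((κ - δ) * t) ≤ Real.exp ((κ - min δ κ) * t) :=
          Real.exp_le_exp.2 (mul_le_mul_of_nonneg_right (by linarith [min_le_left δ κ]) ht0)
      _ ≤ _ := exp_le_rpow_of_growth hκ (min_le_right _ _) hc (hlow t ht.le)
end
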